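/- arXiv:1505.01523 — 4 statements merged into one kernel-verified Lean document; each statement's English description precedes it below -/
import Mathlib

section
/- Chernoff-style upper tail for simple tabulation (Theorem 1, upper bound): for every constant c ≥ 1 and every constant γ > 0 there exist constants α > 0 and C such that the following holds. Let h : Σ^c → [m] be a random simple tabulation hash function (m a power of two), let S ⊆ Σ^c be a set of n keys with m ≥ n^{1−1/(2c)}, let q ∉ S be a query key, and let the bin b ∈ [m] be an arbitrary function of h(q). If X is the number of keys x ∈ S with h(x) = b and μ = n/m, then for every δ > 0, Pr[X ≥ (1+δ)μ] ≤ (e^δ/(1+δ)^{(1+δ)})^{α μ} + C/m^γ. -/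
open scoped Classical
open Finset

/-- Bit strings of length `n`, identified with `(𝔽₂)^n`; bitwise XOR is
coordinatewise addition in `ZMod 2`.  This models the set `[2^n]`. -/
abbrev Bits (n : ℕ) : Type := Fin n → ZMod 2

/-- Probability of an event under the uniform distribution on a finite sample space. -/
noncomputable def Pr {Ω : Type*} [Fintype Ω] (E : Ω → Prop) : ℝ :=
  ((Finset.univ.filter E).card : ℝ) / (Fintype.card Ω : ℝ)

/-- Simple tabulation hashing with `c` random character tables. -/
def simpleTab {c : ℕ} {A R : Type*} [AddCommMonoid R] (T : Fin c → A → R) (x : Fin c → A) : R :=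
  ∑ i, T i (x i)

namespace TabAux

variable {c s r : ℕ}

/-- The table that is `v` at entry `(i, a)` and zero elsewhere. -/
def bump (i : Fin c) (a : Bits s) (v : Bits r) : Fin c → Bits s → Bits r :=
  fun j b => if j = i ∧ b = a then v else 0

lemma simpleTab_bump (T : Fin c → Bits s → Bits r) (i : Fin c) (a : Bits s) (v : Bits r)
    (x : Fin c → Bits s) :
    simpleTab (T + bump i a v) x = simpleTab T x + if x i = a then v else 0 := by
  unfold simpleTab bump
  simp only [Pi.add_apply, Finset.sum_add_distrib]
  congr 1
  rw [Finset.sum_eq_single i]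
  · simp
  · intro j _ hj
    simp [hj]
  · simp

lemma sum_bump (i : Fin c) (a : Bits s) (F : (Fin c → Bits s → Bits r) → ℝ) :
    (2 : ℝ) ^ r * ∑ T, F T = ∑ T, ∑ v : Bits r, F (T + bump i a v) := by
  rw [Finset.sum_comm]
  have : ∀ v : Bits r, ∑ T, F (T + bump i a v) = ∑ T, F T := fun v =>
    Fintype.sum_equiv (Equiv.addRight (bump i a v)) _ _ (fun T => rfl)
  simp [this]

/-- Each key has a character not occurring in the later keys. -/
def Peel : (k : ℕ) → (Fin (k + 1) → Fin c → Bits s) → Prop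
  | 0, _ => True
  | k + 1, g => (∃ i, ∀ l : Fin (k + 1), g l.succ i ≠ g 0 i) ∧ Peel k (Fin.tail g)

lemma exists_peel (k : ℕ) : ∀ A : Finset (Fin c → Bits s), 2 ^ k ≤ A.card →
    ∃ g : Fin (k + 1) → Fin c → Bits s, (∀ j, g j ∈ A) ∧ Peel k g := by
  induction k with
  | zero =>
    intro A hA
    obtain ⟨x, hx⟩ := Finset.card_pos.1 (by simpa using hA)
    exact ⟨fun _ => x, fun _ => hx, trivial⟩
  | succ k ih =>
    intro A hA
    have key : ∀ (i : Fin c) (x : Fin c → Bits s), x ∈ A →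
        2 ^ k ≤ (A.filter fun z => z i ≠ x i).card →
        ∃ g : Fin (k + 1 + 1) → Fin c → Bits s, (∀ j, g j ∈ A) ∧ Peel (k + 1) g := by
      intro i x hx h
      obtain ⟨g, hg, hp⟩ := ih _ h
      refine ⟨Fin.cons x g, ?_, ?_, ?_⟩
      · intro j
        refine Fin.cases ?_ (fun j => ?_) j
        · simpa using hx
        · simpa using (Finset.mem_filter.1 (hg j)).1
      · refine ⟨i, fun l => ?_⟩
        simpa using (Finset.mem_filter.1 (hg l)).2
      · simpa using hp
    have h1 : 1 < A.card := by
      have : 1 ≤ 2 ^ k := Nat.one_le_two_pow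
      rw [pow_succ] at hA
      omega
    obtain ⟨x, hx, y, hy, hxy⟩ := Finset.one_lt_card.1 h1
    obtain ⟨i, hi⟩ := Function.ne_iff.1 hxy
    have hsum : A.card ≤ (A.filter fun z => z i ≠ x i).card + (A.filter fun z => z i ≠ y i).card := by
      rw [← Finset.card_union_add_card_inter]
      refine le_trans (Finset.card_le_card ?_) (Nat.le_add_right _ _)
      intro z hz
      simp only [Finset.mem_union, Finset.mem_filter, hz, true_and]
      by_contra hcon
      push Not at hcon
      exact hi (hcon.1.symm.trans hcon.2)
    rw [pow_succ] at hA
    rcases le_or_gt (2 ^ k) (A.filter fun z => z i ≠ x i).card with h | h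
    · exact key i x hx h
    · exact key i y hy (by omega)

/-- All keys of the tuple hash to the same value. -/
def Coll {k : ℕ} (g : Fin (k + 1) → Fin c → Bits s) (T : Fin c → Bits s → Bits r) : Prop :=
  ∃ v, ∀ j, simpleTab T (g j) = v

lemma coll_bound (k : ℕ) : ∀ g : Fin (k + 1) → Fin c → Bits s, Peel k g →
    ((2 : ℝ) ^ r) ^ k * ∑ T : Fin c → Bits s → Bits r, (if Coll g T then (1 : ℝ) else 0) ≤
      (Fintype.card (Fin c → Bits s → Bits r) : ℝ) := by
  induction k with
  | zero =>
    intro g _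
    rw [pow_zero, one_mul, Finset.sum_boole]
    exact_mod_cast Finset.card_le_univ _
  | succ k ih =>
    intro g hp
    obtain ⟨⟨i, hi⟩, hp⟩ := hp
    refine le_trans ?_ (ih _ hp)
    rw [pow_succ, mul_assoc, sum_bump i (g 0 i)]
    refine mul_le_mul_of_nonneg_left (Finset.sum_le_sum fun T _ => ?_) (by positivity)
    have hshift : ∀ v, Coll g (T + bump i (g 0 i) v) → Coll (Fin.tail g) T ∧
        v = simpleTab T (g (Fin.succ 0)) - simpleTab T (g 0) := by
      rintro v ⟨w, hw⟩
      have hw' : ∀ l : Fin (k + 1), simpleTab T (g l.succ) = w := by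
        intro l
        have := hw l.succ
        rwa [simpleTab_bump, if_neg (hi l), add_zero] at this
      refine ⟨⟨w, hw'⟩, ?_⟩
      have h0 := hw 0
      rw [simpleTab_bump, if_pos rfl] at h0
      rw [hw' 0, ← h0]
      abel
    split_ifs with hT
    · calc _ ≤ ∑ v : Bits r, if v = simpleTab T (g (Fin.succ 0)) - simpleTab T (g 0)
            then (1 : ℝ) else 0 := by
            refine Finset.sum_le_sum fun v _ => ?_
            split_ifs with h1 h2 h2
            · exact le_rfl
            · exact absurd (hshift v h1).2 h2
            · exact zero_le_one
            · exact le_rfl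
        _ = 1 := by
            rw [Finset.sum_eq_single (simpleTab T (g (Fin.succ 0)) - simpleTab T (g 0))]
            · exact if_pos rfl
            · intro b _ hb
              exact if_neg hb
            · intro h
              exact absurd (Finset.mem_univ _) h
        _ ≤ 1 := le_rfl
    · refine le_of_eq (Finset.sum_eq_zero fun v _ => if_neg fun h => hT (hshift v h).1)

/-- Some bin receives at least `2^k` keys of `G`. -/
def Over (k : ℕ) (G : Finset (Fin c → Bits s)) (T : Fin c → Bits s → Bits r) : Prop :=
  ∃ v, 2 ^ k ≤ (G.filter fun x => simpleTab T x = v).card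

lemma over_bound (k : ℕ) (G : Finset (Fin c → Bits s)) :
    ((2 : ℝ) ^ r) ^ k * ∑ T : Fin c → Bits s → Bits r, (if Over k G T then (1 : ℝ) else 0) ≤
      (G.card : ℝ) ^ (k + 1) * (Fintype.card (Fin c → Bits s → Bits r) : ℝ) := by
  let P : Finset (Fin (k + 1) → Fin c → Bits s) :=
    (Fintype.piFinset fun _ => G).filter fun g => Peel k g
  have hP : (P.card : ℝ) ≤ (G.card : ℝ) ^ (k + 1) := by
    have : P.card ≤ G.card ^ (k + 1) := by
      refine (Finset.card_filter_le _ _).trans ?_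
      simp
    exact_mod_cast this
  have h1 : ∑ T : Fin c → Bits s → Bits r, (if Over k G T then (1 : ℝ) else 0) ≤
      ∑ g ∈ P, ∑ T : Fin c → Bits s → Bits r, (if Coll g T then (1 : ℝ) else 0) := by
    rw [Finset.sum_comm]
    refine Finset.sum_le_sum fun T _ => ?_
    have hnn : ∀ g ∈ P, (0 : ℝ) ≤ if Coll g T then (1 : ℝ) else 0 := by
      intro g _
      split_ifs <;> norm_num
    split_ifs with h
    · obtain ⟨v, hv⟩ := h
      obtain ⟨g, hg, hp⟩ := exists_peel k _ hv
      have hgP : g ∈ P := by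
        simp only [P, Finset.mem_filter, Fintype.mem_piFinset]
        exact ⟨fun j => (Finset.mem_filter.1 (hg j)).1, hp⟩
      have hc : Coll g T := ⟨v, fun j => (Finset.mem_filter.1 (hg j)).2⟩
      have := Finset.single_le_sum hnn hgP
      rwa [if_pos hc] at this
    · exact Finset.sum_nonneg hnn
  calc _ ≤ ((2 : ℝ) ^ r) ^ k * ∑ g ∈ P, ∑ T : Fin c → Bits s → Bits r,
        (if Coll g T then (1 : ℝ) else 0) := by gcongr
    _ = ∑ g ∈ P, ((2 : ℝ) ^ r) ^ k * ∑ T : Fin c → Bits s → Bits r,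
        (if Coll g T then (1 : ℝ) else 0) := Finset.mul_sum _ _ _
    _ ≤ ∑ g ∈ P, (Fintype.card (Fin c → Bits s → Bits r) : ℝ) :=
        Finset.sum_le_sum fun g hg => coll_bound k g (Finset.mem_filter.1 hg).2
    _ = (P.card : ℝ) * (Fintype.card (Fin c → Bits s → Bits r) : ℝ) := by
        rw [Finset.sum_const, nsmul_eq_mul]
    _ ≤ _ := by gcongr

lemma exists_group (hc : 1 ≤ c) (S : Finset (Fin c → Bits s)) (q : Fin c → Bits s)
    (hq : q ∉ S) (hS : S.Nonempty) :
    ∃ (i : Fin c) (a : Bits s), a ≠ q i ∧ (S.filter fun x => x i = a).Nonempty ∧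
      (S.filter fun x => x i = a).card ^ c ≤ 2 ^ c * S.card ^ (c - 1) := by
  let A : Fin c → Finset (Bits s) := fun i => (S.image fun x => x i).erase (q i)
  have : Nonempty (Fin c) := ⟨⟨0, hc⟩⟩
  obtain ⟨i, -, hi⟩ := Finset.exists_max_image (Finset.univ : Finset (Fin c))
    (fun i => (A i).card) Finset.univ_nonempty
  have hM : 1 ≤ (A i).card := by
    obtain ⟨x, hx⟩ := hS
    have hne : x ≠ q := fun h => hq (h ▸ hx)
    obtain ⟨j, hj⟩ := Function.ne_iff.1 hne
    have : x j ∈ A j := Finset.mem_erase.2 ⟨hj, Finset.mem_image_of_mem _ hx⟩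
    exact (Finset.card_pos.2 ⟨_, this⟩).trans_le (hi j (Finset.mem_univ _))
  have hcard : S.card ≤ ((A i).card + 1) ^ c := by
    have hsub : S ⊆ Fintype.piFinset fun j => insert (q j) (A j) := by
      intro x hx
      rw [Fintype.mem_piFinset]
      intro j
      by_cases h : x j = q j
      · rw [h]; exact Finset.mem_insert_self _ _
      · exact Finset.mem_insert_of_mem
          (Finset.mem_erase.2 ⟨h, Finset.mem_image_of_mem (fun x : Fin c → Bits s => x j) hx⟩)
    refine (Finset.card_le_card hsub).trans ?_
    rw [Fintype.card_piFinset]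
    refine (Finset.prod_le_pow_card _ _ ((A i).card + 1) fun j _ => ?_).trans (by simp)
    exact (Finset.card_insert_le _ _).trans (Nat.succ_le_succ (hi j (Finset.mem_univ _)))
  have hne : (A i).Nonempty := Finset.card_pos.1 hM
  obtain ⟨a, ha, hmin⟩ := Finset.exists_min_image (A i)
    (fun a => (S.filter fun x => x i = a).card) hne
  have hprod : (A i).card * (S.filter fun x => x i = a).card ≤ S.card := by
    calc (A i).card * (S.filter fun x => x i = a).card
        = ∑ _b ∈ A i, (S.filter fun x => x i = a).card := by simp
      _ ≤ ∑ b ∈ A i, (S.filter fun x => x i = b).card := Finset.sum_le_sum hmin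
      _ ≤ S.card := by
          have hd : (↑(A i) : Set (Bits s)).PairwiseDisjoint fun b => S.filter fun x => x i = b := by
            intro b _ b' _ hbb
            refine Finset.disjoint_left.2 fun x hx hx' => hbb ?_
            exact (Finset.mem_filter.1 hx).2.symm.trans (Finset.mem_filter.1 hx').2
          rw [← Finset.card_biUnion hd]
          refine Finset.card_le_card fun x hx => ?_
          obtain ⟨b, _, hb⟩ := Finset.mem_biUnion.1 hx
          exact (Finset.mem_filter.1 hb).1
  refine ⟨i, a, (Finset.mem_erase.1 ha).1, ?_, ?_⟩
  · obtain ⟨x, hx, hxa⟩ := Finset.mem_image.1 (Finset.mem_erase.1 ha).2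
    exact ⟨x, Finset.mem_filter.2 ⟨hx, hxa⟩⟩
  · have hpos : 0 < (A i).card ^ c := by positivity
    refine Nat.le_of_mul_le_mul_left ?_ hpos
    calc (A i).card ^ c * (S.filter fun x => x i = a).card ^ c
        = ((A i).card * (S.filter fun x => x i = a).card) ^ c := (mul_pow _ _ _).symm
      _ ≤ S.card ^ c := Nat.pow_le_pow_left hprod c
      _ = S.card * S.card ^ (c - 1) := by
          rw [← pow_succ']; congr 1; omega
      _ ≤ (2 * (A i).card) ^ c * S.card ^ (c - 1) := by
          refine Nat.mul_le_mul_right _ (hcard.trans (Nat.pow_le_pow_left ?_ c))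
          omega
      _ = _ := by rw [mul_pow]; ring

/-- Number of keys of `S` in the query-determined bin. -/
noncomputable def cnt (S : Finset (Fin c → Bits s)) (q : Fin c → Bits s) (f : Bits r → Bits r)
    (T : Fin c → Bits s → Bits r) : ℕ :=
  (S.filter fun x => simpleTab T x = f (simpleTab T q)).card

lemma exp_conv {l d y : ℝ} (hd : 0 < d) (hy : 0 ≤ y) (hyd : y ≤ d) :
    Real.exp (l * y) ≤ 1 + y * ((Real.exp (l * d) - 1) / d) := by
  have h := convexOn_exp.2 (Set.mem_univ (0 : ℝ)) (Set.mem_univ (l * d))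
    (sub_nonneg.2 ((div_le_one hd).2 hyd)) (div_nonneg hy hd.le) (sub_add_cancel 1 (y / d))
  simp only [smul_eq_mul, mul_zero, zero_add, Real.exp_zero, mul_one] at h
  have e : y / d * (l * d) = l * y := by field_simp
  rw [e] at h
  refine h.trans (le_of_eq ?_)
  field_simp
  ring

lemma main_ind (hc : 1 ≤ c) (q : Fin c → Bits s) (f : Bits r → Bits r) (k n : ℕ)
    (l ε : ℝ) (hε : 0 ≤ ε)
    (hsmall : ∀ g : ℕ, g ^ c ≤ 2 ^ c * n ^ (c - 1) →
      (g : ℝ) ^ (k + 1) ≤ ε * ((2 : ℝ) ^ r) ^ k) (N : ℕ) :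
    ∀ S : Finset (Fin c → Bits s), S.card = N → N ≤ n → q ∉ S →
    ∃ Good : (Fin c → Bits s → Bits r) → Prop,
      (∀ i a v T, a ≠ q i → (∀ x ∈ S, x i ≠ a) → (Good (T + bump i a v) ↔ Good T)) ∧
      (∑ T : Fin c → Bits s → Bits r, (if Good T then (0 : ℝ) else 1)) ≤
        N * ε * (Fintype.card (Fin c → Bits s → Bits r) : ℝ) ∧
      (∑ T : Fin c → Bits s → Bits r, (if Good T then Real.exp (l * cnt S q f T) else 0)) ≤
        Real.exp (N / (2 : ℝ) ^ r * ((Real.exp (l * (2 : ℝ) ^ k) - 1) / (2 : ℝ) ^ k)) *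
          (Fintype.card (Fin c → Bits s → Bits r) : ℝ) := by
  induction N using Nat.strong_induction_on with
  | _ N ih =>
  intro S hSN hN hq
  rcases S.eq_empty_or_nonempty with rfl | hS
  · have : N = 0 := by simpa using hSN.symm
    subst this
    refine ⟨fun _ => True, by simp, by simp, by simp [cnt]⟩
  obtain ⟨i, a, haq, hGne, hGc⟩ := exists_group hc S q hq hS
  set G := S.filter fun x => x i = a with hG
  set S' := S.filter fun x => ¬ x i = a with hS'
  have hsplit : G.card + S'.card = N := by
    rw [← hSN]; exact Finset.card_filter_add_card_filter_not _
  have hGpos : 0 < G.card := Finset.card_pos.2 hGne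
  obtain ⟨Good, hinv, hbad, hmgf⟩ := ih S'.card (by omega) S' rfl (by omega)
    (fun h => hq (Finset.mem_filter.1 h).1)
  have hS'a : ∀ x ∈ S', x i ≠ a := fun x hx => (Finset.mem_filter.1 hx).2
  have hqb : ∀ (i : Fin c) (a : Bits s) (v : Bits r) (T : Fin c → Bits s → Bits r), a ≠ q i →
      simpleTab (T + bump i a v) q = simpleTab T q := by
    intro i a v T h
    rw [simpleTab_bump, if_neg (Ne.symm h), add_zero]
  have hGb : ∀ (v : Bits r) (T : Fin c → Bits s → Bits r), ∀ x ∈ G,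
      simpleTab (T + bump i a v) x = simpleTab T x + v := by
    intro v T x hx
    rw [simpleTab_bump, if_pos (Finset.mem_filter.1 hx).2]
  have hOvMono : ∀ (v : Bits r) (T : Fin c → Bits s → Bits r),
      Over k G (T + bump i a v) ↔ Over k G T := by
    intro v T
    have e : ∀ w, (G.filter fun x => simpleTab (T + bump i a v) x = w) =
        G.filter fun x => simpleTab T x = w - v := by
      intro w
      refine Finset.filter_congr fun x hx => ?_
      rw [hGb v T x hx, eq_sub_iff_add_eq]
    constructor
    · rintro ⟨w, hw⟩
      rw [e] at hw
      exact ⟨_, hw⟩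
    · rintro ⟨w, hw⟩
      refine ⟨w + v, ?_⟩
      rw [e, add_sub_cancel_right]
      exact hw
  have hcntS' : ∀ (v : Bits r) (T : Fin c → Bits s → Bits r),
      cnt S' q f (T + bump i a v) = cnt S' q f T := by
    intro v T
    unfold cnt
    congr 1
    refine Finset.filter_congr fun x hx => ?_
    rw [hqb i a v T haq, simpleTab_bump, if_neg (hS'a x hx), add_zero]
  have hcnt : ∀ T : Fin c → Bits s → Bits r, cnt S q f T = cnt G q f T + cnt S' q f T := by
    intro T
    unfold cnt
    rw [hG, hS', Finset.filter_filter, Finset.filter_filter,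
      ← Finset.card_filter_add_card_filter_not (s := S.filter fun x =>
        simpleTab T x = f (simpleTab T q)) (fun x => x i = a),
      Finset.filter_filter, Finset.filter_filter]
    simp only [and_comm]
  have hsum : ((G.card : ℝ) + S'.card) = N := by exact_mod_cast hsplit
  refine ⟨fun T => Good T ∧ ¬ Over k G T, ?_, ?_, ?_⟩
  · intro j b v T hb hx
    have h1 := hinv j b v T hb (fun x h => hx x (Finset.mem_filter.1 h).1)
    have h2 : Over k G (T + bump j b v) ↔ Over k G T := by
      have e : ∀ w, (G.filter fun x => simpleTab (T + bump j b v) x = w) =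
          G.filter fun x => simpleTab T x = w := by
        intro w
        refine Finset.filter_congr fun x h => ?_
        rw [simpleTab_bump, if_neg (hx x (Finset.mem_filter.1 h).1), add_zero]
      unfold Over
      simp only [e]
    exact and_congr h1 (not_congr h2)
  · have hov : ∑ T : Fin c → Bits s → Bits r, (if Over k G T then (1 : ℝ) else 0) ≤
        ε * (Fintype.card (Fin c → Bits s → Bits r) : ℝ) := by
      have h1 := over_bound (r := r) k G
      have h2 := hsmall G.card (hGc.trans (Nat.mul_le_mul_left _
        (Nat.pow_le_pow_left (hSN.le.trans hN) _)))
      have hp : (0 : ℝ) < ((2 : ℝ) ^ r) ^ k := by positivity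
      refine le_of_mul_le_mul_left (h1.trans ?_) hp
      calc _ ≤ ε * ((2 : ℝ) ^ r) ^ k * (Fintype.card (Fin c → Bits s → Bits r) : ℝ) := by
            gcongr
        _ = _ := by ring
    have h1 : (1 : ℝ) ≤ G.card := by exact_mod_cast hGpos
    calc _ ≤ ∑ T : Fin c → Bits s → Bits r, ((if Good T then (0 : ℝ) else 1) +
          (if Over k G T then (1 : ℝ) else 0)) := by
            refine Finset.sum_le_sum fun T _ => ?_
            by_cases hg : Good T <;> by_cases ho : Over k G T <;> simp [hg, ho]
      _ ≤ S'.card * ε * (Fintype.card (Fin c → Bits s → Bits r) : ℝ) +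
          ε * (Fintype.card (Fin c → Bits s → Bits r) : ℝ) := by
            rw [Finset.sum_add_distrib]; exact add_le_add hbad hov
      _ = (S'.card + 1) * (ε * (Fintype.card (Fin c → Bits s → Bits r) : ℝ)) := by ring
      _ ≤ N * (ε * (Fintype.card (Fin c → Bits s → Bits r) : ℝ)) := by
            refine mul_le_mul_of_nonneg_right (by linarith) (by positivity)
      _ = _ := by ring
  · set K : ℝ := (Real.exp (l * (2 : ℝ) ^ k) - 1) / (2 : ℝ) ^ k with hK
    have hm : (0 : ℝ) < (2 : ℝ) ^ r := by positivity
    have hin : ∀ T : Fin c → Bits s → Bits r, ¬ Over k G T →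
        ∑ v : Bits r, Real.exp (l * cnt G q f (T + bump i a v)) ≤
          (2 : ℝ) ^ r * Real.exp (G.card / (2 : ℝ) ^ r * K) := by
      intro T hT
      have hle : ∀ v : Bits r, (cnt G q f (T + bump i a v) : ℝ) ≤ (2 : ℝ) ^ k := by
        intro v
        have h0 : ¬ Over k G (T + bump i a v) := fun h => hT ((hOvMono v T).1 h)
        have : cnt G q f (T + bump i a v) ≤ 2 ^ k := by
          by_contra hcon
          exact h0 ⟨_, (not_le.1 hcon).le⟩
        exact_mod_cast this
      have htot : ∑ v : Bits r, (cnt G q f (T + bump i a v) : ℝ) = G.card := by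
        have : ∑ v : Bits r, cnt G q f (T + bump i a v) = G.card := by
          unfold cnt
          simp only [Finset.card_filter]
          rw [Finset.sum_comm, Finset.card_eq_sum_ones]
          refine Finset.sum_congr rfl fun x hx => ?_
          rw [Finset.sum_eq_single (f (simpleTab T q) - simpleTab T x)]
          · rw [if_pos]
            rw [hGb _ T x hx, hqb i a _ T haq]
            abel
          · intro v _ hv
            refine if_neg fun h => hv ?_
            rw [hGb _ T x hx, hqb i a _ T haq] at h
            rw [← h]
            abel
          · intro h
            exact absurd (Finset.mem_univ _) h
        exact_mod_cast this
      calc _ ≤ ∑ v : Bits r, (1 + (cnt G q f (T + bump i a v) : ℝ) * K) :=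
            Finset.sum_le_sum fun v _ => exp_conv (by positivity) (by positivity) (hle v)
        _ = (2 : ℝ) ^ r + G.card * K := by
            rw [Finset.sum_add_distrib, ← Finset.sum_mul, htot]
            simp
        _ = (2 : ℝ) ^ r * (G.card / (2 : ℝ) ^ r * K + 1) := by field_simp; ring
        _ ≤ _ := by
            gcongr
            exact Real.add_one_le_exp _
    refine le_of_mul_le_mul_left ?_ hm
    rw [sum_bump i a]
    calc _ ≤ ∑ T : Fin c → Bits s → Bits r, (if Good T then Real.exp (l * cnt S' q f T) else 0) *
          ((2 : ℝ) ^ r * Real.exp (G.card / (2 : ℝ) ^ r * K)) := by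
            refine Finset.sum_le_sum fun T _ => ?_
            have hg : ∀ v, Good (T + bump i a v) ↔ Good T := fun v => hinv i a v T haq hS'a
            simp only [hg, hOvMono, hcnt, hcntS']
            by_cases h1 : Good T
            · by_cases h2 : Over k G T
              · simp only [h1, h2, not_true_eq_false, and_false, if_false, if_true,
                  Finset.sum_const_zero]
                positivity
              · simp only [h1, h2, not_false_eq_true, and_true, if_true]
                push_cast
                simp only [mul_add, Real.exp_add]
                rw [← Finset.sum_mul, mul_comm]
                exact mul_le_mul_of_nonneg_left (hin T h2) (Real.exp_pos _).le
            · simp [h1]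
      _ ≤ _ := by
            rw [← Finset.sum_mul]
            refine (mul_le_mul_of_nonneg_right hmgf (by positivity)).trans (le_of_eq ?_)
            rw [← hsum, add_div, add_mul, Real.exp_add]
            ring

end TabAux

namespace TabAux

lemma num_bound (c' L u m n g : ℕ) (hu : u + 1 = (c' + 1) * L)
    (hn : n ^ (2 * c' + 1) ≤ m ^ (2 * (c' + 1)))
    (hg : g ^ (c' + 1) ≤ 2 ^ (c' + 1) * n ^ c') :
    g ^ (2 * (c' + 1) * c' * L + u + 1) ≤
      2 ^ (2 * (c' + 1) * c' * L + u + 1) * m ^ (2 * (c' + 1) * c' * L) := by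
  have e : 2 * (c' + 1) * c' * L + u + 1 = (c' + 1) * ((2 * c' + 1) * L) := by
    rw [add_assoc, hu]; ring
  rw [e]
  calc g ^ ((c' + 1) * ((2 * c' + 1) * L)) = (g ^ (c' + 1)) ^ ((2 * c' + 1) * L) := pow_mul _ _ _
    _ ≤ (2 ^ (c' + 1) * n ^ c') ^ ((2 * c' + 1) * L) := Nat.pow_le_pow_left hg _
    _ = 2 ^ ((c' + 1) * ((2 * c' + 1) * L)) * (n ^ (2 * c' + 1)) ^ (c' * L) := by
        rw [mul_pow, ← pow_mul, ← pow_mul, ← pow_mul]; congr 2; ring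
    _ ≤ 2 ^ ((c' + 1) * ((2 * c' + 1) * L)) * (m ^ (2 * (c' + 1))) ^ (c' * L) :=
        Nat.mul_le_mul_left _ (Nat.pow_le_pow_left hn _)
    _ = _ := by rw [← pow_mul]; congr 2; ring

lemma card_pow_le (c' n r : ℕ)
    (h : (n : ℝ) ^ ((1 : ℝ) - 1 / (2 * ((c' + 1 : ℕ) : ℝ))) ≤ (2 : ℝ) ^ r) :
    n ^ (2 * c' + 1) ≤ (2 ^ r) ^ (2 * (c' + 1)) := by
  have h1 := pow_le_pow_left₀ (by positivity) h (2 * (c' + 1))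
  rw [← Real.rpow_natCast, ← Real.rpow_mul (by positivity)] at h1
  have e : ((1 : ℝ) - 1 / (2 * ((c' + 1 : ℕ) : ℝ))) * ((2 * (c' + 1) : ℕ) : ℝ) =
      ((2 * c' + 1 : ℕ) : ℝ) := by
    push_cast
    have : (c' : ℝ) + 1 ≠ 0 := by positivity
    field_simp
    ring
  rw [e, Real.rpow_natCast] at h1
  exact_mod_cast h1

lemma card_le_sq (c' n m : ℕ) (hn : n ^ (2 * c' + 1) ≤ m ^ (2 * (c' + 1))) (hm : 1 ≤ m) :
    n ≤ m ^ 2 := by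
  refine le_of_pow_le_pow_left₀ (n := 2 * c' + 1) (by omega) (by positivity) (hn.trans ?_)
  rw [← pow_mul]
  exact Nat.pow_le_pow_right hm (by omega)

end TabAux

/-- Chernoff-style upper tail for simple tabulation (Theorem 1, upper
bound): for constants `c ≥ 1`, `γ > 0` there are constants `α > 0`, `C` such that when
`n` keys `S` are hashed into `m = 2^r ≥ n^{1-1/(2c)}` bins by random simple tabulation,
`q ∉ S` is a query key, and the bin `b = f(h(q))` is an arbitrary function of `h(q)`,
the number `X` of keys of `S` hashing to `b` satisfies, with `μ = n/m`, for all `δ > 0`: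
`Pr[X ≥ (1+δ)μ] ≤ (e^δ/(1+δ)^{1+δ})^{αμ} + C/m^γ`. -/
theorem simple_tabulation_chernoff_upper (c : ℕ) (hc : 1 ≤ c) (γ : ℝ) (hγ : 0 < γ) :
    ∃ α : ℝ, 0 < α ∧ ∃ C : ℝ,
      ∀ (s r : ℕ) (S : Finset (Fin c → Bits s)) (q : Fin c → Bits s) (f : Bits r → Bits r),
        q ∉ S →
        (S.card : ℝ) ^ ((1 : ℝ) - 1 / (2 * (c : ℝ))) ≤ (2 : ℝ) ^ r →
        ∀ δ : ℝ, 0 < δ →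
          Pr (fun T : Fin c → Bits s → Bits r =>
              (1 + δ) * ((S.card : ℝ) / (2 : ℝ) ^ r) ≤
                ((S.filter fun x => simpleTab T x = f (simpleTab T q)).card : ℝ)) ≤
            (Real.exp δ / (1 + δ) ^ (1 + δ)) ^ (α * ((S.card : ℝ) / (2 : ℝ) ^ r)) +
              C / ((2 : ℝ) ^ r) ^ γ := by
  obtain ⟨c', rfl⟩ : ∃ c', c = c' + 1 := ⟨c - 1, by omega⟩
  obtain ⟨L, hL⟩ : ∃ L : ℕ, L = ⌈γ⌉₊ + 3 := ⟨_, rfl⟩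
  obtain ⟨u, hu⟩ : ∃ u : ℕ, u + 1 = (c' + 1) * L :=
    ⟨(c' + 1) * L - 1, Nat.sub_add_cancel (Nat.mul_pos (by omega) (by omega))⟩
  have huγ : γ + 2 ≤ (u : ℝ) := by
    have h1 : L ≤ u + 1 := by rw [hu]; exact Nat.le_mul_of_pos_left _ (by omega)
    have h2 : ⌈γ⌉₊ + 2 ≤ u := by omega
    have h3 : ((⌈γ⌉₊ + 2 : ℕ) : ℝ) ≤ (u : ℝ) := by exact_mod_cast h2
    push_cast at h3
    linarith [Nat.le_ceil γ]
  obtain ⟨k, hk⟩ : ∃ k : ℕ, k = 2 * (c' + 1) * c' * L + u := ⟨_, rfl⟩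
  refine ⟨1 / (2 : ℝ) ^ k, by positivity, (2 : ℝ) ^ (k + 1), ?_⟩
  intro s r S q f hq hcard δ hδ
  have hn := TabAux.card_pow_le c' S.card r hcard
  have hn2 := TabAux.card_le_sq c' S.card (2 ^ r) hn Nat.one_le_two_pow
  have hn2' : (S.card : ℝ) ≤ ((2 : ℝ) ^ r) ^ 2 := by exact_mod_cast hn2
  have hm : (0 : ℝ) < (2 : ℝ) ^ r := by positivity
  have hm1 : (1 : ℝ) ≤ (2 : ℝ) ^ r := one_le_pow₀ (by norm_num)
  obtain ⟨m, hmdef⟩ : ∃ m : ℝ, m = (2 : ℝ) ^ r := ⟨_, rfl⟩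
  have hsmall : ∀ g : ℕ, g ^ (c' + 1) ≤ 2 ^ (c' + 1) * S.card ^ (c' + 1 - 1) →
      (g : ℝ) ^ (k + 1) ≤ (2 : ℝ) ^ (k + 1) / ((2 : ℝ) ^ r) ^ u * ((2 : ℝ) ^ r) ^ k := by
    intro g hg
    have h1 := TabAux.num_bound c' L u (2 ^ r) S.card g hu hn hg
    rw [← hk] at h1
    have h2 : (g : ℝ) ^ (k + 1) ≤ (2 : ℝ) ^ (k + 1) * ((2 : ℝ) ^ r) ^ (2 * (c' + 1) * c' * L) := by
      exact_mod_cast h1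
    refine h2.trans (le_of_eq ?_)
    rw [← hmdef] at hm ⊢
    have e : m ^ k = m ^ (2 * (c' + 1) * c' * L) * m ^ u := by rw [hk, pow_add]
    rw [e]
    field_simp
  obtain ⟨l, hl⟩ : ∃ l : ℝ, l = Real.log (1 + δ) / (2 : ℝ) ^ k := ⟨_, rfl⟩
  have h2k : (0 : ℝ) < (2 : ℝ) ^ k := by positivity
  have hlpos : 0 ≤ l := by
    rw [hl]; exact div_nonneg (Real.log_nonneg (by linarith)) h2k.le
  have hexp : Real.exp (l * (2 : ℝ) ^ k) = 1 + δ := by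
    rw [hl, div_mul_cancel₀ _ h2k.ne', Real.exp_log (by linarith)]
  obtain ⟨Good, -, hbad, hmgf⟩ := TabAux.main_ind hc q f k S.card l
    ((2 : ℝ) ^ (k + 1) / ((2 : ℝ) ^ r) ^ u) (by positivity) hsmall S.card S rfl le_rfl hq
  rw [hexp] at hmgf
  obtain ⟨t, ht⟩ : ∃ t : ℝ, t = (1 + δ) * ((S.card : ℝ) / (2 : ℝ) ^ r) := ⟨_, rfl⟩
  have hΩ : (0 : ℝ) < (Fintype.card (Fin (c' + 1) → Bits s → Bits r) : ℝ) := by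
    exact_mod_cast Fintype.card_pos
  unfold Pr
  rw [div_le_iff₀ hΩ, ← Finset.sum_boole]
  have hpt : ∀ T : Fin (c' + 1) → Bits s → Bits r,
      (if (1 + δ) * ((S.card : ℝ) / (2 : ℝ) ^ r) ≤
        ((S.filter fun x => simpleTab T x = f (simpleTab T q)).card : ℝ) then (1 : ℝ) else 0) ≤
      Real.exp (-(l * t)) * (if Good T then Real.exp (l * TabAux.cnt S q f T) else 0) +
        (if Good T then (0 : ℝ) else 1) := by
    intro T
    rw [← ht]
    change (if t ≤ (TabAux.cnt S q f T : ℝ) then (1 : ℝ) else 0) ≤ _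
    by_cases hg : Good T
    · simp only [hg, if_true, add_zero]
      rw [← Real.exp_add]
      split_ifs with h
      · refine Real.one_le_exp ?_
        nlinarith [mul_le_mul_of_nonneg_left h hlpos]
      · exact (Real.exp_pos _).le
    · simp only [hg, if_false, mul_zero, zero_add]
      split_ifs <;> norm_num
  refine (Finset.sum_le_sum fun T _ => hpt T).trans ?_
  rw [Finset.sum_add_distrib, ← Finset.mul_sum, add_mul]
  refine add_le_add ?_ (hbad.trans ?_)
  · refine (mul_le_mul_of_nonneg_left hmgf (Real.exp_pos _).le).trans (le_of_eq ?_)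
    rw [← mul_assoc, ← Real.exp_add]
    congr 1
    have h1δ : (0 : ℝ) < 1 + δ := by linarith
    have hpw : (0 : ℝ) < (1 + δ) ^ (1 + δ) := Real.rpow_pos_of_pos h1δ _
    rw [Real.rpow_def_of_pos (div_pos (Real.exp_pos _) hpw), Real.log_div (Real.exp_pos _).ne' hpw.ne',
      Real.log_exp, Real.log_rpow h1δ, ht, hl]
    congr 1
    field_simp
    ring
  · refine mul_le_mul_of_nonneg_right ?_ hΩ.le
    rw [← hmdef] at hn2' hm hm1 ⊢
    have h1 : m ^ γ * m ^ 2 ≤ m ^ u := by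
      rw [← Real.rpow_natCast m 2, ← Real.rpow_natCast m u, ← Real.rpow_add hm]
      exact Real.rpow_le_rpow_of_exponent_le hm1 (by exact_mod_cast huγ)
    have hmγ : 0 < m ^ γ := Real.rpow_pos_of_pos hm _
    rw [← mul_div_assoc, div_le_div_iff₀ (by positivity) hmγ]
    calc (S.card : ℝ) * 2 ^ (k + 1) * m ^ γ ≤ m ^ 2 * 2 ^ (k + 1) * m ^ γ := by gcongr
      _ = 2 ^ (k + 1) * (m ^ γ * m ^ 2) := by ring
      _ ≤ _ := by gcongr
end

section
/- Chernoff-style lower tail for simple tabulation (Theorem 1, lower bound): for every constant c ≥ 1 and every constant γ > 0 there exist constants α > 0 and C such that the following holds. Let h : Σ^c → [m] be a random simple tabulation hash function (m a power of two), let S ⊆ Σ^c be a set of n keys with m ≥ n^{1−1/(2c)}, let q ∉ S be a query key, and let the bin b ∈ [m] be an arbitrary function of h(q). If X is the number of keys x ∈ S with h(x) = b and μ = n/m, then for every 0 < δ ≤ 1, Pr[X ≤ (1−δ)μ] ≤ (e^{−δ}/(1−δ)^{(1−δ)})^{α μ} + C/m^γ. -/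
open scoped Classical
open Finset

/-- Averaging over shifts of the sample space. -/
lemma shift_sum {Ω V : Type*} [Fintype Ω] [AddGroup Ω] [Fintype V] (D : V → Ω) (F : Ω → ℝ) :
    (Fintype.card V : ℝ) * ∑ T, F T = ∑ T, ∑ v, F (T + D v) := by
  rw [Finset.sum_comm]
  have : ∀ v, ∑ T, F (T + D v) = ∑ T, F T := fun v =>
    Equiv.sum_comp (Equiv.addRight (D v)) F
  simp [this]

lemma simpleTab_add {c : ℕ} {A R : Type*} [AddCommMonoid R] (T D : Fin c → A → R)
    (x : Fin c → A) : simpleTab (T + D) x = simpleTab T x + simpleTab D x := by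
  simp [simpleTab, Finset.sum_add_distrib]

/-- The table with a single nonzero row. -/
noncomputable def rowTab {c : ℕ} {A R : Type*} [AddCommMonoid R] (i : Fin c) (u : A → R) :
    Fin c → A → R := fun j => if j = i then u else 0

lemma simpleTab_rowTab {c : ℕ} {A R : Type*} [AddCommMonoid R] (i : Fin c) (u : A → R)
    (x : Fin c → A) : simpleTab (rowTab i u) x = u (x i) := by
  unfold simpleTab rowTab
  rw [Finset.sum_eq_single i]
  · simp
  · intro j _ hj
    simp [hj]
  · simp

/-- Keys with distinct characters in position `j` collide with small probability. -/
lemma collide_bound {c s r K : ℕ} (j : Fin c) (y : Fin K → Fin c → Bits s)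
    (hy : Function.Injective fun l => y l j) :
    (2 ^ r : ℝ) ^ K * ((univ.filter fun T : Fin c → Bits s → Bits r =>
      ∃ w, ∀ l, simpleTab T (y l) = w).card : ℝ) ≤
      2 ^ r * (Fintype.card (Fin c → Bits s → Bits r) : ℝ) := by
  have h := shift_sum (Ω := Fin c → Bits s → Bits r) (V := Fin K → Bits r)
    (fun v => rowTab j (Function.extend (fun l => y l j) v 0))
    (fun T => if ∃ w, ∀ l, simpleTab T (y l) = w then (1 : ℝ) else 0)
  have hcard : (Fintype.card (Fin K → Bits r) : ℝ) = (2 ^ r : ℝ) ^ K := by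
    simp [ZMod.card]
  have hcard1 : (Fintype.card (Bits r) : ℝ) = (2 ^ r : ℝ) := by
    simp [ZMod.card]
  rw [hcard] at h
  have e1 : ((univ.filter fun T : Fin c → Bits s → Bits r =>
      ∃ w, ∀ l, simpleTab T (y l) = w).card : ℝ) =
      ∑ T : Fin c → Bits s → Bits r, if ∃ w, ∀ l, simpleTab T (y l) = w then (1 : ℝ) else 0 := by
    rw [Finset.sum_boole]
  rw [e1, h]
  have hb : ∀ T : Fin c → Bits s → Bits r, (∑ v : Fin K → Bits r,
      if ∃ w, ∀ l, simpleTab (T + rowTab j (Function.extend (fun l => y l j) v 0)) (y l) = w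
        then (1 : ℝ) else 0) ≤ 2 ^ r := by
    intro T
    rw [Finset.sum_boole, ← hcard1]
    norm_cast
    have hsub : (univ.filter fun v : Fin K → Bits r =>
        ∃ w, ∀ l, simpleTab (T + rowTab j (Function.extend (fun l => y l j) v 0)) (y l) = w) ⊆
        (univ : Finset (Bits r)).image (fun w => fun l => w - simpleTab T (y l)) := by
      intro v hv
      simp only [mem_filter, mem_univ, true_and] at hv
      obtain ⟨w, hw⟩ := hv
      simp only [mem_image, mem_univ, true_and]
      refine ⟨w, ?_⟩
      funext l
      rw [← hw l, simpleTab_add, simpleTab_rowTab]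
      have := hy.extend_apply v 0 l
      rw [this]
      abel
    exact (card_le_card hsub).trans (card_image_le.trans (le_of_eq rfl))
  calc _ ≤ ∑ T : Fin c → Bits s → Bits r, (2 ^ r : ℝ) := Finset.sum_le_sum fun T _ => hb T
    _ = _ := by simp [mul_comm]

/-- A large set of keys has many characters at some position. -/
lemma exists_position {c s k : ℕ} (U : Finset (Fin c → Bits s)) (h : k ^ c < U.card) :
    ∃ j : Fin c, k < (U.image fun x => x j).card := by
  by_contra hcon
  push Not at hcon
  have hsub : U ⊆ Fintype.piFinset fun j => U.image fun x => x j := by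
    intro x hx
    rw [Fintype.mem_piFinset]
    intro j
    exact mem_image_of_mem _ hx
  have h1 := card_le_card hsub
  rw [Fintype.card_piFinset] at h1
  have h2 : ∏ j : Fin c, (U.image fun x => x j).card ≤ ∏ _j : Fin c, k :=
    Finset.prod_le_prod' fun j _ => hcon j
  simp at h2
  omega

/-- Maximal load of a set of keys is bounded by `K ^ c`. -/
def goodLoad {c s r : ℕ} (K : ℕ) (G : Finset (Fin c → Bits s)) (T : Fin c → Bits s → Bits r) :
    Prop := ∀ w, (G.filter fun x => simpleTab T x = w).card ≤ K ^ c

lemma load_bound {c s r K : ℕ} (G : Finset (Fin c → Bits s)) :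
    (2 ^ r : ℝ) ^ K * ((univ.filter fun T : Fin c → Bits s → Bits r =>
      ¬ goodLoad K G T).card : ℝ) ≤
      c * (G.card : ℝ) ^ K * (2 ^ r * (Fintype.card (Fin c → Bits s → Bits r) : ℝ)) := by
  set I : Finset (Fin c × (Fin K → Fin c → Bits s)) :=
    ((univ : Finset (Fin c)) ×ˢ Fintype.piFinset (fun _ : Fin K => G)).filter
      (fun p => Function.Injective fun l => p.2 l p.1) with hI
  have hsub : (univ.filter fun T : Fin c → Bits s → Bits r => ¬ goodLoad K G T) ⊆
      I.biUnion fun p => univ.filter fun T : Fin c → Bits s → Bits r =>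
        ∃ w, ∀ l, simpleTab T (p.2 l) = w := by
    intro T hT
    simp only [mem_filter, mem_univ, true_and, goodLoad, not_forall, not_le] at hT
    obtain ⟨w, hw⟩ := hT
    obtain ⟨j, hj⟩ := exists_position _ hw
    obtain ⟨W, hW, hWc⟩ := Finset.exists_subset_card_eq hj.le
    have hch : ∀ l : Fin K, ∃ x ∈ G.filter (fun x => simpleTab T x = w),
        x j = (W.equivFinOfCardEq hWc).symm l := by
      intro l
      have := hW ((W.equivFinOfCardEq hWc).symm l).2
      simpa using mem_image.1 this
    choose y hyG hyj using hch
    rw [mem_biUnion]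
    refine ⟨(j, y), ?_, ?_⟩
    · rw [hI, mem_filter, mem_product, Fintype.mem_piFinset]
      refine ⟨⟨mem_univ _, fun l => (mem_filter.1 (hyG l)).1⟩, ?_⟩
      intro l l' h
      simp only [hyj] at h
      exact (W.equivFinOfCardEq hWc).symm.injective (Subtype.ext h)
    · simp only [mem_filter, mem_univ, true_and]
      exact ⟨w, fun l => (mem_filter.1 (hyG l)).2⟩
  have h1 := (card_le_card hsub).trans card_biUnion_le
  have h1' : ((univ.filter fun T : Fin c → Bits s → Bits r => ¬ goodLoad K G T).card : ℝ) ≤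
      ∑ p ∈ I, ((univ.filter fun T : Fin c → Bits s → Bits r =>
        ∃ w, ∀ l, simpleTab T (p.2 l) = w).card : ℝ) := by exact_mod_cast h1
  have hIc : (I.card : ℝ) ≤ c * (G.card : ℝ) ^ K := by
    have : I.card ≤ c * G.card ^ K := by
      refine (card_filter_le _ _).trans ?_
      rw [card_product, Fintype.card_piFinset]
      simp
    exact_mod_cast this
  calc _ ≤ (2 ^ r : ℝ) ^ K * ∑ p ∈ I, ((univ.filter fun T : Fin c → Bits s → Bits r =>
        ∃ w, ∀ l, simpleTab T (p.2 l) = w).card : ℝ) := by gcongr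
    _ = ∑ p ∈ I, (2 ^ r : ℝ) ^ K * ((univ.filter fun T : Fin c → Bits s → Bits r =>
        ∃ w, ∀ l, simpleTab T (p.2 l) = w).card : ℝ) := by rw [Finset.mul_sum]
    _ ≤ ∑ p ∈ I, (2 ^ r * (Fintype.card (Fin c → Bits s → Bits r) : ℝ)) := by
        refine Finset.sum_le_sum fun p hp => ?_
        exact collide_bound p.1 p.2 (mem_filter.1 hp).2
    _ = I.card * (2 ^ r * (Fintype.card (Fin c → Bits s → Bits r) : ℝ)) := by
        rw [Finset.sum_const, nsmul_eq_mul]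
    _ ≤ _ := by gcongr

lemma sum_fiber_le {X Y : Type*} [DecidableEq Y] (S : Finset X) (g : X → Y) (B : Finset Y) :
    ∑ a ∈ B, (S.filter fun x => g x = a).card ≤ S.card := by
  have h : ∑ a ∈ B, (S.filter fun x => g x = a).card =
      (B.biUnion fun a => S.filter fun x => g x = a).card := by
    rw [card_biUnion]
    intro a _ b _ hab
    rw [Function.onFun, Finset.disjoint_left]
    intro x hx hx'
    exact hab ((mem_filter.1 hx).2.symm.trans (mem_filter.1 hx').2)
  rw [h]
  refine card_le_card fun x hx => ?_
  obtain ⟨a, _, hx⟩ := mem_biUnion.1 hx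
  exact (mem_filter.1 hx).1

/-- Choice of the next group. -/
lemma exists_group {c s : ℕ} (hc : 1 ≤ c) (S : Finset (Fin c → Bits s)) (q : Fin c → Bits s)
    (hq : q ∉ S) (hS : S.Nonempty) :
    ∃ (i : Fin c) (a : Bits s), q i ≠ a ∧ (S.filter fun x => x i = a).Nonempty ∧
      ((S.filter fun x => x i = a).card : ℝ) ≤ 2 * (S.card : ℝ) ^ (1 - 1 / (c : ℝ)) := by
  have hcpos : (0 : ℝ) < c := by exact_mod_cast hc
  rcases Nat.lt_or_ge S.card 2 with h2 | h2
  · have h1 : S.card = 1 := by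
      have := hS.card_pos
      omega
    obtain ⟨x, rfl⟩ := card_eq_one.1 h1
    have hne : q ≠ x := by simpa using hq
    obtain ⟨i, hi⟩ := Function.ne_iff.1 hne
    refine ⟨i, x i, hi, ⟨x, by simp⟩, ?_⟩
    have : (({x} : Finset (Fin c → Bits s)).filter fun y => y i = x i).card ≤ 1 :=
      (card_filter_le _ _).trans (by simp)
    have h' : ((({x} : Finset (Fin c → Bits s)).filter fun y => y i = x i).card : ℝ) ≤ 1 := by
      exact_mod_cast this
    simp only [card_singleton, Nat.cast_one, Real.one_rpow]
    linarith
  · -- a position with at least `N ^ (1/c)` characters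
    set N : ℝ := (S.card : ℝ) with hN
    have hN0 : 0 < N := by rw [hN]; exact_mod_cast hS.card_pos
    have hpos : ∃ i : Fin c, S.card ≤ (S.image fun x => x i).card ^ c := by
      by_contra hcon
      push Not at hcon
      have : Nonempty (Fin c) := ⟨⟨0, hc⟩⟩
      obtain ⟨i, -, hi⟩ := Finset.exists_max_image (univ : Finset (Fin c))
        (fun i => (S.image fun x => x i).card) univ_nonempty
      obtain ⟨j, hj⟩ := exists_position S (hcon i)
      exact absurd (hi j (mem_univ _)) (not_le.2 hj)
    obtain ⟨i, hi⟩ := hpos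
    set k := (S.image fun x => x i).card with hk
    have hk2 : 2 ≤ k := by
      by_contra hlt
      have : k ≤ 1 := by omega
      have := Nat.pow_le_pow_left this c
      simp at this
      omega
    set B := (S.image fun x => x i).erase (q i) with hB
    have hBc : k - 1 ≤ B.card := by
      rw [hB]; exact Finset.pred_card_le_card_erase
    have hBne : B.Nonempty := by
      rw [← card_pos]; omega
    have hsum : ∑ a ∈ B, (S.filter fun x => x i = a).card ≤ S.card := by
      exact sum_fiber_le S (fun x => x i) B
    obtain ⟨a, haB, hamin⟩ := Finset.exists_min_image B
      (fun a => (S.filter fun x => x i = a).card) hBne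
    have ha := Finset.card_nsmul_le_sum B _ _ hamin
    refine ⟨i, a, ((mem_erase.1 haB).1).symm, ?_, ?_⟩
    · obtain ⟨x, hx, hxa⟩ := mem_image.1 (mem_erase.1 haB).2
      exact ⟨x, mem_filter.2 ⟨hx, hxa⟩⟩
    · set g := (S.filter fun x => x i = a).card with hg
      have h3 : (k - 1) * g ≤ S.card := by
        refine le_trans ?_ (ha.trans hsum)
        rw [smul_eq_mul]
        exact Nat.mul_le_mul_right _ hBc
      have h4 : k * g ≤ 2 * S.card := by
        have : k ≤ 2 * (k - 1) := by omega
        calc k * g ≤ 2 * (k - 1) * g := Nat.mul_le_mul_right _ this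
          _ = 2 * ((k - 1) * g) := by ring
          _ ≤ _ := by omega
      have h4' : (k : ℝ) * g ≤ 2 * N := by rw [hN]; exact_mod_cast h4
      have h5 : N ^ (1 / (c : ℝ)) ≤ k := by
        have : N ≤ (k : ℝ) ^ (c : ℝ) := by
          rw [Real.rpow_natCast, hN]; exact_mod_cast hi
        calc N ^ (1 / (c : ℝ)) ≤ ((k : ℝ) ^ (c : ℝ)) ^ (1 / (c : ℝ)) := by gcongr
          _ = k := by
            rw [← Real.rpow_mul (by positivity), mul_one_div_cancel hcpos.ne', Real.rpow_one]
      have h6 : 0 < N ^ (1 / (c : ℝ)) := Real.rpow_pos_of_pos hN0 _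
      rw [Real.rpow_sub hN0, Real.rpow_one]
      have h7 : N ^ (1 / (c : ℝ)) * g ≤ 2 * N :=
        le_trans (by gcongr) h4'
      rw [← mul_div_assoc, le_div_iff₀ h6]
      linarith

lemma convex_pow (z : ℝ) (hz0 : 0 ≤ z) (hz1 : z ≤ 1) (d : ℕ) (k : ℕ) (hk : k ≤ d) :
    (d : ℝ) * z ^ k ≤ d - (1 - z ^ d) * k := by
  induction d, hk using Nat.le_induction with
  | base => nlinarith
  | succ d hkd ih =>
    push_cast
    have h1 : z ^ d ≤ z ^ k := pow_le_pow_of_le_one hz0 hz1 hkd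
    have h2 : (0 : ℝ) ≤ z ^ d := by positivity
    have h3 : (k : ℝ) * (1 - z) * z ^ d ≤ 1 - z ^ k := by
      have hgeo : (1 - z) * ∑ i ∈ range k, z ^ i = 1 - z ^ k := by
        have := geom_sum_mul z k
        linarith
      rw [← hgeo]
      have : ∑ i ∈ range k, z ^ d ≤ ∑ i ∈ range k, z ^ i := by
        refine Finset.sum_le_sum fun i hi => ?_
        exact pow_le_pow_of_le_one hz0 hz1 ((mem_range.1 hi).le.trans hkd)
      rw [Finset.sum_const, card_range, nsmul_eq_mul] at this
      nlinarith
    rw [pow_succ]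
    nlinarith

/-- Moment bound for one group. -/
lemma group_moment {c s r K : ℕ} (hK : 1 ≤ K) (G : Finset (Fin c → Bits s)) (z : ℝ) (hz0 : 0 ≤ z)
    (hz1 : z ≤ 1) (T : Fin c → Bits s → Bits r) (b : Bits r) (hgood : goodLoad K G T) :
    ∑ v : Bits r, z ^ (G.filter fun x => simpleTab T x + v = b).card ≤
      2 ^ r * Real.exp (-((1 - z ^ (K ^ c)) / (K ^ c : ℕ) * (G.card / 2 ^ r))) := by
  have e1 : ∑ v : Bits r, z ^ (G.filter fun x => simpleTab T x + v = b).card =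
      ∑ w : Bits r, z ^ (G.filter fun x => simpleTab T x = w).card := by
    rw [← Equiv.sum_comp (Equiv.subLeft b)]
    refine Finset.sum_congr rfl fun v _ => ?_
    congr 2
    ext x
    simp only [mem_filter, Equiv.subLeft_apply]
    rw [add_sub_left_comm, add_eq_left, sub_eq_zero]
  rw [e1]
  set d := K ^ c with hd
  have hdpos : (0 : ℝ) < (d : ℝ) := by
    have : 0 < d := by rw [hd]; positivity
    exact_mod_cast this
  have hcard1 : (Fintype.card (Bits r) : ℝ) = (2 ^ r : ℝ) := by
    simp [ZMod.card]
  have hsum : ∑ w : Bits r, ((G.filter fun x => simpleTab T x = w).card : ℝ) = G.card := by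
    have := Finset.card_eq_sum_card_fiberwise (f := fun x => simpleTab T x) (s := G)
      (t := (univ : Finset (Bits r))) (fun x _ => by simp)
    rw [this]; push_cast; rfl
  have h2 : ∑ w : Bits r, z ^ (G.filter fun x => simpleTab T x = w).card ≤
      ∑ w : Bits r, (1 - (1 - z ^ d) / d * ((G.filter fun x => simpleTab T x = w).card : ℝ)) := by
    refine Finset.sum_le_sum fun w _ => ?_
    have := convex_pow z hz0 hz1 d _ (hgood w)
    rw [show (1 - (1 - z ^ d) / d * ((G.filter fun x => simpleTab T x = w).card : ℝ)) =
      (d - (1 - z ^ d) * ((G.filter fun x => simpleTab T x = w).card : ℝ)) / d by field_simp]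
    rw [le_div_iff₀ hdpos]
    linarith
  refine h2.trans ?_
  rw [Finset.sum_sub_distrib, ← Finset.mul_sum, hsum, Finset.sum_const, card_univ, nsmul_eq_mul,
    hcard1, mul_one]
  have h3 := Real.add_one_le_exp (-((1 - z ^ d) / d * (G.card / 2 ^ r)))
  have h4 : (0 : ℝ) < 2 ^ r := by positivity
  calc _ = (2 : ℝ) ^ r * (-((1 - z ^ d) / d * (G.card / 2 ^ r)) + 1) := by field_simp; ring
    _ ≤ _ := by gcongr

/-- Main induction. -/
lemma main_induction {c s r K : ℕ} (hc : 1 ≤ c) (hK : 1 ≤ K) (q : Fin c → Bits s)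
    (f : Bits r → Bits r) (z : ℝ) (hz0 : 0 ≤ z) (hz1 : z ≤ 1) (n : ℕ) :
    ∀ (N : ℕ) (S : Finset (Fin c → Bits s)), S.card = N → N ≤ n → q ∉ S →
    ∃ good : (Fin c → Bits s → Bits r) → Prop,
      (∀ i a, (∀ x ∈ S, x i ≠ a) → ∀ v T, good (T + rowTab i (Pi.single a v)) ↔ good T) ∧
      (∑ T : Fin c → Bits s → Bits r, (if good T then
        z ^ (S.filter fun x => simpleTab T x = f (simpleTab T q)).card else 0)) ≤
        Fintype.card (Fin c → Bits s → Bits r) *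
          Real.exp (-((1 - z ^ (K ^ c)) / (K ^ c : ℕ) * (S.card / 2 ^ r))) ∧
      (2 ^ r : ℝ) ^ K * ((univ.filter fun T => ¬ good T).card : ℝ) ≤
        S.card * (c * (2 * (n : ℝ) ^ (1 - 1 / (c : ℝ))) ^ K *
          (2 ^ r * (Fintype.card (Fin c → Bits s → Bits r) : ℝ))) := by
  intro N
  induction N using Nat.strong_induction_on with
  | _ N ih =>
  intro S hSN hNn hq
  rcases S.eq_empty_or_nonempty with rfl | hS
  · refine ⟨fun _ => True, by simp, ?_, ?_⟩ <;> simp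
  obtain ⟨i, a, hqa, hGne, hGc⟩ := exists_group hc S q hq hS
  set G := S.filter fun x => x i = a with hG
  set S' := S.filter fun x => ¬ x i = a with hS'
  have hcards : G.card + S'.card = S.card := Finset.card_filter_add_card_filter_not _
  have hGpos := hGne.card_pos
  obtain ⟨good', hinv, hmom, hbad⟩ := ih S'.card (by omega) S' rfl (by omega)
    (fun h => hq (mem_filter.1 h).1)
  have hshift : ∀ (j : Fin c) (e : Bits s) (v : Bits r) (T : Fin c → Bits s → Bits r)
      (x : Fin c → Bits s), simpleTab (T + rowTab j (Pi.single e v)) x =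
        simpleTab T x + if x j = e then v else 0 := by
    intro j e v T x
    rw [simpleTab_add, simpleTab_rowTab, Pi.single_apply]
  have hc0 : (0 : ℝ) < c := by exact_mod_cast hc
  refine ⟨fun T => good' T ∧ goodLoad K G T, ?_, ?_, ?_⟩
  · intro j e hje v T
    have h1 := hinv j e (fun x hx => hje x (mem_filter.1 hx).1) v T
    have h2 : goodLoad K G (T + rowTab j (Pi.single e v)) ↔ goodLoad K G T := by
      unfold goodLoad
      refine forall_congr' fun w => ?_
      have : (G.filter fun x => simpleTab (T + rowTab j (Pi.single e v)) x = w) =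
          (G.filter fun x => simpleTab T x = w) := by
        refine Finset.filter_congr fun x hx => ?_
        rw [hshift, if_neg (hje x (mem_filter.1 hx).1), add_zero]
      rw [this]
    exact and_congr h1 h2
  · set κ := (1 - z ^ (K ^ c)) / ((K ^ c : ℕ) : ℝ) with hκ
    have h := shift_sum (Ω := Fin c → Bits s → Bits r) (V := Bits r)
      (fun v => rowTab i (Pi.single a v))
      (fun T => if good' T ∧ goodLoad K G T then
        z ^ (S.filter fun x => simpleTab T x = f (simpleTab T q)).card else 0)
    have hcard1 : (Fintype.card (Bits r) : ℝ) = (2 ^ r : ℝ) := by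
      simp [ZMod.card]
    rw [hcard1] at h
    have hT : ∀ T : Fin c → Bits s → Bits r,
        (∑ v : Bits r, if good' (T + rowTab i (Pi.single a v)) ∧
            goodLoad K G (T + rowTab i (Pi.single a v)) then
          z ^ (S.filter fun x => simpleTab (T + rowTab i (Pi.single a v)) x =
            f (simpleTab (T + rowTab i (Pi.single a v)) q)).card else 0) ≤
        (if good' T then z ^ (S'.filter fun x => simpleTab T x = f (simpleTab T q)).card else 0) *
          (2 ^ r * Real.exp (-(κ * (G.card / 2 ^ r)))) := by
      intro T
      have hg1 : ∀ v, good' (T + rowTab i (Pi.single a v)) ↔ good' T := fun v =>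
        hinv i a (fun x hx => (mem_filter.1 hx).2) v T
      have hg2 : ∀ v, goodLoad K G (T + rowTab i (Pi.single a v)) ↔ goodLoad K G T := by
        intro v
        have key : ∀ w, (G.filter fun x => simpleTab (T + rowTab i (Pi.single a v)) x = w) =
          (G.filter fun x => simpleTab T x = w - v) := by
          intro w
          refine Finset.filter_congr fun x hx => ?_
          rw [hshift, if_pos (mem_filter.1 hx).2, eq_sub_iff_add_eq]
        unfold goodLoad
        simp only [key]
        constructor
        · intro hh w
          simpa using hh (w + v)
        · intro hh w
          exact hh _
      have hqv : ∀ v, simpleTab (T + rowTab i (Pi.single a v)) q = simpleTab T q := by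
        intro v
        rw [hshift, if_neg hqa, add_zero]
      have hcnt : ∀ v, (S.filter fun x => simpleTab (T + rowTab i (Pi.single a v)) x =
            f (simpleTab (T + rowTab i (Pi.single a v)) q)).card =
          (S'.filter fun x => simpleTab T x = f (simpleTab T q)).card +
          (G.filter fun x => simpleTab T x + v = f (simpleTab T q)).card := by
        intro v
        rw [hqv v]
        rw [← Finset.card_filter_add_card_filter_not (s := S.filter fun x =>
          simpleTab (T + rowTab i (Pi.single a v)) x = f (simpleTab T q)) (fun x => x i = a),
          add_comm]
        congr 2
        · ext x
          simp only [hS', mem_filter, hshift]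
          constructor
          · rintro ⟨⟨h1, h2⟩, h3⟩
            rw [if_neg h3, add_zero] at h2
            exact ⟨⟨h1, h3⟩, h2⟩
          · rintro ⟨⟨h1, h3⟩, h2⟩
            rw [if_neg h3, add_zero]
            exact ⟨⟨h1, h2⟩, h3⟩
        · ext x
          simp only [hG, mem_filter, hshift]
          constructor
          · rintro ⟨⟨h1, h2⟩, h3⟩
            rw [if_pos h3] at h2
            exact ⟨⟨h1, h3⟩, h2⟩
          · rintro ⟨⟨h1, h3⟩, h2⟩
            rw [if_pos h3]
            exact ⟨⟨h1, h2⟩, h3⟩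
      simp only [hg1, hg2, hcnt]
      by_cases hA : good' T
      · by_cases hB : goodLoad K G T
        · simp only [hA, hB, and_self, if_true, pow_add]
          rw [← Finset.mul_sum]
          refine mul_le_mul_of_nonneg_left ?_ (by positivity)
          exact group_moment hK G z hz0 hz1 T _ hB
        · simp only [hB, and_false, if_false, Finset.sum_const_zero]
          split_ifs <;> positivity
      · simp [hA]
    have h4 : (0 : ℝ) < 2 ^ r := by positivity
    have h5 := Finset.sum_le_sum fun T (_ : T ∈ (univ : Finset (Fin c → Bits s → Bits r))) => hT T
    rw [← h, ← Finset.sum_mul] at h5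
    have h6 : (2 : ℝ) ^ r * (∑ T : Fin c → Bits s → Bits r,
        (if good' T ∧ goodLoad K G T then
        z ^ (S.filter fun x => simpleTab T x = f (simpleTab T q)).card else 0)) ≤
        2 ^ r * (Fintype.card (Fin c → Bits s → Bits r) *
          Real.exp (-(κ * (S.card / 2 ^ r)))) := by
      refine h5.trans ((mul_le_mul_of_nonneg_right hmom (by positivity)).trans (le_of_eq ?_))
      have : -(κ * ((S.card : ℝ) / 2 ^ r)) =
          -(κ * ((S'.card : ℝ) / 2 ^ r)) + -(κ * ((G.card : ℝ) / 2 ^ r)) := by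
        rw [← hcards]; push_cast; ring
      rw [this, Real.exp_add]
      ring
    refine le_trans (le_of_eq ?_) (le_of_mul_le_mul_left h6 h4)
    congr!
  · have hl := load_bound (r := r) (K := K) G
    set Q := (2 ^ r * (Fintype.card (Fin c → Bits s → Bits r) : ℝ)) with hQ
    have hQ0 : 0 ≤ Q := by positivity
    have hGn : (G.card : ℝ) ≤ 2 * (n : ℝ) ^ (1 - 1 / (c : ℝ)) := by
      refine hGc.trans ?_
      have hSn : (S.card : ℝ) ≤ n := by exact_mod_cast (hSN ▸ hNn)
      have : 0 ≤ 1 - 1 / (c : ℝ) := by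
        rw [sub_nonneg, div_le_one hc0]; exact_mod_cast hc
      gcongr
    have hl' : (2 ^ r : ℝ) ^ K * ((univ.filter fun T : Fin c → Bits s → Bits r =>
        ¬ goodLoad K G T).card : ℝ) ≤ c * (2 * (n : ℝ) ^ (1 - 1 / (c : ℝ))) ^ K * Q := by
      refine hl.trans ?_
      gcongr
    set p := c * (2 * (n : ℝ) ^ (1 - 1 / (c : ℝ))) ^ K * Q with hp
    have hp0 : 0 ≤ p := by positivity
    have hun : (univ.filter fun T : Fin c → Bits s → Bits r =>
        ¬ (good' T ∧ goodLoad K G T)).card ≤ (univ.filter fun T => ¬ good' T).card +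
        (univ.filter fun T : Fin c → Bits s → Bits r => ¬ goodLoad K G T).card := by
      refine le_trans (card_le_card ?_) (card_union_le _ _)
      intro T
      simp only [mem_filter, mem_univ, true_and, mem_union]
      tauto
    have hun' : ((univ.filter fun T : Fin c → Bits s → Bits r =>
        ¬ (good' T ∧ goodLoad K G T)).card : ℝ) ≤ ((univ.filter fun T => ¬ good' T).card : ℝ) +
        ((univ.filter fun T : Fin c → Bits s → Bits r => ¬ goodLoad K G T).card : ℝ) := by
      exact_mod_cast hun
    have hSr : (S'.card : ℝ) + 1 ≤ S.card := by
      have : S'.card + 1 ≤ S.card := by omega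
      exact_mod_cast this
    calc _ ≤ (2 ^ r : ℝ) ^ K * (((univ.filter fun T => ¬ good' T).card : ℝ) +
        ((univ.filter fun T : Fin c → Bits s → Bits r => ¬ goodLoad K G T).card : ℝ)) := by
          refine mul_le_mul_of_nonneg_left ?_ (by positivity)
          refine le_trans (le_of_eq ?_) hun'
          congr!
      _ ≤ S'.card * p + p := by rw [mul_add]; linarith
      _ = (S'.card + 1) * p := by ring
      _ ≤ _ := by gcongr

/-- Arithmetic for the error term. -/
lemma error_bound (c : ℕ) (hc : 1 ≤ c) (γ : ℝ) (K : ℕ) (hK : (3 + γ) * (2 * c - 1) ≤ K)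
    (n m : ℝ) (hn : 0 ≤ n) (hm : 1 ≤ m) (hnm : n ^ ((1 : ℝ) - 1 / (2 * (c : ℝ))) ≤ m) :
    n * (c * (2 * n ^ (1 - 1 / (c : ℝ))) ^ K * m) ≤ c * 2 ^ K / m ^ γ * m ^ K := by
  have hc1 : (1 : ℝ) ≤ c := by exact_mod_cast hc
  have hm0 : 0 < m := by linarith
  set e : ℝ := (1 : ℝ) - 1 / (2 * (c : ℝ)) with he
  have hee : e = (2 * c - 1) / (2 * c) := by rw [he]; field_simp
  have he0 : 0 < e := by
    rw [hee]; apply div_pos <;> linarith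
  have hpow : ∀ t : ℝ, 0 ≤ t → n ^ t ≤ m ^ (t / e) := by
    intro t ht
    calc n ^ t = (n ^ e) ^ (t / e) := by
          rw [← Real.rpow_mul hn, mul_div_cancel₀ _ he0.ne']
      _ ≤ m ^ (t / e) := Real.rpow_le_rpow (by positivity) hnm (by positivity)
  have h1 : n ≤ m ^ (2 : ℝ) := by
    have := hpow 1 zero_le_one
    rw [Real.rpow_one] at this
    refine this.trans (Real.rpow_le_rpow_of_exponent_le hm ?_)
    rw [div_le_iff₀ he0, hee, ← mul_div_assoc, le_div_iff₀ (by linarith)]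
    linarith
  have h2 : n ^ (1 - 1 / (c : ℝ)) ≤ m ^ (1 - 1 / (2 * (c : ℝ) - 1)) := by
    have h0 : 0 ≤ 1 - 1 / (c : ℝ) := by
      rw [sub_nonneg, div_le_one (by linarith)]; exact hc1
    refine (hpow _ h0).trans (le_of_eq ?_)
    congr 1
    rw [hee]
    have : (2 * (c : ℝ) - 1) ≠ 0 := by linarith
    rw [div_div_eq_mul_div, div_eq_iff this, sub_mul (1 : ℝ) (1 / (2 * (c : ℝ) - 1)),
      one_div_mul_cancel this]
    field_simp
    ring
  have h3 : n * (n ^ (1 - 1 / (c : ℝ))) ^ K * m ≤ m ^ (K : ℝ) / m ^ γ := by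
    calc n * (n ^ (1 - 1 / (c : ℝ))) ^ K * m
        ≤ m ^ (2 : ℝ) * (m ^ (1 - 1 / (2 * (c : ℝ) - 1))) ^ K * m := by gcongr
      _ = m ^ (2 + (1 - 1 / (2 * (c : ℝ) - 1)) * K + 1) := by
          rw [Real.rpow_add hm0, Real.rpow_add hm0, Real.rpow_one, Real.rpow_mul hm0.le,
            Real.rpow_natCast]
      _ ≤ m ^ (K - γ) := by
          apply Real.rpow_le_rpow_of_exponent_le hm
          have hp : 0 < 2 * (c : ℝ) - 1 := by linarith
          have : 3 + γ ≤ 1 / (2 * (c : ℝ) - 1) * K := by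
            rw [one_div_mul_eq_div, le_div_iff₀ hp]; exact hK
          linarith
      _ = _ := Real.rpow_sub hm0 _ _
  rw [Real.rpow_natCast] at h3
  calc _ = c * 2 ^ K * (n * (n ^ (1 - 1 / (c : ℝ))) ^ K * m) := by rw [mul_pow]; ring
    _ ≤ c * 2 ^ K * (m ^ K / m ^ γ) := by gcongr
    _ = _ := by ring

/-- Chernoff-style lower tail for simple tabulation (Theorem 1, lower
bound): for constants `c ≥ 1`, `γ > 0` there are constants `α > 0`, `C` such that when
`n` keys `S` are hashed into `m = 2^r ≥ n^{1-1/(2c)}` bins by random simple tabulation,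
`q ∉ S` is a query key, and the bin `b = f(h(q))` is an arbitrary function of `h(q)`,
the number `X` of keys of `S` hashing to `b` satisfies, with `μ = n/m`, for `0 < δ ≤ 1`:
`Pr[X ≤ (1−δ)μ] ≤ (e^{−δ}/(1−δ)^{1−δ})^{αμ} + C/m^γ`. -/
theorem simple_tabulation_chernoff_lower (c : ℕ) (hc : 1 ≤ c) (γ : ℝ) (hγ : 0 < γ) :
    ∃ α : ℝ, 0 < α ∧ ∃ C : ℝ,
      ∀ (s r : ℕ) (S : Finset (Fin c → Bits s)) (q : Fin c → Bits s) (f : Bits r → Bits r),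
        q ∉ S →
        (S.card : ℝ) ^ ((1 : ℝ) - 1 / (2 * (c : ℝ))) ≤ (2 : ℝ) ^ r →
        ∀ δ : ℝ, 0 < δ → δ ≤ 1 →
          Pr (fun T : Fin c → Bits s → Bits r =>
              ((S.filter fun x => simpleTab T x = f (simpleTab T q)).card : ℝ) ≤
                (1 - δ) * ((S.card : ℝ) / (2 : ℝ) ^ r)) ≤
            (Real.exp (-δ) / (1 - δ) ^ (1 - δ)) ^ (α * ((S.card : ℝ) / (2 : ℝ) ^ r)) +
              C / ((2 : ℝ) ^ r) ^ γ := by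
  have hc1 : (1 : ℝ) ≤ c := by exact_mod_cast hc
  obtain ⟨K, hKγ⟩ := exists_nat_ge ((3 + γ) * (2 * c - 1))
  have hK : 1 ≤ K := by
    have : (1 : ℝ) ≤ K := by nlinarith
    exact_mod_cast this
  have hdpos : 0 < K ^ c := by positivity
  have hd0 : (0 : ℝ) < ((K ^ c : ℕ) : ℝ) := by exact_mod_cast hdpos
  refine ⟨1 / ((K ^ c : ℕ) : ℝ), by positivity, c * 2 ^ K, ?_⟩
  intro s r S q f hq hnm δ hδ0 hδ1
  set d := K ^ c with hd
  set m : ℝ := (2 : ℝ) ^ r with hm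
  have hm1 : 1 ≤ m := one_le_pow₀ (by norm_num)
  have hm0 : 0 < m := by linarith
  set μ : ℝ := (S.card : ℝ) / m with hμ
  have hμ0 : 0 ≤ μ := by positivity
  have h1δ : 0 ≤ 1 - δ := by linarith
  set z : ℝ := (1 - δ) ^ ((d : ℝ)⁻¹) with hz
  have hz0 : 0 ≤ z := by positivity
  have hz1 : z ≤ 1 := Real.rpow_le_one h1δ (by linarith) (by positivity)
  have hzd : z ^ d = 1 - δ := Real.rpow_inv_natCast_pow h1δ hdpos.ne'
  obtain ⟨good, -, hmom, hbad⟩ := main_induction hc hK q f z hz0 hz1 S.card S.card S rfl le_rfl hq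
  rw [← hd, hzd, sub_sub_cancel] at hmom
  set Ωc : ℝ := (Fintype.card (Fin c → Bits s → Bits r) : ℝ) with hΩ
  have hΩ0 : 0 < Ωc := by
    rw [hΩ]; exact_mod_cast Fintype.card_pos
  set P : ℝ := (1 - δ) ^ ((1 - δ) * (1 / (d : ℝ) * μ)) with hP
  have hP0 : 0 < P := by
    rcases h1δ.eq_or_lt with h | h
    · rw [hP, ← h]; simp
    · exact Real.rpow_pos_of_pos h _
  have hPz : ∀ X : ℕ, (X : ℝ) ≤ (1 - δ) * μ → P ≤ z ^ X := by
    intro X hX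
    rcases h1δ.eq_or_lt with h | h
    · have hX0 : X = 0 := by
        rw [← h, zero_mul] at hX
        exact_mod_cast le_antisymm hX (by positivity)
      rw [hP, ← h, hX0]; simp
    · rw [hz, ← Real.rpow_natCast, ← Real.rpow_mul h1δ, hP]
      apply Real.rpow_le_rpow_of_exponent_ge h (by linarith)
      calc (d : ℝ)⁻¹ * X ≤ (d : ℝ)⁻¹ * ((1 - δ) * μ) := by gcongr
        _ = _ := by ring
  set E : (Fin c → Bits s → Bits r) → Prop := fun T =>
    ((S.filter fun x => simpleTab T x = f (simpleTab T q)).card : ℝ) ≤ (1 - δ) * μ with hE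
  have hgoodE : P * ((univ.filter fun T => good T ∧ E T).card : ℝ) ≤
      Ωc * Real.exp (-(δ / d * μ)) := by
    refine le_trans ?_ hmom
    rw [Finset.card_filter]
    push_cast
    rw [Finset.mul_sum]
    refine Finset.sum_le_sum fun T _ => ?_
    by_cases hg : good T
    · by_cases hET : E T
      · simp only [hg, hET, and_self, if_true, mul_one]
        exact hPz _ hET
      · simp only [hg, hET, and_false, if_false, mul_zero, if_true]
        positivity
    · simp [hg]
  have hbad' : ((univ.filter fun T => ¬ good T).card : ℝ) ≤ c * 2 ^ K / m ^ γ * Ωc := by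
    have herr := error_bound c hc γ K hKγ S.card m (by positivity) hm1 hnm
    have : m ^ K * ((univ.filter fun T => ¬ good T).card : ℝ) ≤
        m ^ K * (c * 2 ^ K / m ^ γ * Ωc) := by
      refine hbad.trans ?_
      calc _ = (S.card * (c * (2 * (S.card : ℝ) ^ (1 - 1 / (c : ℝ))) ^ K * m)) * Ωc := by ring
        _ ≤ (c * 2 ^ K / m ^ γ * m ^ K) * Ωc := by gcongr
        _ = _ := by ring
    exact le_of_mul_le_mul_left this (by positivity)
  have hsplit : ((univ.filter E).card : ℝ) ≤ ((univ.filter fun T => good T ∧ E T).card : ℝ) +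
      ((univ.filter fun T => ¬ good T).card : ℝ) := by
    have : (univ.filter E).card ≤ (univ.filter fun T => good T ∧ E T).card +
        (univ.filter fun T => ¬ good T).card := by
      refine le_trans (card_le_card ?_) (card_union_le _ _)
      intro T
      simp only [mem_filter, mem_univ, true_and, mem_union]
      tauto
    exact_mod_cast this
  have hmain : (Real.exp (-δ) / (1 - δ) ^ (1 - δ)) ^ (1 / (d : ℝ) * μ) =
      Real.exp (-(δ / d * μ)) / P := by
    rw [Real.div_rpow (Real.exp_pos _).le (by positivity), ← Real.exp_mul, ← Real.rpow_mul h1δ]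
    congr 2
    ring
  rw [hmain]
  unfold Pr
  rw [← hΩ, div_le_iff₀ hΩ0, add_mul]
  have hgE : ((univ.filter fun T => good T ∧ E T).card : ℝ) ≤
      Real.exp (-(δ / d * μ)) / P * Ωc := by
    rw [div_mul_eq_mul_div, le_div_iff₀ hP0]
    linarith
  refine le_trans (le_of_eq ?_) (hsplit.trans (add_le_add hgE hbad'))
  congr!
end

section
/- k-th moment bound for simple tabulation (Theorem 2): for every constant c ≥ 1 and every constant k ≥ 1 there exists a constant C such that the following holds. Let h : Σ^c → [m] be a random simple tabulation hash function (m a power of two), let S ⊆ Σ^c be a set of n keys with m ≥ n^{1−1/(2c)}, let q ∉ S be a query key, and let the bin b ∈ [m] be an arbitrary function of h(q). If X is the number of keys x ∈ S with h(x) = b and μ = n/m, then E[(X − μ)^k] ≤ C·(μ + μ^{k/2}). -/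
open scoped Classical
open Finset

/-- Expectation of a real random variable under the uniform distribution on a finite
sample space. -/
noncomputable def Ex {Ω : Type*} [Fintype Ω] (f : Ω → ℝ) : ℝ :=
  (∑ ω, f ω) / (Fintype.card Ω : ℝ)

/-- Multilinear `ℓ²`-boundedness of a 0/1 kernel. -/
def BK {t : ℕ} {B : Type} [Fintype B] (K : (Fin t → B) → Prop) (C : ℝ) : Prop :=
  ∀ (f : Fin t → B → ℝ) (N : Fin t → ℝ), (∀ i b, 0 ≤ f i b) → (∀ i, 0 ≤ N i) →
    (∀ i, ∑ b, f i b ^ 2 ≤ N i ^ 2) →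
    ∑ x, (if K x then ∏ i, f i (x i) else 0) ≤ C * ∏ i, N i

/-- Every value is in `Q` or is shared with another index. -/
def KQ {t : ℕ} {A : Type} (Q : Finset A) (x : Fin t → A) : Prop :=
  ∀ j, x j ∈ Q ∨ ∃ j', j' ≠ j ∧ x j' = x j

lemma le_of_sq_sum {B : Type} [Fintype B] {g : B → ℝ} {N : ℝ} (hN : 0 ≤ N)
    (h : ∑ b, g b ^ 2 ≤ N ^ 2) (b : B) : g b ≤ N := by
  have : g b ^ 2 ≤ N ^ 2 :=
    (Finset.single_le_sum (f := fun b => g b ^ 2) (fun i _ => sq_nonneg _) (mem_univ b)).trans h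
  exact le_trans (le_abs_self _) (abs_le_of_sq_le_sq this hN)

lemma cs_sum {B : Type} [Fintype B] {g g' : B → ℝ} {N N' : ℝ} (hN : 0 ≤ N) (hN' : 0 ≤ N')
    (h : ∑ b, g b ^ 2 ≤ N ^ 2) (h' : ∑ b, g' b ^ 2 ≤ N' ^ 2) : ∑ b, g b * g' b ≤ N * N' := by
  have h1 := Finset.sum_mul_sq_le_sq_mul_sq univ g g'
  have h2 : (∑ b, g b * g' b) ^ 2 ≤ (N * N') ^ 2 := by
    rw [mul_pow]
    exact h1.trans (mul_le_mul h h' (Finset.sum_nonneg fun i _ => sq_nonneg _) (sq_nonneg _))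
  exact le_trans (le_abs_self _) (abs_le_of_sq_le_sq h2 (mul_nonneg hN hN'))

lemma KQ_step {t : ℕ} {A : Type} (Q : Finset A) (u : A) (y : Fin (t + 1) → A)
    (h : KQ Q (Fin.cons u y : Fin (t + 2) → A)) :
    (u ∈ Q ∧ KQ Q y) ∨ ∃ j, y j = u ∧ KQ (insert u Q) (fun i => y (j.succAbove i)) := by
  by_cases hu : u ∈ Q
  · left
    refine ⟨hu, fun j => ?_⟩
    rcases h j.succ with h1 | ⟨j', h1, h2⟩
    · left; simpa using h1
    · induction j' using Fin.cases with
      | zero => left; simp at h2; rwa [← h2]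
      | succ j' =>
        right
        exact ⟨j', fun h => h1 (by rw [h]), by simpa using h2⟩
  · right
    rcases h 0 with h1 | ⟨j', h1, h2⟩
    · exact absurd (by simpa using h1) hu
    · induction j' using Fin.cases with
      | zero => exact absurd rfl h1
      | succ j =>
        have hj : y j = u := by simpa using h2
        refine ⟨j, hj, fun i => ?_⟩
        by_cases hi : y (j.succAbove i) = u
        · left; simp [hi]
        rcases h (j.succAbove i).succ with h3 | ⟨l, h3, h4⟩
        · left; simp at h3; simp [h3]
        · induction l using Fin.cases with
          | zero => simp at h4; exact absurd h4.symm hi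
          | succ l =>
            simp at h4
            have hlj : l ≠ j := by
              rintro rfl
              exact hi (by rw [← h4, hj])
            obtain ⟨l', rfl⟩ := Fin.exists_succAbove_eq hlj
            right
            exact ⟨l', fun h => h3 (by rw [h]), h4⟩

lemma single_pos (k : ℕ) : ∀ M : ℕ, ∃ C : ℝ, 0 ≤ C ∧ ∀ (A : Type) [Fintype A] (Q : Finset A),
    Q.card ≤ M → BK (KQ Q : (Fin k → A) → Prop) C := by
  induction k using Nat.strong_induction_on with
  | _ k ih =>
  intro M
  match k, ih with
  | 0, _ =>
    refine ⟨1, zero_le_one, fun A _ Q hQ f N hf hN h => ?_⟩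
    rw [Fintype.sum_unique]
    split_ifs <;> simp
  | 1, _ =>
    refine ⟨M, Nat.cast_nonneg _, fun A _ Q hQ f N hf hN h => ?_⟩
    rw [← (Equiv.funUnique (Fin 1) A).symm.sum_comp]
    have : ∀ u : A, (if KQ Q ((Equiv.funUnique (Fin 1) A).symm u) then
        ∏ i, f i ((Equiv.funUnique (Fin 1) A).symm u i) else 0) ≤ if u ∈ Q then N 0 else 0 := by
      intro u
      have h1 : KQ Q ((Equiv.funUnique (Fin 1) A).symm u) → u ∈ Q := by
        intro h
        rcases h 0 with h1 | ⟨j', h1, h2⟩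
        · simpa using h1
        · exact absurd (Subsingleton.elim _ _) h1
      split_ifs with h2 h3 h3
      · simpa using le_of_sq_sum (hN 0) (h 0) u
      · exact absurd (h1 h2) h3
      · exact hN 0
      · exact le_rfl
    refine (Finset.sum_le_sum fun u _ => this u).trans ?_
    rw [Finset.sum_ite_mem]
    simp
    exact mul_le_mul_of_nonneg_right (by exact_mod_cast hQ) (hN 0)
  | t + 2, ih =>
    obtain ⟨C1, hC1, H1⟩ := ih (t + 1) (by omega) M
    obtain ⟨C2, hC2, H2⟩ := ih t (by omega) (M + 1)
    refine ⟨M * C1 + (t + 1) * C2, by positivity, fun A _ Q hQ f N hf hN h => ?_⟩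
    rw [← (Fin.consEquiv (fun _ : Fin (t + 2) => A)).sum_comp, Fintype.sum_prod_type]
    have key : ∀ (u : A) (y : Fin (t + 1) → A),
        (if KQ Q (Fin.cons u y : Fin (t + 2) → A) then
          ∏ i, f i ((Fin.cons u y : Fin (t + 2) → A) i) else 0) ≤
        (if u ∈ Q then f 0 u else 0) * (if KQ Q y then ∏ i, f (Fin.succ i) (y i) else 0) +
        ∑ j, f 0 u * (if y j = u then (if KQ (insert u Q) (fun i => y (j.succAbove i))
          then ∏ i, f (Fin.succ i) (y i) else 0) else 0) := by
      intro u y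
      have hP : 0 ≤ ∏ i, f (Fin.succ i) (y i) := Finset.prod_nonneg fun i _ => hf _ _
      have hterm : ∀ j, 0 ≤ f 0 u * (if y j = u then (if KQ (insert u Q)
          (fun i => y (j.succAbove i)) then ∏ i, f (Fin.succ i) (y i) else 0) else 0) := by
        intro j
        refine mul_nonneg (hf _ _) ?_
        split_ifs <;> first | exact hP | exact le_rfl
      have h1 : 0 ≤ (if u ∈ Q then f 0 u else 0) *
          (if KQ Q y then ∏ i, f (Fin.succ i) (y i) else 0) := by
        refine mul_nonneg ?_ ?_ <;> split_ifs <;> first | exact hP | exact le_rfl | exact hf _ _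
      by_cases hK : KQ Q (Fin.cons u y : Fin (t + 2) → A)
      · rw [if_pos hK, Fin.prod_univ_succ]
        simp only [Fin.cons_zero, Fin.cons_succ]
        rcases KQ_step Q u y hK with ⟨ha, hb⟩ | ⟨j, ha, hb⟩
        · rw [if_pos ha, if_pos hb]
          exact le_add_of_nonneg_right (Finset.sum_nonneg fun j _ => hterm j)
        · refine le_trans ?_ (le_add_of_nonneg_left h1)
          refine le_trans ?_ (Finset.single_le_sum (fun j _ => hterm j) (mem_univ j))
          rw [if_pos ha, if_pos hb]
      · rw [if_neg hK]
        exact add_nonneg h1 (Finset.sum_nonneg fun j _ => hterm j)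
    refine (Finset.sum_le_sum fun u _ => Finset.sum_le_sum fun y _ => key u y).trans ?_
    simp only [Finset.sum_add_distrib]
    rw [add_mul]
    refine add_le_add ?_ ?_
    · simp only [← Finset.mul_sum]
      rw [← Finset.sum_mul]
      have a1 : ∑ u, (if u ∈ Q then f 0 u else 0) ≤ M * N 0 := by
        have : ∀ u ∈ Q, f 0 u ≤ N 0 := fun u _ => le_of_sq_sum (hN 0) (h 0) u
        rw [Finset.sum_ite_mem, Finset.univ_inter]
        refine (Finset.sum_le_sum this).trans ?_
        rw [Finset.sum_const, nsmul_eq_mul]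
        exact mul_le_mul_of_nonneg_right (by exact_mod_cast hQ) (hN 0)
      have a2 := H1 A Q hQ (fun i => f i.succ) (fun i => N i.succ) (fun i b => hf _ _)
        (fun i => hN _) (fun i => h _)
      rw [Fin.prod_univ_succ]
      calc _ ≤ (M * N 0) * (C1 * ∏ i : Fin (t + 1), N i.succ) := by
            refine mul_le_mul a1 a2 ?_ (mul_nonneg (Nat.cast_nonneg _) (hN 0))
            refine Finset.sum_nonneg fun y _ => ?_
            split_ifs
            · exact Finset.prod_nonneg fun i _ => hf _ _
            · exact le_rfl
        _ = _ := by ring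
    · have b1 : ∀ j : Fin (t + 1), ∑ u, ∑ y : Fin (t + 1) → A,
          f 0 u * (if y j = u then (if KQ (insert u Q) (fun i => y (j.succAbove i))
          then ∏ i, f (Fin.succ i) (y i) else 0) else 0) ≤ C2 * ∏ i, N i := by
        intro j
        have b2 : ∀ u, ∑ y : Fin (t + 1) → A,
          f 0 u * (if y j = u then (if KQ (insert u Q) (fun i => y (j.succAbove i))
          then ∏ i, f (Fin.succ i) (y i) else 0) else 0) ≤
            (f 0 u * f j.succ u) * (C2 * ∏ i, N (j.succAbove i).succ) := by
          intro u
          rw [← (Fin.insertNthEquiv (fun _ : Fin (t + 1) => A) j).sum_comp, Fintype.sum_prod_type]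
          simp only [Fin.insertNthEquiv_apply, Fin.insertNth_apply_same,
            Fin.insertNth_apply_succAbove, Fin.prod_univ_succAbove _ j]
          rw [Finset.sum_eq_single u (fun v _ hv => by simp [hv]) (by simp)]
          simp only [if_true]
          have := H2 A (insert u Q) ((Finset.card_insert_le _ _).trans (by omega))
            (fun i => f (j.succAbove i).succ) (fun i => N (j.succAbove i).succ)
            (fun i b => hf _ _) (fun i => hN _) (fun i => h _)
          refine le_trans (le_of_eq ?_) (mul_le_mul_of_nonneg_left this
            (mul_nonneg (hf 0 u) (hf j.succ u)))
          rw [Finset.mul_sum]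
          refine Finset.sum_congr rfl fun z _ => ?_
          split_ifs <;> ring
        refine (Finset.sum_le_sum fun u _ => b2 u).trans ?_
        rw [← Finset.sum_mul, Fin.prod_univ_succ, Fin.prod_univ_succAbove _ j]
        refine (mul_le_mul_of_nonneg_right (cs_sum (hN 0) (hN j.succ) (h 0) (h j.succ))
          (mul_nonneg hC2 (Finset.prod_nonneg fun i _ => hN _))).trans (le_of_eq ?_)
        ring
      calc _ = ∑ j : Fin (t + 1), ∑ u, ∑ y : Fin (t + 1) → A,
          f 0 u * (if y j = u then (if KQ (insert u Q) (fun i => y (j.succAbove i))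
          then ∏ i, f (Fin.succ i) (y i) else 0) else 0) := by
            rw [Finset.sum_comm (s := (univ : Finset (Fin (t + 1))))]
            refine Finset.sum_congr rfl fun u _ => ?_
            exact Finset.sum_comm
        _ ≤ ∑ j : Fin (t + 1), C2 * ∏ i, N i := Finset.sum_le_sum fun j _ => b1 j
        _ = _ := by simp; ring

lemma BK_prod {t : ℕ} {A B : Type} [Fintype A] [Fintype B] {K : (Fin t → A) → Prop}
    {K' : (Fin t → B) → Prop} {C C' : ℝ} (hC' : 0 ≤ C') (h : BK K C) (h' : BK K' C') :
    BK (fun x : Fin t → A × B => K (fun i => (x i).1) ∧ K' (fun i => (x i).2)) (C * C') := by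
  intro f N hf hN hs
  rw [← (Equiv.arrowProdEquivProdArrow (Fin t) (fun _ => A) (fun _ => B)).symm.sum_comp,
    Fintype.sum_prod_type]
  set F : Fin t → A → ℝ := fun i u => Real.sqrt (∑ b, f i (u, b) ^ 2) with hF
  have hFs : ∀ i u, F i u ^ 2 = ∑ b, f i (u, b) ^ 2 := fun i u =>
    Real.sq_sqrt (Finset.sum_nonneg fun _ _ => sq_nonneg _)
  have h1 := h F N (fun i u => Real.sqrt_nonneg _) hN (fun i => by
    simp only [hFs]
    rw [← Fintype.sum_prod_type (f := fun p : A × B => f i p ^ 2)]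
    exact hs i)
  have h2 : ∀ y : Fin t → A, ∑ z : Fin t → B,
      (if K' z then ∏ i, f i (y i, z i) else 0) ≤ C' * ∏ i, F i (y i) := fun y =>
    h' (fun i b => f i (y i, b)) (fun i => F i (y i)) (fun i b => hf _ _)
      (fun i => Real.sqrt_nonneg _) (fun i => (hFs _ _).ge)
  calc _ ≤ ∑ y : Fin t → A, C' * (if K y then ∏ i, F i (y i) else 0) := by
        refine Finset.sum_le_sum fun y _ => ?_
        by_cases hy : K y
        · simpa [Equiv.arrowProdEquivProdArrow, hy] using h2 y
        · simp [Equiv.arrowProdEquivProdArrow, hy]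
    _ = C' * ∑ y : Fin t → A, (if K y then ∏ i, F i (y i) else 0) := by rw [Finset.mul_sum]
    _ ≤ C' * (C * ∏ i, N i) := mul_le_mul_of_nonneg_left h1 hC'
    _ = _ := by ring

lemma BK_equiv {t : ℕ} {A B : Type} [Fintype A] [Fintype B] (e : A ≃ B) {K : (Fin t → A) → Prop}
    {K' : (Fin t → B) → Prop} {C : ℝ} (h : BK K C) (hK : ∀ x, K' (fun i => e (x i)) → K x) :
    BK K' C := by
  intro f N hf hN hs
  refine le_trans ?_ (h (fun i a => f i (e a)) N (fun i b => hf _ _) hN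
    (fun i => by rw [e.sum_comp (fun b => f i b ^ 2)]; exact hs i))
  rw [← (Equiv.arrowCongr (Equiv.refl (Fin t)) e).sum_comp]
  refine Finset.sum_le_sum fun x _ => ?_
  have e1 : (Equiv.arrowCongr (Equiv.refl (Fin t)) e) x = fun i => e (x i) := rfl
  rw [e1]
  split_ifs with h1 h2 h2
  · exact le_rfl
  · exact absurd (hK _ h1) h2
  · exact Finset.prod_nonneg fun i _ => hf _ _
  · exact le_rfl

lemma multi_pos (k : ℕ) : ∃ C : ℝ, 0 ≤ C ∧ ∀ (c : ℕ) (A : Type) [Fintype A] (q : Fin c → A),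
    BK (fun x : Fin k → (Fin c → A) => ∀ p, KQ {q p} (fun i => x i p)) (C ^ c) := by
  obtain ⟨C, hC, H⟩ := single_pos k 1
  refine ⟨C, hC, fun c => ?_⟩
  induction c with
  | zero =>
    intro A _ q f N hf hN hs
    have : ∀ i (b : Fin 0 → A), f i b ≤ N i := fun i b => le_of_sq_sum (hN i) (hs i) b
    rw [Fintype.sum_unique]
    simp
    exact Finset.prod_le_prod (fun i _ => hf _ _) (fun i _ => this _ _)
  | succ c ih =>
    intro A _ q
    have h1 := H A {q 0} (by simp)
    have h2 := ih A (fun p => q p.succ)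
    rw [pow_succ']
    refine BK_equiv (Fin.consEquiv (fun _ : Fin (c + 1) => A)) (BK_prod (pow_nonneg hC c) h1 h2) ?_
    intro x hx
    exact ⟨by simpa [Fin.consEquiv] using hx 0,
      fun p => by simpa [Fin.consEquiv] using hx p.succ⟩

/-- The surviving tuples. -/
def Surv {k c : ℕ} {A : Type} (q : Fin c → A) (x : Fin k → (Fin c → A)) : Prop :=
  ∀ p, KQ {q p} (fun i => x i p)

lemma count_surv (k : ℕ) : ∃ C : ℝ, 0 ≤ C ∧ ∀ (c : ℕ) (A : Type) [Fintype A] (q : Fin c → A)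
    (S : Finset (Fin c → A)),
    ((((Fintype.piFinset fun _ : Fin k => S).filter (Surv q)).card : ℕ) : ℝ) ≤
      C ^ c * (S.card : ℝ) ^ ((k : ℝ) / 2) := by
  obtain ⟨C, hC, H⟩ := multi_pos k
  refine ⟨C, hC, fun c A _ q S => ?_⟩
  have := H c A q (fun _ x => if x ∈ S then 1 else 0) (fun _ => Real.sqrt S.card)
    (fun i b => by split_ifs <;> norm_num) (fun i => Real.sqrt_nonneg _)
    (fun i => by rw [Real.sq_sqrt (Nat.cast_nonneg _)]; simp)
  have e : (S.card : ℝ) ^ ((k : ℝ) / 2) = ∏ _i : Fin k, Real.sqrt S.card := by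
    rw [Finset.prod_const, Finset.card_univ, Fintype.card_fin, Real.sqrt_eq_rpow,
      ← Real.rpow_natCast, ← Real.rpow_mul (Nat.cast_nonneg _)]
    congr 1; ring
  rw [e]
  refine le_trans (le_of_eq ?_) this
  rw [Finset.card_eq_sum_ones, Finset.sum_filter, Nat.cast_sum]
  rw [← Finset.sum_subset (Finset.subset_univ (Fintype.piFinset fun _ : Fin k => S))]
  · refine Finset.sum_congr rfl fun x hx => ?_
    rw [Fintype.mem_piFinset] at hx
    simp only [hx, if_true, Finset.prod_const_one]
    by_cases hS : Surv q x
    · have hS' : ∀ p, KQ {q p} (fun i => x i p) := hS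
      rw [if_pos hS, if_pos hS', Nat.cast_one]
    · have hS' : ¬ ∀ p, KQ {q p} (fun i => x i p) := hS
      rw [if_neg hS, if_neg hS', Nat.cast_zero]
  · intro x _ hx
    rw [Fintype.mem_piFinset] at hx
    push Not at hx
    obtain ⟨i, hi⟩ := hx
    split_ifs
    · exact Finset.prod_eq_zero (mem_univ i) (by simp [hi])
    · rfl

/-- Index `i` has a position character which is not in the query or an earlier key. -/
def New {k c : ℕ} {A : Type} (q : Fin c → A) (x : Fin k → (Fin c → A)) (i : Fin k) : Prop :=
  ∃ p, x i p ≠ q p ∧ ∀ j, j < i → x j p ≠ x i p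

lemma count_new {k c : ℕ} {A : Type} [Fintype A] (q : Fin c → A) (S : Finset (Fin c → A))
    (J : Finset (Fin k)) :
    ((Fintype.piFinset fun _ : Fin k => S).filter (fun x => univ.filter (New q x) = J)).card ≤
      (k + 1) ^ (c * k) * S.card ^ J.card := by
  have ch : ∀ (x : Fin k → (Fin c → A)) (i : Fin k), ∃ g : Fin c → Option (Fin k),
      ¬ New q x i → ∀ p, (g p = none → x i p = q p) ∧
        (∀ j, g p = some j → j < i ∧ x j p = x i p) := by
    intro x i
    by_cases h : New q x i
    · exact ⟨fun _ => none, fun h' => absurd h h'⟩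
    · have : ∀ p, ∃ o : Option (Fin k), (o = none → x i p = q p) ∧
        (∀ j, o = some j → j < i ∧ x j p = x i p) := by
        intro p
        by_cases hp : x i p = q p
        · exact ⟨none, fun _ => hp, by simp⟩
        · by_contra hcon
          apply h
          refine ⟨p, hp, fun j hj hx => hcon ⟨some j, by simp, ?_⟩⟩
          rintro _ ⟨⟩
          exact ⟨hj, hx⟩
      choose g hg using this
      exact ⟨g, fun _ => hg⟩
  choose G hG using ch
  let T : Finset ((Fin k → (Fin c → A)) × (Fin k → Fin c → Option (Fin k))) :=
    (Fintype.piFinset fun i => if i ∈ J then S else {q}) ×ˢ univ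
  have hT : T.card = (k + 1) ^ (c * k) * S.card ^ J.card := by
    simp only [T, Finset.card_product, Fintype.card_piFinset, apply_ite Finset.card,
      Finset.card_singleton, Finset.prod_ite_mem, Finset.univ_inter, Finset.prod_const]
    simp only [Finset.card_univ, Fintype.card_fun, Fintype.card_option, Fintype.card_fin]
    rw [← pow_mul, mul_comm]
  rw [← hT]
  refine Finset.card_le_card_of_injOn
    (fun x => (fun i => if i ∈ J then x i else q, G x)) ?_ ?_
  · intro x hx
    simp only [Finset.coe_filter, Set.mem_ofPred_eq, Fintype.mem_piFinset] at hx
    simp only [T, Finset.mem_coe, Finset.mem_product, Fintype.mem_piFinset, Finset.mem_univ,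
      and_true]
    intro i
    split_ifs
    · exact hx.1 i
    · simp
  · intro x hx y hy hxy
    simp only [Finset.coe_filter, Set.mem_ofPred_eq] at hx hy
    simp only [Prod.mk.injEq] at hxy
    obtain ⟨h1, h2⟩ := hxy
    have : ∀ n : ℕ, ∀ i : Fin k, i.val = n → x i = y i := by
      intro n
      induction n using Nat.strong_induction_on with
      | _ n ih =>
      intro i hi
      by_cases hJ : i ∈ J
      · have := congrFun h1 i
        simpa [hJ] using this
      · have nx : ¬ New q x i := fun h => hJ (by rw [← hx.2]; simp [h])
        have ny : ¬ New q y i := fun h => hJ (by rw [← hy.2]; simp [h])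
        funext p
        have gx := hG x i nx p
        have gy := hG y i ny p
        rw [← h2] at gy
        cases ho : G x i p with
        | none => rw [gx.1 ho, gy.1 ho]
        | some j =>
          obtain ⟨a1, a2⟩ := gx.2 j ho
          obtain ⟨b1, b2⟩ := gy.2 j ho
          rw [← a2, ← b2, ih j.val (by rw [← hi]; exact a1) j rfl]
    funext i
    exact this _ i rfl

/-- The centred indicator. -/
noncomputable def Zv {c s r : ℕ} (f : Bits r → Bits r) (q x : Fin c → Bits s)
    (T : Fin c → Bits s → Bits r) : ℝ :=
  (if simpleTab T x = f (simpleTab T q) then 1 else 0) - 1 / (2 : ℝ) ^ r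

lemma tab_shift {c s r : ℕ} (T : Fin c → Bits s → Bits r) (p : Fin c) (a : Bits s) (v : Bits r)
    (x : Fin c → Bits s) :
    simpleTab (T + Pi.single p (Pi.single a v)) x = simpleTab T x + if x p = a then v else 0 := by
  unfold simpleTab
  simp only [Pi.add_apply, Finset.sum_add_distrib]
  congr 1
  rw [Finset.sum_eq_single p]
  · rw [Pi.single_eq_same, Pi.single_apply]
  · intro i _ hi
    rw [Pi.single_eq_of_ne hi]; rfl
  · simp

lemma card_bits (r : ℕ) : Fintype.card (Bits r) = 2 ^ r := by
  simp [Bits]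

lemma avg {c s r : ℕ} (f : Bits r → Bits r) (q x : Fin c → Bits s) (p : Fin c)
    (hq : x p ≠ q p) (F : (Fin c → Bits s → Bits r) → ℝ)
    (hF : ∀ T v, F (T + Pi.single p (Pi.single (x p) v)) = F T) (g : ℝ → ℝ) :
    (2 : ℝ) ^ r * ∑ T, F T * g (Zv f q x T) =
      (∑ T, F T) * (g (1 - 1 / 2 ^ r) + (2 ^ r - 1) * g (- (1 / 2 ^ r))) := by
  have h1 : ∀ v : Bits r, ∑ T, F T * g (Zv f q x T) =
      ∑ T, F T * g ((if simpleTab T x + v = f (simpleTab T q) then 1 else 0) - 1 / (2 : ℝ) ^ r) := by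
    intro v
    rw [← Equiv.sum_comp
      (Equiv.addRight (Pi.single p (Pi.single (x p) v) : Fin c → Bits s → Bits r))]
    refine Finset.sum_congr rfl fun T _ => ?_
    simp only [Equiv.coe_addRight, hF, Zv, tab_shift, if_true, if_neg hq.symm, add_zero]
  have h2 : ∑ _v : Bits r, ∑ T, F T * g (Zv f q x T) = 2 ^ r * ∑ T, F T * g (Zv f q x T) := by
    rw [Finset.sum_const, Finset.card_univ, card_bits, nsmul_eq_mul]; push_cast; rfl
  rw [← h2, Finset.sum_congr rfl fun v _ => h1 v, Finset.sum_comm, Finset.sum_mul]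
  refine Finset.sum_congr rfl fun T _ => ?_
  rw [← Finset.mul_sum]
  congr 1
  rw [← Finset.add_sum_erase univ _ (mem_univ (f (simpleTab T q) - simpleTab T x))]
  congr 1
  · simp
  · have : ∀ v ∈ univ.erase (f (simpleTab T q) - simpleTab T x),
        g ((if simpleTab T x + v = f (simpleTab T q) then 1 else 0) - 1 / (2 : ℝ) ^ r) =
          g (- (1 / 2 ^ r)) := by
      intro v hv
      rw [Finset.mem_erase] at hv
      rw [if_neg, zero_sub]
      intro h
      exact hv.1 (by rw [← h]; abel)
    rw [Finset.sum_congr rfl this, Finset.sum_const, Finset.card_erase_of_mem (mem_univ _),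
      Finset.card_univ, card_bits, nsmul_eq_mul, Nat.cast_sub Nat.one_le_two_pow]
    push_cast; rfl

lemma Zv_shift {c s r : ℕ} (f : Bits r → Bits r) (q x : Fin c → Bits s) (p : Fin c) (a : Bits s)
    (hq : q p ≠ a) (hx : x p ≠ a) (T : Fin c → Bits s → Bits r) (v : Bits r) :
    Zv f q x (T + Pi.single p (Pi.single a v)) = Zv f q x T := by
  simp [Zv, tab_shift, hq, hx]

lemma two_pow_inv (r : ℕ) : 0 < 1 / (2 : ℝ) ^ r ∧ 1 / (2 : ℝ) ^ r ≤ 1 := by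
  refine ⟨by positivity, ?_⟩
  rw [div_le_one (by positivity)]
  exact one_le_pow₀ (by norm_num)

lemma abs_Zv_le {c s r : ℕ} (f : Bits r → Bits r) (q x : Fin c → Bits s)
    (T : Fin c → Bits s → Bits r) : |Zv f q x T| ≤ 1 := by
  obtain ⟨h1, h2⟩ := two_pow_inv r
  unfold Zv
  rw [abs_le]
  split_ifs <;> constructor <;> linarith

lemma not_surv_zero {k c s r : ℕ} (f : Bits r → Bits r) (q : Fin c → Bits s)
    (x : Fin k → (Fin c → Bits s)) (h : ¬ Surv q x) :
    ∑ T : Fin c → Bits s → Bits r, ∏ i, Zv f q (x i) T = 0 := by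
  unfold Surv KQ at h
  push Not at h
  obtain ⟨p, i, h1, h2⟩ := h
  rw [Finset.mem_singleton] at h1
  have := avg f q (x i) p h1 (fun T => ∏ j ∈ univ.erase i, Zv f q (x j) T) (by
    intro T v
    refine Finset.prod_congr rfl fun j hj => ?_
    exact Zv_shift _ _ _ _ _ (Ne.symm h1) (h2 j (Finset.ne_of_mem_erase hj)) _ _) id
  simp only [id, Finset.prod_erase_mul _ _ (mem_univ i)] at this
  have h3 : (1 - 1 / (2 : ℝ) ^ r + (2 ^ r - 1) * -(1 / 2 ^ r)) = 0 := by
    field_simp; ring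
  rw [h3, mul_zero] at this
  exact (mul_eq_zero.1 this).resolve_left (by positivity)

lemma new_castSucc {k c : ℕ} {A : Type} (q : Fin c → A) (x : Fin (k + 1) → (Fin c → A))
    (i : Fin k) : New q x i.castSucc ↔ New q (fun j => x j.castSucc) i := by
  constructor
  · rintro ⟨p, h1, h2⟩
    exact ⟨p, h1, fun j hj => h2 _ (by simpa using hj)⟩
  · rintro ⟨p, h1, h2⟩
    refine ⟨p, h1, fun j hj => ?_⟩
    induction j using Fin.lastCases with
    | last => exact absurd hj (not_lt.2 (Fin.le_last _))
    | cast j => exact h2 j (by simpa using hj)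

lemma abs_bound {k c s r : ℕ} (f : Bits r → Bits r) (q : Fin c → Bits s)
    (x : Fin k → (Fin c → Bits s)) :
    ∑ T : Fin c → Bits s → Bits r, ∏ i, |Zv f q (x i) T| ≤
      (Fintype.card (Fin c → Bits s → Bits r) : ℝ) *
        ∏ i, (if New q x i then 2 / (2 : ℝ) ^ r else 1) := by
  induction k with
  | zero => simp
  | succ k ih =>
    have ih' := ih (fun j => x j.castSucc)
    rw [Fin.prod_univ_castSucc]
    simp only [new_castSucc]
    simp only [Fin.prod_univ_castSucc (n := k) (M := ℝ)]
    rw [← mul_assoc]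
    have hF0 : ∀ T, 0 ≤ ∏ i : Fin k, |Zv f q (x i.castSucc) T| := fun T =>
      Finset.prod_nonneg fun i _ => abs_nonneg _
    split_ifs with hn
    · refine le_trans ?_ (mul_le_mul_of_nonneg_right ih' (by positivity))
      obtain ⟨p, h1, h2⟩ := hn
      have := avg f q (x (Fin.last k)) p h1 (fun T => ∏ i : Fin k, |Zv f q (x i.castSucc) T|) (by
        intro T v
        refine Finset.prod_congr rfl fun j _ => ?_
        rw [Zv_shift _ _ _ _ _ (Ne.symm h1) (h2 j.castSucc (Fin.castSucc_lt_last j))]) (fun z => |z|)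
      obtain ⟨e1, e2⟩ := two_pow_inv r
      rw [abs_of_nonneg (by linarith : 0 ≤ 1 - 1 / (2 : ℝ) ^ r), abs_neg,
        abs_of_nonneg e1.le] at this
      rw [mul_div_assoc', le_div_iff₀ (by positivity), mul_comm, this]
      refine mul_le_mul_of_nonneg_left ?_ (Finset.sum_nonneg fun T _ => hF0 T)
      have : (2 : ℝ) ^ r * (1 / 2 ^ r) = 1 := by field_simp
      linarith
    · rw [mul_one]
      refine le_trans (Finset.sum_le_sum fun T _ => ?_) ih'
      exact mul_le_of_le_one_right (hF0 T) (abs_Zv_le _ _ _ _)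

/-- `k`-th moment bound for simple tabulation (Theorem 2): for
constants `c ≥ 1`, `k ≥ 1` there is a constant `C` such that when `n` keys `S` are
hashed into `m = 2^r ≥ n^{1-1/(2c)}` bins by random simple tabulation, `q ∉ S` is a
query key, and the bin `b = f(h(q))` is an arbitrary function of `h(q)`, the number `X`
of keys of `S` hashing to `b` satisfies, with `μ = n/m`:
`E[(X − μ)^k] = O(μ + μ^{k/2})`, i.e. `|E[(X − μ)^k]| ≤ C·(μ + μ^{k/2})`. -/
theorem simple_tabulation_kth_moment (c k : ℕ) (hc : 1 ≤ c) (hk : 1 ≤ k) :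
    ∃ C : ℝ,
      ∀ (s r : ℕ) (S : Finset (Fin c → Bits s)) (q : Fin c → Bits s) (f : Bits r → Bits r),
        q ∉ S →
        (S.card : ℝ) ^ ((1 : ℝ) - 1 / (2 * (c : ℝ))) ≤ (2 : ℝ) ^ r →
        |Ex (fun T : Fin c → Bits s → Bits r =>
            (((S.filter fun x => simpleTab T x = f (simpleTab T q)).card : ℝ) -
                (S.card : ℝ) / (2 : ℝ) ^ r) ^ k)| ≤
          C * ((S.card : ℝ) / (2 : ℝ) ^ r +
            ((S.card : ℝ) / (2 : ℝ) ^ r) ^ ((k : ℝ) / 2)) := by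
  obtain ⟨C0, hC0, H⟩ := count_surv k
  refine ⟨2 ^ k * (2 ^ k * (C0 ^ c + (k + 1) ^ (c * k))), ?_⟩
  intro s r S q f hq _
  set D : ℝ := C0 ^ c + (k + 1) ^ (c * k) with hD
  have hD1 : C0 ^ c ≤ D := by rw [hD]; exact le_add_of_nonneg_right (by positivity)
  have hD2 : ((k : ℝ) + 1) ^ (c * k) ≤ D := by rw [hD]; exact le_add_of_nonneg_left (by positivity)
  have hD0 : 0 ≤ D := le_trans (by positivity) hD1
  have hcard : (0 : ℝ) < (Fintype.card (Fin c → Bits s → Bits r) : ℝ) := by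
    exact_mod_cast Fintype.card_pos
  set P : Finset (Fin k → (Fin c → Bits s)) := Fintype.piFinset fun _ => S with hP
  have hE : Ex (fun T : Fin c → Bits s → Bits r =>
            (((S.filter fun x => simpleTab T x = f (simpleTab T q)).card : ℝ) -
                (S.card : ℝ) / (2 : ℝ) ^ r) ^ k) =
      (∑ x ∈ P, ∑ T : Fin c → Bits s → Bits r, ∏ i, Zv f q (x i) T) /
        (Fintype.card (Fin c → Bits s → Bits r) : ℝ) := by
    unfold Ex
    congr 1
    rw [Finset.sum_comm]
    refine Finset.sum_congr rfl fun T _ => ?_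
    rw [hP, ← Finset.prod_univ_sum (fun _ : Fin k => S) (fun _ x => Zv f q x T),
      Finset.prod_const, Finset.card_univ, Fintype.card_fin]
    congr 1
    simp only [Zv, Finset.sum_sub_distrib, Finset.sum_const, nsmul_eq_mul]
    rw [Finset.sum_boole, mul_one_div]
  have hR : |Ex (fun T : Fin c → Bits s → Bits r =>
            (((S.filter fun x => simpleTab T x = f (simpleTab T q)).card : ℝ) -
                (S.card : ℝ) / (2 : ℝ) ^ r) ^ k)| ≤
      ∑ x ∈ P.filter (Surv q), (2 / (2 : ℝ) ^ r) ^ (univ.filter (New q x)).card := by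
    rw [hE, abs_div, abs_of_pos hcard, div_le_iff₀ hcard, Finset.sum_filter]
    refine (Finset.abs_sum_le_sum_abs _ _).trans ?_
    rw [Finset.sum_mul]
    refine Finset.sum_le_sum fun x _ => ?_
    split_ifs with hs
    · refine (Finset.abs_sum_le_sum_abs _ _).trans ?_
      simp only [Finset.abs_prod]
      refine (abs_bound f q x).trans (le_of_eq ?_)
      rw [mul_comm, Finset.prod_ite, Finset.prod_const, Finset.prod_const_one, mul_one]
    · rw [not_surv_zero f q x hs]; simp
  refine hR.trans ?_
  rw [← Finset.sum_fiberwise (P.filter (Surv q)) (fun x => univ.filter (New q x))]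
  have hm1 : (1 : ℝ) ≤ 2 ^ r := one_le_pow₀ (by norm_num)
  have hm0 : (0 : ℝ) < 2 ^ r := by positivity
  set m : ℝ := 2 ^ r with hm
  set n : ℝ := (S.card : ℝ) with hn
  have hn0 : 0 ≤ n := Nat.cast_nonneg _
  have hμ0 : 0 ≤ n / m := by positivity
  have hμk : 0 ≤ (n / m) ^ ((k : ℝ) / 2) := Real.rpow_nonneg hμ0 _
  have key : ∀ J : Finset (Fin k),
      ∑ x ∈ (P.filter (Surv q)).filter (fun x => univ.filter (New q x) = J),
        (2 / m) ^ (univ.filter (New q x)).card ≤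
      2 ^ k * D * (n / m + (n / m) ^ ((k : ℝ) / 2)) := by
    intro J
    have h1 : ∑ x ∈ (P.filter (Surv q)).filter (fun x => univ.filter (New q x) = J),
        (2 / m) ^ (univ.filter (New q x)).card =
        (((P.filter (Surv q)).filter (fun x => univ.filter (New q x) = J)).card : ℝ) *
          (2 / m) ^ J.card := by
      rw [Finset.sum_congr rfl (g := fun _ => (2 / m) ^ J.card), Finset.sum_const, nsmul_eq_mul]
      intro x hx
      rw [(Finset.mem_filter.1 hx).2]
    rw [h1]
    set W := (P.filter (Surv q)).filter (fun x => univ.filter (New q x) = J) with hW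
    rcases Finset.eq_empty_or_nonempty W with he | ⟨x, hx⟩
    · rw [he]; simp; positivity
    have hJ1 : 1 ≤ J.card := by
      rw [hW, Finset.mem_filter, Finset.mem_filter, hP, Fintype.mem_piFinset] at hx
      rw [Finset.one_le_card, ← hx.2]
      refine ⟨⟨0, hk⟩, ?_⟩
      rw [Finset.mem_filter]
      refine ⟨mem_univ _, ?_⟩
      by_contra hcon
      apply hq
      have : q = x ⟨0, hk⟩ := by
        funext p
        by_contra hp
        exact hcon ⟨p, fun h => hp h.symm, fun j hj => absurd hj (by simp [Fin.lt_def])⟩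
      rw [this]
      exact hx.1.1 _
    have hJk : J.card ≤ k := by simpa using Finset.card_le_univ J
    have c1 : (W.card : ℝ) ≤ D * n ^ ((k : ℝ) / 2) := by
      refine le_trans ?_ ((H c (Bits s) q S).trans
        (mul_le_mul_of_nonneg_right hD1 (Real.rpow_nonneg hn0 _)))
      exact_mod_cast Finset.card_le_card (Finset.filter_subset _ _)
    have c2 : (W.card : ℝ) ≤ D * n ^ J.card := by
      have h2 : W.card ≤ (k + 1) ^ (c * k) * S.card ^ J.card := by
        refine le_trans (Finset.card_le_card ?_) (count_new q S J)
        exact Finset.filter_subset_filter _ (Finset.filter_subset _ _)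
      have h3 : (W.card : ℝ) ≤ ((k : ℝ) + 1) ^ (c * k) * n ^ J.card := by
        rw [hn]; exact_mod_cast h2
      exact h3.trans (mul_le_mul_of_nonneg_right hD2 (by positivity))
    have c3 : (W.card : ℝ) / m ^ J.card ≤ D * (n / m + (n / m) ^ ((k : ℝ) / 2)) := by
      rcases le_total (J.card : ℝ) ((k : ℝ) / 2) with hle | hle
      · calc (W.card : ℝ) / m ^ J.card ≤ D * n ^ J.card / m ^ J.card := by gcongr
          _ = D * (n / m) ^ J.card := by rw [div_pow, mul_div_assoc]
          _ ≤ D * (n / m + (n / m) ^ ((k : ℝ) / 2)) := by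
            refine mul_le_mul_of_nonneg_left ?_ hD0
            rcases le_total (n / m) 1 with hl | hl
            · exact (pow_le_of_le_one hμ0 hl (by omega)).trans (le_add_of_nonneg_right hμk)
            · refine le_trans ?_ (le_add_of_nonneg_left hμ0)
              rw [← Real.rpow_natCast]
              exact Real.rpow_le_rpow_of_exponent_le hl hle
      · calc (W.card : ℝ) / m ^ J.card ≤ D * n ^ ((k : ℝ) / 2) / m ^ J.card := by gcongr
          _ ≤ D * n ^ ((k : ℝ) / 2) / m ^ ((k : ℝ) / 2) := by
            refine div_le_div_of_nonneg_left (mul_nonneg hD0 (Real.rpow_nonneg hn0 _))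
              (Real.rpow_pos_of_pos hm0 _) ?_
            rw [← Real.rpow_natCast]
            exact Real.rpow_le_rpow_of_exponent_le hm1 hle
          _ = D * (n / m) ^ ((k : ℝ) / 2) := by
            rw [Real.div_rpow hn0 hm0.le, mul_div_assoc]
          _ ≤ D * (n / m + (n / m) ^ ((k : ℝ) / 2)) :=
            mul_le_mul_of_nonneg_left (le_add_of_nonneg_left hμ0) hD0
    calc (W.card : ℝ) * (2 / m) ^ J.card = 2 ^ J.card * (W.card / m ^ J.card) := by
          rw [div_pow]; ring
      _ ≤ 2 ^ k * (D * (n / m + (n / m) ^ ((k : ℝ) / 2))) := by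
          refine mul_le_mul (pow_le_pow_right₀ (by norm_num) hJk) c3 (by positivity) (by positivity)
      _ = _ := by ring
  refine (Finset.sum_le_sum fun J _ => key J).trans (le_of_eq ?_)
  rw [Finset.sum_const, Finset.card_univ, Fintype.card_finset, Fintype.card_fin, nsmul_eq_mul]
  push_cast
  ring
end

section
/- Simple tabulation is ε-minwise independent (Theorem 4): for every constant c ≥ 1 there exists a constant C such that the following holds. Let h : Σ^c → [m] be a random simple tabulation hash function with m ≥ n^{1+1/c} (m a power of two), let S ⊆ Σ^c be a set of n keys and q ∈ S. Then |Pr[h(q) = min_{x∈S} h(x)] − 1/n| ≤ ε/n where ε = C·(log n)²/n^{1/c}. -/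
open scoped Classical
open Finset

/-- The numerical value in `[2^n]` of a bit string (used to compare hash values). -/
def bitsToNat {n : ℕ} (v : Bits n) : ℕ :=
  ∑ i : Fin n, (v i).val * 2 ^ (i : ℕ)

namespace STM

lemma zmod2_cases (a : ZMod 2) : a = 0 ∨ a = 1 := by
  revert a; decide

lemma bits_lt : ∀ {n : ℕ} (v : Bits n), bitsToNat v < 2 ^ n := by
  intro n
  induction n with
  | zero => intro v; simp [bitsToNat]
  | succ n ih =>
    intro v
    have h := ih (fun i => v i.castSucc)
    unfold bitsToNat at h ⊢
    rw [Fin.sum_univ_castSucc]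
    have h2 : (v (Fin.last n)).val ≤ 1 := by
      have := ZMod.val_lt (v (Fin.last n)); omega
    simp only [Fin.val_castSucc, Fin.val_last] at *
    have : (v (Fin.last n)).val * 2 ^ n ≤ 1 * 2 ^ n := Nat.mul_le_mul_right _ h2
    rw [pow_succ]; omega

lemma bits_inj : ∀ {n : ℕ}, Function.Injective (bitsToNat (n := n)) := by
  intro n
  induction n with
  | zero => intro v w _; exact Subsingleton.elim _ _
  | succ n ih =>
    intro v w hvw
    have hv := bits_lt (fun i : Fin n => v i.castSucc)
    have hw := bits_lt (fun i : Fin n => w i.castSucc)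
    have ih' := @ih (fun i => v i.castSucc) (fun i => w i.castSucc)
    unfold bitsToNat at hvw ih' hv hw
    rw [Fin.sum_univ_castSucc, Fin.sum_univ_castSucc] at hvw
    simp only [Fin.val_castSucc, Fin.val_last] at *
    have h2 : (v (Fin.last n)).val ≤ 1 := by
      have := ZMod.val_lt (v (Fin.last n)); omega
    have h3 : (w (Fin.last n)).val ≤ 1 := by
      have := ZMod.val_lt (w (Fin.last n)); omega
    have key : (v (Fin.last n)).val = (w (Fin.last n)).val := by
      interval_cases (v (Fin.last n)).val <;> interval_cases (w (Fin.last n)).val <;> omega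
    have h4 := ih' (by rw [key] at hvw; omega)
    funext i
    refine Fin.lastCases ?_ (fun j => ?_) i
    · exact ZMod.val_injective 2 key
    · exact congrFun h4 j

lemma card_bits (r : ℕ) : Fintype.card (Bits r) = 2 ^ r := by
  simp [Bits, ZMod.card]

lemma bits_image (r : ℕ) :
    (univ : Finset (Bits r)).image bitsToNat = range (2 ^ r) := by
  apply Finset.eq_of_subset_of_card_le
  · intro k hk
    simp only [mem_image, mem_univ, true_and] at hk
    obtain ⟨v, rfl⟩ := hk
    exact mem_range.2 (bits_lt v)
  · rw [card_range, card_image_of_injective _ bits_inj, card_univ, card_bits]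

lemma sum_bits (r : ℕ) (φ : ℕ → ℝ) :
    ∑ v : Bits r, φ (bitsToNat v) = ∑ k ∈ range (2 ^ r), φ k := by
  rw [← bits_image, sum_image (fun a _ b _ h => bits_inj h)]

lemma sum_lt (r p : ℕ) (hp : p ≤ 2 ^ r) :
    ∑ v : Bits r, (if bitsToNat v < p then (1 : ℝ) else 0) = p := by
  rw [sum_bits r (fun k => if k < p then (1 : ℝ) else 0), ← sum_filter]
  have : (range (2 ^ r)).filter (fun k => k < p) = range p := by
    ext k; simp; omega
  rw [this]; simp

lemma sum_eq (r p : ℕ) (hp : p < 2 ^ r) :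
    ∑ v : Bits r, (if bitsToNat v = p then (1 : ℝ) else 0) = 1 := by
  rw [sum_bits r (fun k => if k = p then (1 : ℝ) else 0)]
  simp [hp]

section Prob
variable {c s r : ℕ}

/-- Expectation over the random tables. -/
noncomputable def Ex (f : (Fin c → Bits s → Bits r) → ℝ) : ℝ :=
  (∑ T, f T) / (Fintype.card (Fin c → Bits s → Bits r) : ℝ)

/-- Shift one table entry. -/
noncomputable def sh (i : Fin c) (σ : Bits s) (v : Bits r) : Fin c → Bits s → Bits r :=
  Pi.single i (Pi.single σ v)

lemma tab_sh (T : Fin c → Bits s → Bits r) (i : Fin c) (σ : Bits s) (v : Bits r)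
    (y : Fin c → Bits s) :
    simpleTab (T + sh i σ v) y = simpleTab T y + if y i = σ then v else 0 := by
  unfold simpleTab sh
  simp only [Pi.add_apply, sum_add_distrib]
  congr 1
  rw [Finset.sum_eq_single i]
  · simp [Pi.single_apply]
  · intro j _ hj; simp [Pi.single_apply, hj]
  · simp

lemma cardΩ_pos : (0 : ℝ) < (Fintype.card (Fin c → Bits s → Bits r) : ℝ) := by
  exact_mod_cast Fintype.card_pos

lemma Ex_mono {f g : (Fin c → Bits s → Bits r) → ℝ} (h : ∀ T, f T ≤ g T) : Ex f ≤ Ex g := by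
  unfold Ex
  exact div_le_div_of_nonneg_right (sum_le_sum fun T _ => h T) cardΩ_pos.le

lemma Ex_add (f g : (Fin c → Bits s → Bits r) → ℝ) :
    Ex (fun T => f T + g T) = Ex f + Ex g := by
  unfold Ex; rw [sum_add_distrib, add_div]

lemma Ex_sub (f g : (Fin c → Bits s → Bits r) → ℝ) :
    Ex (fun T => f T - g T) = Ex f - Ex g := by
  unfold Ex; rw [sum_sub_distrib, sub_div]

lemma Ex_mul (a : ℝ) (f : (Fin c → Bits s → Bits r) → ℝ) :
    Ex (fun T => a * f T) = a * Ex f := by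
  unfold Ex; rw [← mul_sum, mul_div_assoc]

lemma Ex_sum {ι : Type*} (A : Finset ι) (f : ι → (Fin c → Bits s → Bits r) → ℝ) :
    Ex (fun T => ∑ a ∈ A, f a T) = ∑ a ∈ A, Ex (f a) := by
  unfold Ex; rw [sum_comm, sum_div]

lemma Ex_one : Ex (fun _ : Fin c → Bits s → Bits r => (1 : ℝ)) = 1 := by
  unfold Ex
  rw [sum_const, card_univ, nsmul_eq_mul, mul_one, div_self cardΩ_pos.ne']

lemma Ex_nonneg {f : (Fin c → Bits s → Bits r) → ℝ} (h : ∀ T, 0 ≤ f T) : 0 ≤ Ex f :=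
  div_nonneg (sum_nonneg fun T _ => h T) cardΩ_pos.le

lemma core (f : (Fin c → Bits s → Bits r) → ℝ) (x : Fin c → Bits s) (i : Fin c)
    (φ : Bits r → ℝ) (hf : ∀ T v, f (T + sh i (x i) v) = f T) :
    Ex (fun T => f T * φ (simpleTab T x)) = Ex f * ((∑ w, φ w) / 2 ^ r) := by
  have key : (2 : ℝ) ^ r * ∑ T, f T * φ (simpleTab T x) = (∑ T, f T) * ∑ w, φ w := by
    have h1 : ∀ v : Bits r, ∑ T, f T * φ (simpleTab T x)
        = ∑ T, f T * φ (simpleTab T x + v) := by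
      intro v
      rw [← Equiv.sum_comp (Equiv.addRight (sh i (x i) v))]
      refine sum_congr rfl fun T _ => ?_
      simp only [Equiv.coe_addRight, hf, tab_sh, if_true]
    have h2 : ∑ v : Bits r, ∑ T, f T * φ (simpleTab T x) =
        ∑ v : Bits r, ∑ T, f T * φ (simpleTab T x + v) := sum_congr rfl fun v _ => h1 v
    rw [sum_const, card_univ, card_bits, nsmul_eq_mul, sum_comm] at h2
    push_cast at h2
    rw [h2, sum_mul]
    refine sum_congr rfl fun T _ => ?_
    rw [← mul_sum]
    congr 1
    exact Equiv.sum_comp (Equiv.addLeft (simpleTab T x)) φ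
  unfold Ex
  have := cardΩ_pos (c := c) (s := s) (r := r)
  field_simp
  linarith

/-- indicator that key `x` hashes below `p` -/
noncomputable def X (p : ℕ) (x : Fin c → Bits s) (T : Fin c → Bits s → Bits r) : ℝ :=
  if bitsToNat (simpleTab T x) < p then 1 else 0

/-- indicator that no key of `U` hashes below `p` -/
noncomputable def A (p : ℕ) (U : Finset (Fin c → Bits s)) (T : Fin c → Bits s → Bits r) : ℝ :=
  if ∀ x ∈ U, p ≤ bitsToNat (simpleTab T x) then 1 else 0

/-- indicator that `q` hashes to `p` -/
noncomputable def Q (p : ℕ) (q : Fin c → Bits s) (T : Fin c → Bits s → Bits r) : ℝ :=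
  if bitsToNat (simpleTab T q) = p then 1 else 0

lemma X_nonneg (p : ℕ) (x : Fin c → Bits s) (T : Fin c → Bits s → Bits r) : 0 ≤ X p x T := by
  unfold X; split_ifs <;> norm_num
lemma X_le (p : ℕ) (x : Fin c → Bits s) (T : Fin c → Bits s → Bits r) : X p x T ≤ 1 := by
  unfold X; split_ifs <;> norm_num
lemma A_nonneg (p : ℕ) (x) (T : Fin c → Bits s → Bits r) : 0 ≤ A p x T := by
  unfold A; split_ifs <;> norm_num
lemma A_le (p : ℕ) (x) (T : Fin c → Bits s → Bits r) : A p x T ≤ 1 := by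
  unfold A; split_ifs <;> norm_num
lemma Q_nonneg (p : ℕ) (x : Fin c → Bits s) (T : Fin c → Bits s → Bits r) : 0 ≤ Q p x T := by
  unfold Q; split_ifs <;> norm_num

lemma X_inv (p : ℕ) (x : Fin c → Bits s) (T : Fin c → Bits s → Bits r) {i : Fin c} {σ : Bits s}
    (v : Bits r) (h : x i ≠ σ) : X p x (T + sh i σ v) = X p x T := by
  unfold X; rw [tab_sh, if_neg h, add_zero]
lemma Q_inv (p : ℕ) (x : Fin c → Bits s) (T : Fin c → Bits s → Bits r) {i : Fin c} {σ : Bits s}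
    (v : Bits r) (h : x i ≠ σ) : Q p x (T + sh i σ v) = Q p x T := by
  unfold Q; rw [tab_sh, if_neg h, add_zero]
lemma A_inv (p : ℕ) (U : Finset (Fin c → Bits s)) (T : Fin c → Bits s → Bits r)
    {i : Fin c} {σ : Bits s}
    (v : Bits r) (h : ∀ x ∈ U, x i ≠ σ) : A p U (T + sh i σ v) = A p U T := by
  unfold A
  congr 1
  apply propext
  refine forall₂_congr fun x hx => ?_
  rw [tab_sh, if_neg (h x hx), add_zero]

lemma core_X (f : (Fin c → Bits s → Bits r) → ℝ) (x : Fin c → Bits s) (i : Fin c)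
    (p : ℕ) (hp : p ≤ 2 ^ r) (hf : ∀ T v, f (T + sh i (x i) v) = f T) :
    Ex (fun T => f T * X p x T) = Ex f * ((p : ℝ) / 2 ^ r) := by
  rw [← sum_lt r p hp]
  exact core f x i (fun w => if bitsToNat w < p then (1 : ℝ) else 0) hf

lemma Ex_Q (hc : 1 ≤ c) (q : Fin c → Bits s) (p : ℕ) (hp : p < 2 ^ r) :
    Ex (Q p q (r := r)) = 1 / 2 ^ r := by
  have := core (c := c) (s := s) (r := r) (fun _ => 1) q ⟨0, hc⟩
    (fun w => if bitsToNat w = p then (1 : ℝ) else 0) (fun _ _ => rfl)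
  rw [sum_eq r p hp, Ex_one] at this
  simp only [one_mul] at this
  exact this

/-- three-wise independence (upper bound form) -/
lemma Ex_QXX (q x y : Fin c → Bits s) (hxq : x ≠ q) (hyq : y ≠ q) (hxy : x ≠ y)
    (p p' : ℕ) (hp : p ≤ 2 ^ r) :
    Ex (fun T : Fin c → Bits s → Bits r => Q p' q T * X p x T * X p y T)
      = Ex (Q p' q (r := r)) * ((p : ℝ) / 2 ^ r) ^ 2 := by
  have main : ∀ a b : Fin c → Bits s, a ≠ q → ∀ i, b i ≠ q i → b i ≠ a i →
      Ex (fun T : Fin c → Bits s → Bits r => Q p' q T * X p a T * X p b T)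
      = Ex (Q p' q (r := r)) * ((p : ℝ) / 2 ^ r) ^ 2 := by
    intro a b ha i h1 h2
    rw [core_X (fun T => Q p' q T * X p a T) b i p hp
      (fun T v => by rw [Q_inv _ _ _ _ h1.symm, X_inv _ _ _ _ h2.symm])]
    obtain ⟨j, hj⟩ := Function.ne_iff.1 ha
    rw [core_X (fun T => Q p' q T) a j p hp (fun T v => Q_inv _ _ _ _ hj.symm)]
    ring
  obtain ⟨i, hi⟩ := Function.ne_iff.1 hxy
  by_cases h : y i = q i
  · have := main y x hyq i (by rw [← h]; exact hi) hi
    rw [← this]; congr 1; funext T; ring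
  · exact main x y hxq i h hi.symm

/-- a chain of keys, each with a fresh character -/
lemma Ex_chain (hc : 1 ≤ c) (p : ℕ) (hp : p ≤ 2 ^ r) (w : ℕ → Fin c → Bits s) (u : ℕ)
    (hw : ∀ j < u, ∃ i, ∀ j' < j, w j' i ≠ w j i) :
    Ex (fun T : Fin c → Bits s → Bits r => ∏ j ∈ range u, X p (w j) T)
      = ((p : ℝ) / 2 ^ r) ^ u := by
  induction u with
  | zero => simp [Ex_one]
  | succ u ih =>
    obtain ⟨i, hi⟩ := hw u (Nat.lt_succ_self u)
    simp only [prod_range_succ]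
    rw [core_X (fun T => ∏ j ∈ range u, X p (w j) T) (w u) i p hp
      (fun T v => prod_congr rfl fun j hj => X_inv _ _ _ _ (hi j (mem_range.1 hj)))]
    rw [ih (fun j hj => hw j (by omega)), pow_succ]

end Prob


section Rec
variable {c s r : ℕ}

lemma ind_mul {P P1 P2 : Prop} [Decidable P] [Decidable P1] [Decidable P2] (h : P ↔ P1 ∧ P2) :
    (if P then (1 : ℝ) else 0) = (if P1 then 1 else 0) * (if P2 then 1 else 0) := by
  by_cases h1 : P1 <;> by_cases h2 : P2 <;> simp [h, h1, h2]

lemma A_split (p : ℕ) (U : Finset (Fin c → Bits s)) (i : Fin c) (σ : Bits s)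
    (T : Fin c → Bits s → Bits r) :
    A p U T = A p (U.filter fun x => x i ≠ σ) T * A p (U.filter fun x => x i = σ) T := by
  unfold A
  apply ind_mul
  simp only [mem_filter]
  constructor
  · intro h; exact ⟨fun x hx => h x hx.1, fun x hx => h x hx.1⟩
  · rintro ⟨h1, h2⟩ x hx
    by_cases h : x i = σ
    · exact h2 x ⟨hx, h⟩
    · exact h1 x ⟨hx, h⟩

lemma sumX_eq (p : ℕ) (G : Finset (Fin c → Bits s)) (T : Fin c → Bits s → Bits r) :
    ∑ x ∈ G, X p x T = ((G.filter fun x => bitsToNat (simpleTab T x) < p).card : ℝ) := by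
  unfold X; rw [sum_boole]

lemma A_eq (p : ℕ) (G : Finset (Fin c → Bits s)) (T : Fin c → Bits s → Bits r) :
    A p G T = if (G.filter fun x => bitsToNat (simpleTab T x) < p).card = 0 then 1 else 0 := by
  unfold A
  congr 1
  apply propext
  rw [card_eq_zero, filter_eq_empty_iff]
  simp only [not_lt]

lemma A_ge (p : ℕ) (G : Finset (Fin c → Bits s)) (T : Fin c → Bits s → Bits r) :
    1 - ∑ x ∈ G, X p x T ≤ A p G T := by
  rw [sumX_eq, A_eq]
  split_ifs with h
  · rw [h]; simp
  · have : (1 : ℝ) ≤ ((G.filter fun x => bitsToNat (simpleTab T x) < p).card : ℝ) := by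
      exact_mod_cast Nat.one_le_iff_ne_zero.2 h
    linarith

lemma X_sq (p : ℕ) (x : Fin c → Bits s) (T : Fin c → Bits s → Bits r) :
    X p x T * X p x T = X p x T := by
  unfold X; split_ifs <;> norm_num

lemma A_le_two (p : ℕ) (G : Finset (Fin c → Bits s)) (T : Fin c → Bits s → Bits r) :
    A p G T ≤ 1 - ∑ x ∈ G, X p x T + ∑ x ∈ G, ∑ y ∈ G.erase x, X p x T * X p y T := by
  have h : ∑ x ∈ G, ∑ y ∈ G.erase x, X p x T * X p y T
      = (∑ x ∈ G, X p x T) ^ 2 - ∑ x ∈ G, X p x T := by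
    rw [sq, sum_mul, ← sum_sub_distrib]
    refine sum_congr rfl fun x hx => ?_
    rw [← mul_sum, ← add_sum_erase G (fun y => X p y T) hx, mul_add, X_sq]; ring
  rw [h, A_eq, sumX_eq]
  split_ifs with h
  · rw [h]; simp
  · nlinarith [sq_nonneg (((G.filter fun x => bitsToNat (simpleTab T x) < p).card : ℝ) - 1)]

/-- every large set contains a chain -/
lemma exists_chain (B : Finset (Fin c → Bits s)) (u : ℕ) (hB : u ^ c < B.card) :
    ∀ k ≤ u + 1, ∃ w : ℕ → Fin c → Bits s, (∀ j < k, w j ∈ B) ∧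
      ∀ j < k, ∃ i, ∀ j' < j, w j' i ≠ w j i := by
  intro k
  induction k with
  | zero => intro _; exact ⟨fun _ _ => 0, by simp, by simp⟩
  | succ k ih =>
    intro hk
    obtain ⟨w, hw1, hw2⟩ := ih (by omega)
    have : ∃ x ∈ B, ∃ i, ∀ j' < k, w j' i ≠ x i := by
      by_contra hcon
      push Not at hcon
      have hsub : B ⊆ Fintype.piFinset (fun i => (range k).image fun j => w j i) := by
        intro x hx
        rw [Fintype.mem_piFinset]
        intro i
        obtain ⟨j, hj, hji⟩ := hcon x hx i
        exact mem_image.2 ⟨j, mem_range.2 hj, hji⟩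
      have h1 := card_le_card hsub
      rw [Fintype.card_piFinset] at h1
      have h2 : ∏ i : Fin c, ((range k).image fun j => w j i).card ≤ ∏ _i : Fin c, u :=
        prod_le_prod' fun i _ => card_image_le.trans (by rw [card_range]; omega)
      simp at h2
      omega
    obtain ⟨x, hx, i, hi⟩ := this
    refine ⟨fun j => if j = k then x else w j, ?_, ?_⟩
    · intro j hj
      by_cases h : j = k
      · simp [h, hx]
      · simp only [h, if_false]; exact hw1 j (by omega)
    · intro j hj
      by_cases h : j = k
      · refine ⟨i, fun j' hj' => ?_⟩
        simp only [h, if_true]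
        rw [if_neg (by omega)]
        exact hi j' (by omega)
      · obtain ⟨i', hi'⟩ := hw2 j (by omega)
        refine ⟨i', fun j' hj' => ?_⟩
        simp only [h, if_false]
        rw [if_neg (by omega)]
        exact hi' j' hj'

/-- extend a finite sequence to all naturals -/
noncomputable def ext {k : ℕ} (w : Fin k → Fin c → Bits s) (j : ℕ) : Fin c → Bits s :=
  if h : j < k then w ⟨j, h⟩ else fun _ => 0

/-- chains of length `k` in `G` -/
noncomputable def chains (G : Finset (Fin c → Bits s)) (k : ℕ) :
    Finset (Fin k → Fin c → Bits s) :=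
  (Fintype.piFinset fun _ => G).filter fun w => ∀ j < k, ∃ i, ∀ j' < j, ext w j' i ≠ ext w j i

lemma A_le_tail (p : ℕ) (G : Finset (Fin c → Bits s)) (T : Fin c → Bits s → Bits r) (u : ℕ)
    (hu : 1 ≤ u) :
    A p G T ≤ 1 - (∑ x ∈ G, X p x T) / (u : ℝ) ^ c
      + G.card * ∑ w ∈ chains G (u + 1), ∏ j ∈ range (u + 1), X p (ext w j) T := by
  set B := G.filter fun x => bitsToNat (simpleTab T x) < p with hBdef
  have hnn : 0 ≤ ∑ w ∈ chains G (u + 1), ∏ j ∈ range (u + 1), X p (ext w j) T :=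
    sum_nonneg fun w _ => prod_nonneg fun j _ => X_nonneg _ _ _
  have hD : (1 : ℝ) ≤ (u : ℝ) ^ c := one_le_pow₀ (by exact_mod_cast hu)
  have hBG : B.card ≤ G.card := card_le_card (filter_subset _ _)
  have hBG' : (B.card : ℝ) ≤ G.card := by exact_mod_cast hBG
  rw [sumX_eq, A_eq, ← hBdef]
  by_cases hB : u ^ c < B.card
  · obtain ⟨w, hw1, hw2⟩ := exists_chain B u hB (u + 1) le_rfl
    set w' : Fin (u + 1) → Fin c → Bits s := fun j => w j with hw'
    have hext : ∀ j < u + 1, ext w' j = w j := by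
      intro j hj; unfold ext; rw [dif_pos hj]
    have hmem : w' ∈ chains G (u + 1) := by
      unfold chains
      rw [mem_filter, Fintype.mem_piFinset]
      refine ⟨fun j => (mem_filter.1 (hw1 j j.2)).1, fun j hj => ?_⟩
      obtain ⟨i, hi⟩ := hw2 j hj
      refine ⟨i, fun j' hj' => ?_⟩
      rw [hext j hj, hext j' (by omega)]
      exact hi j' hj'
    have h1 : (1 : ℝ) ≤ ∑ w ∈ chains G (u + 1), ∏ j ∈ range (u + 1), X p (ext w j) T := by
      have h2 := single_le_sum (f := fun w => ∏ j ∈ range (u + 1), X p (ext w j) T)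
        (fun w _ => prod_nonneg fun j _ => X_nonneg _ _ _) hmem
      refine le_trans (le_of_eq ?_) h2
      symm
      apply prod_eq_one
      intro j hj
      rw [hext j (mem_range.1 hj)]
      unfold X
      rw [if_pos (mem_filter.1 (hw1 j (mem_range.1 hj))).2]
    have h3 : (B.card : ℝ) / (u : ℝ) ^ c ≤ B.card := div_le_self (by positivity) hD
    rw [if_neg (by omega)]
    nlinarith
  · push Not at hB
    have hB' : (B.card : ℝ) ≤ (u : ℝ) ^ c := by exact_mod_cast hB
    have h4 : 0 ≤ (G.card : ℝ) * ∑ w ∈ chains G (u + 1), ∏ j ∈ range (u + 1), X p (ext w j) T :=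
      mul_nonneg (by positivity) hnn
    split_ifs with h
    · rw [h]; simp; exact h4
    · have : (B.card : ℝ) / (u : ℝ) ^ c ≤ 1 := (div_le_one (by linarith)).2 hB'
      linarith

lemma sum_step (f0 : (Fin c → Bits s → Bits r) → ℝ) (p : ℕ) (hp : p ≤ 2 ^ r)
    (U : Finset (Fin c → Bits s)) (i : Fin c) (σ : Bits s)
    (hf0 : ∀ T v, f0 (T + sh i σ v) = f0 T) :
    Ex (fun T => f0 T * A p (U.filter fun x => x i ≠ σ) T *
      ∑ x ∈ U.filter (fun x => x i = σ), X p x T) =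
    Ex (fun T => f0 T * A p (U.filter fun x => x i ≠ σ) T) *
      ((p : ℝ) / 2 ^ r * (U.filter fun x => x i = σ).card) := by
  simp only [mul_sum]
  rw [Ex_sum]
  rw [sum_congr rfl (g := fun _ => Ex (fun T => f0 T * A p (U.filter fun x => x i ≠ σ) T) *
      ((p : ℝ) / 2 ^ r))]
  · rw [sum_const, nsmul_eq_mul]; ring
  · intro x hx
    have hxi : x i = σ := (mem_filter.1 hx).2
    apply core_X (fun T => f0 T * A p (U.filter fun x => x i ≠ σ) T) x i p hp
    intro T v
    rw [hxi, hf0, A_inv]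
    intro y hy; exact (mem_filter.1 hy).2

lemma step_lower (f0 : (Fin c → Bits s → Bits r) → ℝ) (h0 : ∀ T, 0 ≤ f0 T)
    (p : ℕ) (hp : p ≤ 2 ^ r)
    (U : Finset (Fin c → Bits s)) (i : Fin c) (σ : Bits s)
    (hf0 : ∀ T v, f0 (T + sh i σ v) = f0 T) :
    (1 - (p : ℝ) / 2 ^ r * (U.filter fun x => x i = σ).card) *
      Ex (fun T => f0 T * A p (U.filter fun x => x i ≠ σ) T)
    ≤ Ex (fun T => f0 T * A p U T) := by
  have h := sum_step f0 p hp U i σ hf0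
  have h2 : Ex (fun T => f0 T * A p (U.filter fun x => x i ≠ σ) T -
      f0 T * A p (U.filter fun x => x i ≠ σ) T *
      ∑ x ∈ U.filter (fun x => x i = σ), X p x T) ≤ Ex (fun T => f0 T * A p U T) := by
    apply Ex_mono
    intro T
    rw [A_split p U i σ T]
    have := mul_le_mul_of_nonneg_left (A_ge p (U.filter fun x => x i = σ) T)
      (mul_nonneg (h0 T) (A_nonneg p (U.filter fun x => x i ≠ σ) T))
    linarith
  rw [Ex_sub, h] at h2
  linarith

lemma step_upper (q : Fin c → Bits s) (p' p : ℕ) (hp : p ≤ 2 ^ r)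
    (U : Finset (Fin c → Bits s)) (hq : q ∉ U) (i : Fin c) (σ : Bits s) (hσ : σ ≠ q i) :
    Ex (fun T : Fin c → Bits s → Bits r => Q p' q T * A p U T) ≤
    (1 - (p : ℝ) / 2 ^ r * (U.filter fun x => x i = σ).card) *
      Ex (fun T : Fin c → Bits s → Bits r => Q p' q T * A p (U.filter fun x => x i ≠ σ) T)
    + Ex (Q p' q (r := r)) * ((p : ℝ) / 2 ^ r * (U.filter fun x => x i = σ).card) ^ 2 := by
  set G := U.filter fun x => x i = σ with hG
  have h := sum_step (r := r) (fun T => Q p' q T) p hp U i σ (fun T v => Q_inv _ _ _ _ hσ.symm)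
  have hE : 0 ≤ Ex (Q p' q (r := r)) := Ex_nonneg fun T => Q_nonneg _ _ _
  have h2 : Ex (fun T : Fin c → Bits s → Bits r => Q p' q T * A p U T) ≤
    Ex (fun T : Fin c → Bits s → Bits r => (Q p' q T * A p (U.filter fun x => x i ≠ σ) T -
      Q p' q T * A p (U.filter fun x => x i ≠ σ) T * ∑ x ∈ G, X p x T) +
      ∑ x ∈ G, ∑ y ∈ G.erase x, Q p' q T * X p x T * X p y T) := by
    apply Ex_mono
    intro T
    rw [A_split p U i σ T]
    have h3 := mul_le_mul_of_nonneg_left (A_le_two p G T)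
      (mul_nonneg (Q_nonneg p' q T) (A_nonneg p (U.filter fun x => x i ≠ σ) T))
    have h4 : 0 ≤ ∑ x ∈ G, ∑ y ∈ G.erase x, X p x T * X p y T :=
      sum_nonneg fun x _ => sum_nonneg fun y _ => mul_nonneg (X_nonneg _ _ _) (X_nonneg _ _ _)
    have h5 : ∑ x ∈ G, ∑ y ∈ G.erase x, Q p' q T * X p x T * X p y T =
      Q p' q T * ∑ x ∈ G, ∑ y ∈ G.erase x, X p x T * X p y T := by
      simp only [mul_sum, mul_assoc]
    rw [h5]
    have h6 : Q p' q T * A p (U.filter fun x => x i ≠ σ) T *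
        ∑ x ∈ G, ∑ y ∈ G.erase x, X p x T * X p y T ≤
        Q p' q T * ∑ x ∈ G, ∑ y ∈ G.erase x, X p x T * X p y T := by
      apply mul_le_mul_of_nonneg_right _ h4
      exact mul_le_of_le_one_right (Q_nonneg _ _ _) (A_le _ _ _)
    linarith
  rw [Ex_add, Ex_sub, h, Ex_sum] at h2
  have h7 : ∑ x ∈ G, Ex (fun T : Fin c → Bits s → Bits r =>
      ∑ y ∈ G.erase x, Q p' q T * X p x T * X p y T) ≤
      ∑ x ∈ G, ∑ y ∈ G, Ex (Q p' q (r := r)) * ((p : ℝ) / 2 ^ r) ^ 2 := by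
    refine sum_le_sum fun x hx => ?_
    rw [Ex_sum]
    have : ∑ y ∈ G.erase x, Ex (fun T : Fin c → Bits s → Bits r =>
        Q p' q T * X p x T * X p y T) =
        ∑ y ∈ G.erase x, Ex (Q p' q (r := r)) * ((p : ℝ) / 2 ^ r) ^ 2 := by
      refine sum_congr rfl fun y hy => ?_
      have hxU := (mem_filter.1 hx).1
      have hyU := (mem_filter.1 (mem_of_mem_erase hy)).1
      exact Ex_QXX q x y (fun h => hq (h ▸ hxU)) (fun h => hq (h ▸ hyU))
        (ne_of_mem_erase hy).symm p p' hp
    rw [this]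
    exact sum_le_sum_of_subset_of_nonneg (erase_subset _ _) (fun _ _ _ => by positivity)
  simp only [sum_const, nsmul_eq_mul] at h7
  nlinarith

lemma step_tail (hc : 1 ≤ c) (p : ℕ) (hp : p ≤ 2 ^ r)
    (U : Finset (Fin c → Bits s)) (i : Fin c) (σ : Bits s) (u : ℕ) (hu : 1 ≤ u) :
    Ex (A p U (r := r)) ≤
    (1 - (p : ℝ) / 2 ^ r * (U.filter fun x => x i = σ).card / (u : ℝ) ^ c) *
      Ex (A p (U.filter fun x => x i ≠ σ) (r := r))
    + (U.filter fun x => x i = σ).card *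
      ((p : ℝ) / 2 ^ r * (U.filter fun x => x i = σ).card) ^ (u + 1) := by
  set G := U.filter fun x => x i = σ with hG
  have h := sum_step (r := r) (fun _ => 1) p hp U i σ (fun T v => rfl)
  simp only [one_mul] at h
  have h2 : Ex (A p U (r := r)) ≤
    Ex (fun T : Fin c → Bits s → Bits r => (A p (U.filter fun x => x i ≠ σ) T -
      (1 / (u : ℝ) ^ c) * (A p (U.filter fun x => x i ≠ σ) T * ∑ x ∈ G, X p x T)) +
      G.card * ∑ w ∈ chains G (u + 1), ∏ j ∈ range (u + 1), X p (ext w j) T) := by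
    apply Ex_mono
    intro T
    rw [A_split p U i σ T]
    have h3 := mul_le_mul_of_nonneg_left (A_le_tail p G T u hu)
      (A_nonneg p (U.filter fun x => x i ≠ σ) T)
    have h4 : 0 ≤ (G.card : ℝ) * ∑ w ∈ chains G (u + 1), ∏ j ∈ range (u + 1), X p (ext w j) T :=
      mul_nonneg (by positivity)
        (sum_nonneg fun w _ => prod_nonneg fun j _ => X_nonneg _ _ _)
    have h6 := mul_le_of_le_one_left h4 (A_le p (U.filter fun x => x i ≠ σ) T)
    refine h3.trans ?_
    rw [mul_add, mul_sub, mul_one]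
    refine add_le_add (le_of_eq ?_) h6
    ring
  rw [Ex_add, Ex_sub, Ex_mul, Ex_mul, h, Ex_sum] at h2
  have h7 : ∑ w ∈ chains G (u + 1), Ex (fun T : Fin c → Bits s → Bits r =>
      ∏ j ∈ range (u + 1), X p (ext w j) T) ≤ (G.card : ℝ) ^ (u + 1) *
        ((p : ℝ) / 2 ^ r) ^ (u + 1) := by
    rw [sum_congr rfl (g := fun _ => ((p : ℝ) / 2 ^ r) ^ (u + 1))]
    · rw [sum_const, nsmul_eq_mul]
      apply mul_le_mul_of_nonneg_right _ (by positivity)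
      have : (chains G (u + 1)).card ≤ G.card ^ (u + 1) := by
        refine (card_filter_le _ _).trans ?_
        simp
      exact_mod_cast this
    · intro w hw
      exact Ex_chain hc p hp _ _ (mem_filter.1 hw).2
  have h8 := mul_le_mul_of_nonneg_left h7 (Nat.cast_nonneg (α := ℝ) G.card)
  rw [mul_pow]
  refine h2.trans ?_
  have h9 : 1 / (u : ℝ) ^ c * (Ex (A p (U.filter fun x => x i ≠ σ) (r := r)) *
      ((p : ℝ) / 2 ^ r * G.card)) =
      (p : ℝ) / 2 ^ r * G.card / (u : ℝ) ^ c * Ex (A p (U.filter fun x => x i ≠ σ) (r := r)) := by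
    ring
  change Ex (A p (U.filter fun x => x i ≠ σ) (r := r)) - 1 / (u : ℝ) ^ c *
    (Ex (A p (U.filter fun x => x i ≠ σ) (r := r)) * ((p : ℝ) / 2 ^ r * G.card)) + _ ≤ _
  rw [h9]
  linarith

/-- the group lemma -/
lemma exists_group (hc : 1 ≤ c) (U : Finset (Fin c → Bits s)) (q : Fin c → Bits s) (hq : q ∉ U)
    (hU : U.Nonempty) :
    ∃ i σ, σ ≠ q i ∧ (U.filter fun x => x i = σ).Nonempty ∧
      ((U.filter fun x => x i = σ).card : ℝ) ≤ 2 * (U.card : ℝ) ^ (1 - 1 / (c : ℝ)) := by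
  let K : Fin c → Finset (Bits s) := fun i => (U.image fun x => x i).erase (q i)
  have hsub : insert q U ⊆ Fintype.piFinset (fun i => insert (q i) (K i)) := by
    intro x hx
    rw [Fintype.mem_piFinset]
    intro i
    by_cases h : x i = q i
    · rw [h]; exact mem_insert_self _ _
    · rcases mem_insert.1 hx with h' | h'
      · exact absurd (by rw [h']) h
      · exact mem_insert_of_mem (mem_erase.2 ⟨h, mem_image_of_mem (fun x => x i) h'⟩)
  have h1 := card_le_card hsub
  rw [card_insert_of_notMem hq, Fintype.card_piFinset] at h1
  have h2 : ∃ i, U.card + 1 ≤ ((K i).card + 1) ^ c := by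
    by_contra hcon
    push Not at hcon
    have : Nonempty (Fin c) := ⟨⟨0, hc⟩⟩
    obtain ⟨i, -, hi⟩ := exists_max_image (univ : Finset (Fin c)) (fun i => (K i).card)
      univ_nonempty
    have : ∏ j : Fin c, (insert (q j) (K j)).card ≤ ∏ _j : Fin c, ((K i).card + 1) :=
      prod_le_prod' fun j _ => (card_insert_le _ _).trans (by have := hi j (mem_univ _); omega)
    simp only [prod_const, card_univ, Fintype.card_fin] at this
    have := hcon i
    omega
  obtain ⟨i, hi⟩ := h2
  have hUpos : 0 < U.card := hU.card_pos
  have hKpos : 0 < (K i).card := by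
    rcases Nat.eq_zero_or_pos (K i).card with h | h
    · rw [h] at hi; simp only [zero_add, one_pow] at hi; omega
    · exact h
  have hKne : (K i).Nonempty := card_pos.1 hKpos
  obtain ⟨σ, hσ, hmin⟩ := exists_min_image (K i)
    (fun σ => (U.filter fun x => x i = σ).card) hKne
  have h3 : (K i).card * (U.filter fun x => x i = σ).card ≤ U.card := by
    calc (K i).card * (U.filter fun x => x i = σ).card
        = ∑ _τ ∈ K i, (U.filter fun x => x i = σ).card := by rw [sum_const, smul_eq_mul]
      _ ≤ ∑ τ ∈ K i, (U.filter fun x => x i = τ).card := sum_le_sum fun τ hτ => hmin τ hτ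
      _ ≤ U.card := by
        rw [← card_biUnion]
        · apply card_le_card
          intro x hx
          obtain ⟨τ, _, h⟩ := mem_biUnion.1 hx
          exact (mem_filter.1 h).1
        · intro a _ b _ hab
          rw [Function.onFun, disjoint_left]
          intro x hx hx'
          exact hab ((mem_filter.1 hx).2.symm.trans (mem_filter.1 hx').2)
  refine ⟨i, σ, (mem_erase.1 hσ).1, ?_, ?_⟩
  · obtain ⟨x, hx, hxσ⟩ := mem_image.1 (mem_erase.1 hσ).2
    exact ⟨x, mem_filter.2 ⟨hx, hxσ⟩⟩
  · have hU0 : (0 : ℝ) < U.card := by exact_mod_cast hUpos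
    have hK0 : (0 : ℝ) < (K i).card := by exact_mod_cast hKpos
    have h4 : (U.card : ℝ) ≤ (2 * (K i).card : ℝ) ^ c := by
      have : U.card ≤ (2 * (K i).card) ^ c :=
        calc U.card ≤ ((K i).card + 1) ^ c := by omega
          _ ≤ _ := Nat.pow_le_pow_left (by omega) _
      exact_mod_cast this
    have h5 : (U.card : ℝ) ^ (1 / (c : ℝ)) ≤ 2 * (K i).card := by
      have h6 := Real.rpow_le_rpow hU0.le h4 (by positivity : (0 : ℝ) ≤ 1 / (c : ℝ))
      rwa [one_div, Real.pow_rpow_inv_natCast (by positivity) (by omega), ← one_div] at h6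
    have h3' : ((K i).card : ℝ) * (U.filter fun x => x i = σ).card ≤ U.card := by
      exact_mod_cast h3
    rw [Real.rpow_sub hU0, Real.rpow_one]
    have h7 : (0 : ℝ) < (U.card : ℝ) ^ (1 / (c : ℝ)) := by positivity
    rw [← mul_div_assoc, le_div_iff₀ h7]
    have h8 : (0 : ℝ) ≤ (U.filter fun x => x i = σ).card := by positivity
    nlinarith

end Rec

section Bounds
variable {c s r : ℕ}

lemma one_sub_ge {y : ℝ} (h0 : 0 ≤ y) (h1 : y ≤ 1 / 2) : Real.exp (-y - y ^ 2) ≤ 1 - y := by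
  have hz : 0 ≤ y + y ^ 2 := by positivity
  have h := Real.quadratic_le_exp_of_nonneg hz
  have h2 : -y - y ^ 2 = -(y + y ^ 2) := by ring
  rw [h2, Real.exp_neg, inv_le_comm₀ (Real.exp_pos _) (by linarith)]
  refine le_trans ?_ h
  rw [inv_le_iff_one_le_mul₀ (by linarith)]
  have h3 : 0 ≤ y ^ 2 * ((1 - y) * (1 + y) ^ 2 / 2 - y) := by
    apply mul_nonneg (by positivity)
    nlinarith [mul_nonneg h0 (sub_nonneg.2 h1), mul_nonneg (mul_nonneg h0 h0) (sub_nonneg.2 h1)]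
  nlinarith

lemma A_empty (p : ℕ) (T : Fin c → Bits s → Bits r) : A p ∅ T = 1 := by
  unfold A; simp

lemma card_split (U : Finset (Fin c → Bits s)) (i : Fin c) (σ : Bits s) :
    (U.card : ℝ) = (U.filter fun x => x i = σ).card + (U.filter fun x => x i ≠ σ).card := by
  exact_mod_cast (card_filter_add_card_filter_not (s := U) (fun x => x i = σ)).symm

lemma rec_aux (hc : 1 ≤ c) (q : Fin c → Bits s) (g : ℝ) (F : Finset (Fin c → Bits s) → Prop)
    (h0 : F ∅)
    (hs : ∀ U i σ, q ∉ U → σ ≠ q i → ((U.filter fun x => x i = σ).card : ℝ) ≤ g →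
      F (U.filter fun x => x i ≠ σ) → F U) :
    ∀ U : Finset (Fin c → Bits s), q ∉ U → 2 * (U.card : ℝ) ^ (1 - 1 / (c : ℝ)) ≤ g → F U := by
  intro U
  induction U using Finset.strongInduction with
  | H U ih =>
    intro hq hg
    rcases U.eq_empty_or_nonempty with rfl | hU
    · exact h0
    obtain ⟨i, σ, hσ, hne, hcard⟩ := exists_group hc U q hq hU
    refine hs U i σ hq hσ (hcard.trans hg) (ih _ ?_ ?_ ?_)
    · obtain ⟨x, hx⟩ := hne
      rw [filter_ssubset]
      exact ⟨x, (mem_filter.1 hx).1, by simpa using (mem_filter.1 hx).2⟩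
    · exact fun h => hq (mem_filter.1 h).1
    · refine le_trans ?_ hg
      apply mul_le_mul_of_nonneg_left _ (by norm_num)
      apply Real.rpow_le_rpow (by positivity)
      · exact_mod_cast card_filter_le _ _
      · have : (1 : ℝ) ≤ c := by exact_mod_cast hc
        have : 1 / (c : ℝ) ≤ 1 := (div_le_one (by linarith)).2 this
        linarith

lemma lower_bound (hc : 1 ≤ c) (q : Fin c → Bits s) (g t : ℝ) (p' p : ℕ) (hp : p ≤ 2 ^ r)
    (ht : t = (p : ℝ) / 2 ^ r) (htg : t * g ≤ 1 / 2)
    (U : Finset (Fin c → Bits s)) (hq : q ∉ U)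
    (hg : 2 * (U.card : ℝ) ^ (1 - 1 / (c : ℝ)) ≤ g) :
    Ex (Q p' q (r := r)) * Real.exp (-(t * U.card) - t ^ 2 * g * U.card) ≤
      Ex (fun T : Fin c → Bits s → Bits r => Q p' q T * A p U T) := by
  have ht0 : 0 ≤ t := by rw [ht]; positivity
  have ha : 0 ≤ Ex (Q p' q (r := r)) := Ex_nonneg fun T => Q_nonneg _ _ _
  refine rec_aux hc q g (fun U => Ex (Q p' q (r := r)) *
    Real.exp (-(t * U.card) - t ^ 2 * g * U.card) ≤
      Ex (fun T : Fin c → Bits s → Bits r => Q p' q T * A p U T)) ?_ ?_ U hq hg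
  · simp [A_empty]
  · intro U i σ hq hσ hG ih
    have h := step_lower (r := r) (fun T => Q p' q T) (fun T => Q_nonneg _ _ _) p hp U i σ
      (fun T v => Q_inv _ _ _ _ hσ.symm)
    rw [← ht] at h
    refine le_trans ?_ h
    rw [card_split U i σ]
    set k : ℝ := ((U.filter fun x => x i = σ).card : ℝ)
    set l : ℝ := ((U.filter fun x => x i ≠ σ).card : ℝ)
    have hk0 : 0 ≤ k := Nat.cast_nonneg _
    have hy : t * k ≤ 1 / 2 := (mul_le_mul_of_nonneg_left hG ht0).trans htg
    have h1 := one_sub_ge (mul_nonneg ht0 hk0) hy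
    have h2 : Real.exp (-(t * (k + l)) - t ^ 2 * g * (k + l)) ≤
        Real.exp (-(t * k) - (t * k) ^ 2) * Real.exp (-(t * l) - t ^ 2 * g * l) := by
      rw [← Real.exp_add]
      apply Real.exp_le_exp.2
      have : t ^ 2 * (k * k) ≤ t ^ 2 * (g * k) :=
        mul_le_mul_of_nonneg_left (mul_le_mul_of_nonneg_right hG hk0) (by positivity)
      nlinarith
    calc _ ≤ Ex (Q p' q (r := r)) * (Real.exp (-(t * k) - (t * k) ^ 2) *
          Real.exp (-(t * l) - t ^ 2 * g * l)) := mul_le_mul_of_nonneg_left h2 ha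
      _ = Real.exp (-(t * k) - (t * k) ^ 2) *
          (Ex (Q p' q (r := r)) * Real.exp (-(t * l) - t ^ 2 * g * l)) := by ring
      _ ≤ _ := mul_le_mul h1 ih (by positivity) (by linarith)

lemma upper_bound (hc : 1 ≤ c) (q : Fin c → Bits s) (g t : ℝ) (p' p : ℕ) (hp : p ≤ 2 ^ r)
    (ht : t = (p : ℝ) / 2 ^ r) (htg : t * g ≤ 1 / 2) (hg0 : 0 ≤ g)
    (U : Finset (Fin c → Bits s)) (hq : q ∉ U)
    (hg : 2 * (U.card : ℝ) ^ (1 - 1 / (c : ℝ)) ≤ g) :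
      Ex (fun T : Fin c → Bits s → Bits r => Q p' q T * A p U T) ≤
    Ex (Q p' q (r := r)) * (Real.exp (-(t * U.card)) + t * g) := by
  have ht0 : 0 ≤ t := by rw [ht]; positivity
  have ha : 0 ≤ Ex (Q p' q (r := r)) := Ex_nonneg fun T => Q_nonneg _ _ _
  refine rec_aux hc q g (fun U => 
      Ex (fun T : Fin c → Bits s → Bits r => Q p' q T * A p U T) ≤
    Ex (Q p' q (r := r)) * (Real.exp (-(t * U.card)) + t * g)) ?_ ?_ U hq hg
  · simp only [A_empty, mul_one, card_empty, Nat.cast_zero, mul_zero, neg_zero, Real.exp_zero]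
    have : 0 ≤ Ex (Q p' q (r := r)) * (t * g) := by positivity
    change Ex (Q p' q (r := r)) ≤ _
    linarith
  · intro U i σ hq hσ hG ih
    have h := step_upper (r := r) q p' p hp U hq i σ hσ
    rw [← ht] at h
    refine h.trans ?_
    rw [card_split U i σ]
    set k : ℝ := ((U.filter fun x => x i = σ).card : ℝ)
    set l : ℝ := ((U.filter fun x => x i ≠ σ).card : ℝ)
    have hk0 : 0 ≤ k := Nat.cast_nonneg _
    have hy : t * k ≤ 1 / 2 := (mul_le_mul_of_nonneg_left hG ht0).trans htg
    have h1 : (1 - t * k) * Real.exp (-(t * l)) ≤ Real.exp (-(t * (k + l))) := by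
      have : -(t * (k + l)) = -(t * k) + -(t * l) := by ring
      rw [this, Real.exp_add]
      apply mul_le_mul_of_nonneg_right _ (Real.exp_pos _).le
      have := Real.add_one_le_exp (-(t * k))
      linarith
    have h2 : (1 - t * k) * (t * g) + (t * k) ^ 2 ≤ t * g := by
      have : (t * k) * (t * k) ≤ (t * k) * (t * g) :=
        mul_le_mul_of_nonneg_left (mul_le_mul_of_nonneg_left hG ht0) (by positivity)
      nlinarith
    calc _ ≤ (1 - t * k) * (Ex (Q p' q (r := r)) * (Real.exp (-(t * l)) + t * g)) +
          Ex (Q p' q (r := r)) * (t * k) ^ 2 :=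
          by
            have := mul_le_mul_of_nonneg_left ih (by linarith : 0 ≤ 1 - t * k)
            linarith
      _ = Ex (Q p' q (r := r)) * ((1 - t * k) * Real.exp (-(t * l)) +
          ((1 - t * k) * (t * g) + (t * k) ^ 2)) := by ring
      _ ≤ _ := mul_le_mul_of_nonneg_left (add_le_add h1 h2) ha

lemma tail_bound (hc : 1 ≤ c) (q : Fin c → Bits s) (g t : ℝ) (p : ℕ) (hp : p ≤ 2 ^ r)
    (ht : t = (p : ℝ) / 2 ^ r) (htg : t * g ≤ 1 / 2) (hg0 : 0 ≤ g) (u : ℕ) (hu : 1 ≤ u)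
    (U : Finset (Fin c → Bits s)) (hq : q ∉ U)
    (hg : 2 * (U.card : ℝ) ^ (1 - 1 / (c : ℝ)) ≤ g) :
      Ex (A p U (r := r)) ≤
      Real.exp (-(t * U.card / (u : ℝ) ^ c)) + U.card * (t * g) ^ (u + 1) := by
  have ht0 : 0 ≤ t := by rw [ht]; positivity
  have hD : (1 : ℝ) ≤ (u : ℝ) ^ c := one_le_pow₀ (by exact_mod_cast hu)
  refine rec_aux hc q g (fun U => Ex (A p U (r := r)) ≤
      Real.exp (-(t * U.card / (u : ℝ) ^ c)) + U.card * (t * g) ^ (u + 1)) ?_ ?_ U hq hg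
  · simp only [card_empty, Nat.cast_zero, mul_zero, neg_zero, Real.exp_zero, zero_div, zero_mul]
    have : A p ∅ (r := r) = fun _ : Fin c → Bits s → Bits r => 1 := by
      funext T; exact A_empty p T
    rw [this, Ex_one]; norm_num
  · intro U i σ hq hσ hG ih
    have h := step_tail (r := r) hc p hp U i σ u hu
    rw [← ht] at h
    refine h.trans ?_
    rw [card_split U i σ]
    set k : ℝ := ((U.filter fun x => x i = σ).card : ℝ)
    set l : ℝ := ((U.filter fun x => x i ≠ σ).card : ℝ)
    set D : ℝ := (u : ℝ) ^ c
    have hk0 : 0 ≤ k := Nat.cast_nonneg _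
    have hl0 : 0 ≤ l := Nat.cast_nonneg _
    have hy : t * k ≤ 1 / 2 := (mul_le_mul_of_nonneg_left hG ht0).trans htg
    have hyD : t * k / D ≤ 1 := by
      rw [div_le_one (by linarith)]; linarith
    have hyD0 : 0 ≤ t * k / D := by positivity
    have h1 : (1 - t * k / D) * Real.exp (-(t * l / D)) ≤ Real.exp (-(t * (k + l) / D)) := by
      have : -(t * (k + l) / D) = -(t * k / D) + -(t * l / D) := by ring
      rw [this, Real.exp_add]
      apply mul_le_mul_of_nonneg_right _ (Real.exp_pos _).le
      have := Real.add_one_le_exp (-(t * k / D))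
      linarith
    have hE : 0 ≤ (t * g) ^ (u + 1) := by positivity
    have h2 : (t * k) ^ (u + 1) ≤ (t * g) ^ (u + 1) :=
      pow_le_pow_left₀ (by positivity) (mul_le_mul_of_nonneg_left hG ht0) _
    have h3 := mul_le_mul_of_nonneg_left ih (by linarith : 0 ≤ 1 - t * k / D)
    have h4 : (1 - t * k / D) * (l * (t * g) ^ (u + 1)) ≤ l * (t * g) ^ (u + 1) :=
      mul_le_of_le_one_left (by positivity) (by linarith)
    have h5 := mul_le_mul_of_nonneg_left h2 hk0
    nlinarith

lemma decomp_aux (q : Fin c → Bits s) (U : Finset (Fin c → Bits s)) (L : ℕ)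
    (T : Fin c → Bits s → Bits r) :
    ∑ p ∈ range L, Q p q T * A p U T =
      if bitsToNat (simpleTab T q) < L then A (bitsToNat (simpleTab T q)) U T else 0 := by
  unfold Q
  simp only [ite_mul, one_mul, zero_mul]
  rw [sum_ite_eq]
  simp

lemma Pr_eq (q : Fin c → Bits s) (S : Finset (Fin c → Bits s)) :
    Pr (fun T : Fin c → Bits s → Bits r =>
      ∀ x ∈ S, bitsToNat (simpleTab T q) ≤ bitsToNat (simpleTab T x)) =
    Ex (fun T : Fin c → Bits s → Bits r => A (bitsToNat (simpleTab T q)) (S.erase q) T) := by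
  unfold Pr Ex
  congr 1
  rw [← sum_boole]
  refine sum_congr rfl fun T _ => ?_
  unfold A
  congr 1
  apply propext
  constructor
  · intro h x hx; exact h x (mem_of_mem_erase hx)
  · intro h x hx
    by_cases hxq : x = q
    · rw [hxq]
    · exact h x (mem_erase.2 ⟨hxq, hx⟩)

lemma decomp_lower (q : Fin c → Bits s) (U : Finset (Fin c → Bits s)) (L : ℕ) :
    ∑ p ∈ range L, Ex (fun T : Fin c → Bits s → Bits r => Q p q T * A p U T) ≤
    Ex (fun T : Fin c → Bits s → Bits r => A (bitsToNat (simpleTab T q)) U T) := by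
  rw [← Ex_sum]
  apply Ex_mono
  intro T
  rw [decomp_aux]
  split_ifs
  · exact le_rfl
  · exact A_nonneg _ _ _

lemma decomp_upper (q : Fin c → Bits s) (U : Finset (Fin c → Bits s)) (L : ℕ) :
    Ex (fun T : Fin c → Bits s → Bits r => A (bitsToNat (simpleTab T q)) U T) ≤
    ∑ p ∈ range L, Ex (fun T : Fin c → Bits s → Bits r => Q p q T * A p U T) +
      Ex (A L U (r := r)) := by
  rw [← Ex_sum, ← Ex_add]
  apply Ex_mono
  intro T
  rw [decomp_aux]
  split_ifs with h
  · have := A_nonneg L U T; linarith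
  · push Not at h
    rw [zero_add]
    unfold A
    split_ifs with h1 h2 h2
    · exact le_rfl
    · exact absurd (fun x hx => h.trans (h1 x hx)) h2
    · norm_num
    · exact le_rfl

lemma Ex_A_le_one (q : Fin c → Bits s) (U : Finset (Fin c → Bits s)) :
    Ex (fun T : Fin c → Bits s → Bits r => A (bitsToNat (simpleTab T q)) U T) ≤ 1 :=
  (Ex_mono fun T => A_le _ _ _).trans_eq Ex_one

lemma geom_upper (m N : ℝ) (hm : 0 < m) (hN : 0 < N) (L : ℕ) :
    ∑ p ∈ range L, 1 / m * Real.exp (-((p : ℝ) / m * N)) ≤ 1 / N + 1 / m := by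
  have hy : 0 < N / m := by positivity
  have hr : Real.exp (-(N / m)) < 1 := by rw [Real.exp_lt_one_iff]; linarith
  have h1 : ∀ p : ℕ, Real.exp (-((p : ℝ) / m * N)) = Real.exp (-(N / m)) ^ p := by
    intro p; rw [← Real.exp_nat_mul]; congr 1; ring
  rw [← mul_sum]
  simp only [h1]
  have h2 : ∑ p ∈ range L, Real.exp (-(N / m)) ^ p ≤ 1 / (1 - Real.exp (-(N / m))) := by
    rw [le_div_iff₀ (by linarith), geom_sum_mul_neg]
    have : 0 < Real.exp (-(N / m)) ^ L := by positivity
    linarith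
  have h3 : 1 / (1 - Real.exp (-(N / m))) ≤ m / N + 1 := by
    rw [div_le_iff₀ (by linarith)]
    have h4 : Real.exp (-(N / m)) ≤ 1 / (1 + N / m) := by
      rw [Real.exp_neg, one_div]
      apply inv_anti₀ (by positivity)
      have := Real.add_one_le_exp (N / m); linarith
    have h5 : (m / N + 1) * (1 - 1 / (1 + N / m)) = 1 := by
      have : m + N ≠ 0 := by positivity
      have : N + m ≠ 0 := by positivity
      field_simp
      ring
    refine h5.symm.le.trans ?_
    apply mul_le_mul_of_nonneg_left _ (by positivity)
    linarith
  calc _ ≤ 1 / m * (m / N + 1) := mul_le_mul_of_nonneg_left (h2.trans h3) (by positivity)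
    _ = _ := by field_simp

lemma geom_lower (m n : ℝ) (hm : 0 < m) (hn : 0 < n) (L : ℕ) :
    1 / n * (1 - Real.exp (-((L : ℝ) / m * n))) ≤
    ∑ p ∈ range L, 1 / m * Real.exp (-((p : ℝ) / m * n)) := by
  have hy : 0 < n / m := by positivity
  have hr : Real.exp (-(n / m)) < 1 := by rw [Real.exp_lt_one_iff]; linarith
  have h1 : ∀ p : ℕ, Real.exp (-((p : ℝ) / m * n)) = Real.exp (-(n / m)) ^ p := by
    intro p; rw [← Real.exp_nat_mul]; congr 1; ring
  rw [← mul_sum]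
  simp only [h1]
  rw [← geom_sum_mul_neg]
  have h2 : 0 ≤ ∑ p ∈ range L, Real.exp (-(n / m)) ^ p :=
    sum_nonneg fun p _ => by positivity
  have h3 : 1 - Real.exp (-(n / m)) ≤ n / m := by
    have := Real.add_one_le_exp (-(n / m)); linarith
  calc _ ≤ 1 / n * ((∑ p ∈ range L, Real.exp (-(n / m)) ^ p) * (n / m)) := by gcongr
    _ = _ := by field_simp

end Bounds

section Final
variable {c s r : ℕ}

lemma inv_aux (n : ℝ) (hn : 3 ≤ n) : 1 / (n - 1) - 1 / n ≤ 2 * (1 / (n * n)) := by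
  have h1 : 0 < n - 1 := by linarith
  have h2 : 0 < n := by linarith
  rw [div_sub_div _ _ h1.ne' h2.ne', mul_one_div, div_le_div_iff₀ (by positivity) (by positivity)]
  nlinarith [mul_nonneg h2.le (by linarith : 0 ≤ n - 2)]

lemma large (hc : 1 ≤ c) (S : Finset (Fin c → Bits s)) (q : Fin c → Bits s) (hqS : q ∈ S)
    (n z D ℓ : ℝ) (hn : n = S.card) (hz : z = n ^ (1 / (c : ℝ))) (hD : D = ((4 * c - 1 : ℕ) : ℝ) ^ c)
    (hℓ : ℓ = 4 * D * Real.log n) (hn3 : 3 ≤ n) (hm : n * z ≤ (2 : ℝ) ^ r)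
    (hbig : (8 * ℓ) ^ (4 * c) ≤ n) :
    |Ex (fun T : Fin c → Bits s → Bits r => A (bitsToNat (simpleTab T q)) (S.erase q) T) - 1 / n|
      ≤ (5 + 8 * ℓ ^ 2) / (n * z) := by
  have hn0 : 0 < n := by linarith
  have hcR : (1 : ℝ) ≤ c := by exact_mod_cast hc
  have hlog : 1 ≤ Real.log n := by
    rw [Real.le_log_iff_exp_le hn0]
    have := Real.exp_one_lt_d9; linarith
  have hD1 : 1 ≤ D := by
    rw [hD]; apply one_le_pow₀; exact_mod_cast (by omega : 1 ≤ 4 * c - 1)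
  have hℓ1 : 4 * D * 1 ≤ ℓ := by
    rw [hℓ]; exact mul_le_mul_of_nonneg_left hlog (by linarith)
  have hℓlog : 4 * 1 * Real.log n ≤ ℓ := by
    rw [hℓ]; nlinarith
  have hℓ4 : 4 ≤ ℓ := by linarith
  have hzc : z ^ c = n := by
    rw [hz, one_div, Real.rpow_inv_natCast_pow hn0.le (by omega)]
  have hz0 : 0 < z := by rw [hz]; positivity
  have hz1 : 1 ≤ z := by
    rw [hz]; exact Real.one_le_rpow (by linarith) (by positivity)
  have hzn : z ≤ n := by
    calc z = z ^ 1 := (pow_one z).symm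
      _ ≤ z ^ c := pow_le_pow_right₀ hz1 hc
      _ = n := hzc
  have h8z : 8 * ℓ ≤ z := by
    have : (8 * ℓ) ^ c ≤ z ^ c := by
      rw [hzc]
      exact (pow_le_pow_right₀ (by linarith) (by omega)).trans hbig
    exact le_of_pow_le_pow_left₀ (by omega) hz0.le this
  set m : ℝ := (2 : ℝ) ^ r with hmdef
  have hm0 : 0 < m := by positivity
  have hnm : n ≤ m := by nlinarith
  obtain ⟨U, hU⟩ : ∃ U, U = S.erase q := ⟨_, rfl⟩
  have hqU : q ∉ U := by rw [hU]; exact notMem_erase q S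
  have hUcard : (U.card : ℝ) = n - 1 := by
    have := card_erase_add_one hqS
    rw [hn, hU, ← this]; push_cast; ring
  set g : ℝ := 2 * n / z with hgdef
  have hg0 : 0 ≤ g := by positivity
  have hg : 2 * (U.card : ℝ) ^ (1 - 1 / (c : ℝ)) ≤ g := by
    have h1 : (U.card : ℝ) ^ (1 - 1 / (c : ℝ)) ≤ n ^ (1 - 1 / (c : ℝ)) := by
      apply Real.rpow_le_rpow (by positivity) (by linarith)
      have : 1 / (c : ℝ) ≤ 1 := (div_le_one (by linarith)).2 hcR
      linarith
    rw [Real.rpow_sub hn0, Real.rpow_one, ← hz] at h1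
    rw [hgdef, mul_div_assoc]; linarith
  set L : ℕ := ⌈ℓ * m / n⌉₊ with hL
  set τ : ℝ := (L : ℝ) / m with hτ
  have hτ0 : 0 ≤ τ := by positivity
  have hτ1 : ℓ / n ≤ τ := by
    rw [hτ, le_div_iff₀ hm0]
    refine le_trans (le_of_eq ?_) (Nat.le_ceil _)
    ring
  have hτ2 : τ ≤ 2 * ℓ / n := by
    rw [hτ, div_le_iff₀ hm0]
    have h1 := (Nat.ceil_lt_add_one (by positivity : 0 ≤ ℓ * m / n)).le
    have h2 : 1 ≤ ℓ * m / n := by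
      rw [le_div_iff₀ hn0]; nlinarith
    have h3 : 2 * ℓ / n * m = ℓ * m / n + ℓ * m / n := by ring
    rw [h3]; linarith
  have hLm : L ≤ 2 ^ r := by
    have h1 : τ ≤ 1 := hτ2.trans (by rw [div_le_one hn0]; linarith)
    rw [hτ, div_le_one hm0, hmdef] at h1
    exact_mod_cast h1
  have hτg : τ * g ≤ 4 * ℓ / z := by
    calc τ * g ≤ 2 * ℓ / n * g := mul_le_mul_of_nonneg_right hτ2 hg0
      _ = 4 * ℓ / z := by rw [hgdef]; field_simp; ring
  have hτg2 : τ * g ≤ 1 / 2 := hτg.trans (by rw [div_le_div_iff₀ hz0 (by norm_num)]; linarith)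
  have htτ : ∀ p ∈ range L, (p : ℝ) / m ≤ τ := by
    intro p hp
    rw [hτ]
    apply div_le_div_of_nonneg_right _ hm0.le
    exact_mod_cast (mem_range.1 hp).le
  have hτ2g : τ ^ 2 * g ≤ 8 * ℓ ^ 2 / (n * z) := by
    calc τ ^ 2 * g = τ * (τ * g) := by ring
      _ ≤ 2 * ℓ / n * (4 * ℓ / z) := mul_le_mul hτ2 hτg (by positivity) (by positivity)
      _ = _ := by field_simp; ring
  have hnn : 1 / (n * n) ≤ 1 / (n * z) := by
    apply one_div_le_one_div_of_le (by positivity); nlinarith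
  have hmz : 1 / m ≤ 1 / (n * z) := one_div_le_one_div_of_le (by positivity) hm
  have hsplit : (5 + 8 * ℓ ^ 2) / (n * z) = 5 * (1 / (n * z)) + 8 * ℓ ^ 2 / (n * z) := by ring
  have hexplog : Real.exp (-Real.log n) = 1 / n := by
    rw [Real.exp_neg, Real.exp_log hn0, one_div]
  rw [hsplit, ← hU, abs_le]
  constructor
  · -- lower bound
    have h1 := decomp_lower (r := r) q U L
    have h2 : ∀ p ∈ range L, Real.exp (-(τ ^ 2 * g * n)) * (1 / m * Real.exp (-((p : ℝ) / m * n)))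
        ≤ Ex (fun T : Fin c → Bits s → Bits r => Q p q T * A p U T) := by
      intro p hp
      have hpL := mem_range.1 hp
      have ht := htτ p hp
      have h3 := lower_bound (r := r) hc q g ((p : ℝ) / m) p p (by omega) rfl
        ((mul_le_mul_of_nonneg_right ht hg0).trans hτg2) U hqU hg
      rw [Ex_Q hc q p (by omega), ← hmdef] at h3
      refine le_trans ?_ h3
      rw [mul_left_comm, ← Real.exp_add]
      apply mul_le_mul_of_nonneg_left _ (by positivity)
      apply Real.exp_le_exp.2
      have hp0 : 0 ≤ (p : ℝ) / m := by positivity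
      have h4 : ((p : ℝ) / m) ^ 2 * g * U.card ≤ τ ^ 2 * g * n := by
        have : (U.card : ℝ) ≤ n := by linarith
        gcongr
      have h5 : (p : ℝ) / m * U.card ≤ (p : ℝ) / m * n :=
        mul_le_mul_of_nonneg_left (by linarith) hp0
      linarith
    have h6 := sum_le_sum h2
    rw [← mul_sum] at h6
    have h7 := geom_lower m n hm0 hn0 L
    have h8 : Real.exp (-((L : ℝ) / m * n)) ≤ 1 / n := by
      rw [← hexplog]
      apply Real.exp_le_exp.2
      have : ℓ ≤ τ * n := by rwa [div_le_iff₀ hn0] at hτ1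
      rw [← hτ]; linarith
    set b : ℝ := τ ^ 2 * g * n with hb
    have hb0 : 0 ≤ b := by positivity
    have hexpb : 1 - b ≤ Real.exp (-b) := by
      have := Real.add_one_le_exp (-b); linarith
    have h9 : 1 / n * (1 - 1 / n) ≤ ∑ p ∈ range L, 1 / m * Real.exp (-((p : ℝ) / m * n)) := by
      refine le_trans ?_ h7
      apply mul_le_mul_of_nonneg_left _ (by positivity)
      linarith
    have hn1 : 0 ≤ 1 - 1 / n := by
      rw [sub_nonneg, div_le_one hn0]; linarith
    have h10 : (1 - b) * (1 / n * (1 - 1 / n)) ≤ Real.exp (-b) * ∑ p ∈ range L,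
        1 / m * Real.exp (-((p : ℝ) / m * n)) :=
      mul_le_mul hexpb h9 (by positivity) (Real.exp_pos _).le
    have h11 : 1 / n - 1 / (n * n) - τ ^ 2 * g ≤ (1 - b) * (1 / n * (1 - 1 / n)) := by
      have e1 : (1 - b) * (1 / n * (1 - 1 / n)) =
          1 / n - 1 / (n * n) - τ ^ 2 * g + b * (1 / (n * n)) := by
        rw [hb]; field_simp; ring
      rw [e1]
      have : 0 ≤ b * (1 / (n * n)) := by positivity
      linarith
    have : 0 ≤ 1 / (n * z) := by positivity
    linarith
  · -- upper bound
    have h1 := decomp_upper (r := r) q U L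
    have hN0 : 0 < n - 1 := by linarith
    have h2 : ∀ p ∈ range L, Ex (fun T : Fin c → Bits s → Bits r => Q p q T * A p U T) ≤
        1 / m * Real.exp (-((p : ℝ) / m * (n - 1))) + 1 / m * (τ * g) := by
      intro p hp
      have hpL := mem_range.1 hp
      have ht := htτ p hp
      have h3 := upper_bound (r := r) hc q g ((p : ℝ) / m) p p (by omega) rfl
        ((mul_le_mul_of_nonneg_right ht hg0).trans hτg2) hg0 U hqU hg
      rw [Ex_Q hc q p (by omega), ← hmdef, hUcard] at h3
      refine h3.trans ?_
      rw [mul_add]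
      have := mul_le_mul_of_nonneg_left (mul_le_mul_of_nonneg_right ht hg0)
        (by positivity : 0 ≤ 1 / m)
      linarith
    have h6 := sum_le_sum h2
    rw [sum_add_distrib, sum_const, card_range, nsmul_eq_mul] at h6
    have h7 := geom_upper m (n - 1) hm0 hN0 L
    have e1 : (L : ℝ) * (1 / m * (τ * g)) = τ ^ 2 * g := by rw [hτ]; ring
    rw [e1] at h6
    have h8 := tail_bound (r := r) hc q g τ L hLm rfl hτg2 hg0 (4 * c - 1) (by omega) U hqU hg
    rw [← hD, hUcard, (by omega : 4 * c - 1 + 1 = 4 * c)] at h8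
    have h9 : Real.exp (-(τ * (n - 1) / D)) ≤ 1 / (n * n) := by
      have e2 : 1 / (n * n) = Real.exp (-(2 * Real.log n)) := by
        have : -(2 * Real.log n) = -Real.log n + -Real.log n := by ring
        rw [this, Real.exp_add, hexplog]; field_simp
      rw [e2]
      apply Real.exp_le_exp.2
      apply neg_le_neg
      rw [le_div_iff₀ (by linarith)]
      have h10 : ℓ / n * (n / 2) ≤ τ * (n - 1) :=
        mul_le_mul hτ1 (by linarith) (by positivity) hτ0
      have h11 : ℓ / n * (n / 2) = 2 * Real.log n * D := by
        rw [hℓ]; field_simp; ring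
      linarith
    have h12 : (n - 1) * (τ * g) ^ (4 * c) ≤ 1 / (n * n) := by
      have h13 : (τ * g) ^ (4 * c) ≤ (4 * ℓ / z) ^ (4 * c) :=
        pow_le_pow_left₀ (by positivity) hτg _
      have h14 : (4 * ℓ) ^ (4 * c) ≤ n :=
        (pow_le_pow_left₀ (by positivity) (by linarith) _).trans hbig
      have h15 : z ^ (4 * c) = n ^ 4 := by rw [mul_comm, pow_mul, hzc]
      rw [div_pow, h15] at h13
      calc (n - 1) * (τ * g) ^ (4 * c) ≤ n * (n / n ^ 4) := by
            apply mul_le_mul (by linarith) _ (by positivity) hn0.le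
            exact h13.trans (div_le_div_of_nonneg_right h14 (by positivity))
        _ = 1 / (n * n) := by field_simp
    have h16 : 1 / (n - 1) - 1 / n ≤ 2 * (1 / (n * n)) := inv_aux n hn3
    linarith

lemma exists_n0 (c : ℕ) (K : ℝ) : ∃ n0 : ℕ, ∀ n : ℕ, n0 ≤ n →
    (K * Real.log (n : ℝ)) ^ (4 * c) ≤ (n : ℝ) := by
  have h := (Real.isLittleO_pow_log_id_atTop (n := 4 * c)).comp_tendsto tendsto_natCast_atTop_atTop
  have hpos : 0 < (|K| ^ (4 * c) + 1)⁻¹ := by positivity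
  have h2 := h.bound hpos
  obtain ⟨n0, hn0⟩ := Filter.eventually_atTop.1 h2
  refine ⟨n0, fun n hn => ?_⟩
  have h3 := hn0 n hn
  simp only [Function.comp, id, Real.norm_eq_abs, Nat.abs_cast] at h3
  rw [inv_mul_eq_div, le_div_iff₀ (by positivity)] at h3
  refine (le_abs_self _).trans ?_
  rw [mul_pow, abs_mul, abs_pow K]
  have : 0 ≤ |Real.log (n : ℝ) ^ (4 * c)| := abs_nonneg _
  nlinarith

end Final

end STM

/-- Simple tabulation is `ε`-minwise independent (Theorem 4): for every
constant `c ≥ 1` there is a constant `C` such that for `n` keys `S`, `q ∈ S`, and a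
random simple tabulation function into `m = 2^r ≥ n^{1+1/c}` bins,
`Pr[h(q) = min h(S)] = (1 ± ε)/n` where `ε = C·(log n)²/n^{1/c}`.
(The event `h(q) = min h(S)` is expressed as: `h(q) ≤ h(x)` for all `x ∈ S`.) -/
theorem simple_tabulation_minwise (c : ℕ) (hc : 1 ≤ c) :
    ∃ C : ℝ,
      ∀ (s r : ℕ) (S : Finset (Fin c → Bits s)) (q : Fin c → Bits s),
        q ∈ S →
        (S.card : ℝ) ^ ((1 : ℝ) + 1 / (c : ℝ)) ≤ (2 : ℝ) ^ r →
        |Pr (fun T : Fin c → Bits s → Bits r =>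
              ∀ x ∈ S, bitsToNat (simpleTab T q) ≤ bitsToNat (simpleTab T x)) -
            1 / (S.card : ℝ)| ≤
          (C * Real.log (S.card) ^ 2 / (S.card : ℝ) ^ ((1 : ℝ) / (c : ℝ))) /
            (S.card : ℝ) := by
  classical
  set D : ℝ := ((4 * c - 1 : ℕ) : ℝ) ^ c with hD
  obtain ⟨n0, hn0⟩ := STM.exists_n0 c (8 * (4 * D))
  have hl2 : 0 < Real.log 2 := Real.log_pos (by norm_num)
  set C1 : ℝ := 5 + 128 * D ^ 2 with hC1
  set C2 : ℝ := ((n0 : ℝ) + 3) ^ 2 / Real.log 2 ^ 2 with hC2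
  have hC10 : 0 ≤ C1 := by positivity
  have hC20 : 0 ≤ C2 := by positivity
  refine ⟨C1 + C2, ?_⟩
  intro s r S q hq hm
  rw [STM.Pr_eq]
  have hcR : (1 : ℝ) ≤ c := by exact_mod_cast hc
  have hcard : 1 ≤ S.card := card_pos.2 ⟨q, hq⟩
  obtain ⟨n, hn⟩ : ∃ n : ℝ, n = S.card := ⟨_, rfl⟩
  have hn1 : 1 ≤ n := by rw [hn]; exact_mod_cast hcard
  have hnpos : 0 < n := by linarith
  obtain ⟨z, hz⟩ : ∃ z : ℝ, z = n ^ (1 / (c : ℝ)) := ⟨_, rfl⟩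
  have hz0 : 0 < z := by rw [hz]; positivity
  rw [← hn] at hm ⊢
  rw [Real.rpow_add hnpos, Real.rpow_one, ← hz] at hm
  rw [← hz, div_div, mul_comm z n]
  have hnz : 0 < n * z := by positivity
  by_cases hone : S.card = 1
  · have hS : S.erase q = ∅ := by
      apply card_eq_zero.1
      rw [card_erase_of_mem hq, hone]
    have hn' : n = 1 := by rw [hn, hone]; norm_num
    rw [hS]
    simp only [STM.A_empty, STM.Ex_one]
    rw [hn']
    simp
  have htwo : 2 ≤ S.card := by omega
  by_cases hbig : n0 + 3 ≤ S.card
  · have h3 : 3 ≤ n := by rw [hn]; exact_mod_cast (by omega : 3 ≤ S.card)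
    have h4 := STM.large hc S q hq n z D (4 * D * Real.log n) hn hz hD rfl h3 hm (by
      have := hn0 S.card (by omega)
      rw [← hn] at this
      rw [← mul_assoc]
      exact this)
    refine h4.trans ?_
    apply div_le_div_of_nonneg_right _ hnz.le
    have hlog : 1 ≤ Real.log n := by
      rw [Real.le_log_iff_exp_le hnpos]
      have := Real.exp_one_lt_d9; linarith
    have hlog2 : 1 ≤ Real.log n ^ 2 := one_le_pow₀ hlog
    have : 0 ≤ C2 * Real.log n ^ 2 := by positivity
    rw [hC1]
    nlinarith
  · have hlt : n ≤ (n0 : ℝ) + 3 := by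
      rw [hn]; exact_mod_cast (by omega : S.card ≤ n0 + 3)
    have hzn : z ≤ n := by
      rw [hz]
      calc n ^ (1 / (c : ℝ)) ≤ n ^ (1 : ℝ) :=
            Real.rpow_le_rpow_of_exponent_le hn1 ((div_le_one (by linarith)).2 hcR)
        _ = n := Real.rpow_one n
    have h1 := STM.Ex_A_le_one (r := r) q (S.erase q)
    have h2 : 0 ≤ STM.Ex (fun T : Fin c → Bits s → Bits r =>
        STM.A (bitsToNat (simpleTab T q)) (S.erase q) T) :=
      STM.Ex_nonneg fun T => STM.A_nonneg _ _ _
    have h3 : 1 / n ≤ 1 := (div_le_one hnpos).2 hn1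
    have h4 : 0 < 1 / n := by positivity
    have h5 : |STM.Ex (fun T : Fin c → Bits s → Bits r =>
        STM.A (bitsToNat (simpleTab T q)) (S.erase q) T) - 1 / n| ≤ 1 := by
      rw [abs_le]; constructor <;> linarith
    refine h5.trans ?_
    rw [le_div_iff₀ hnz, one_mul]
    have hlog : Real.log 2 ≤ Real.log n := by
      apply Real.log_le_log (by norm_num)
      rw [hn]; exact_mod_cast htwo
    have h6 : Real.log 2 ^ 2 ≤ Real.log n ^ 2 := pow_le_pow_left₀ hl2.le hlog 2
    have h7 : C2 * Real.log 2 ^ 2 = ((n0 : ℝ) + 3) ^ 2 := by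
      rw [hC2]; field_simp
    have h8 := mul_le_mul_of_nonneg_left h6 hC20
    have h9 : 0 ≤ C1 * Real.log n ^ 2 := by positivity
    have h10 : n * z ≤ ((n0 : ℝ) + 3) ^ 2 := by nlinarith
    linarith
end
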